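/- Let p, q be probability measures on ℝ^d with p absolutely continuous with respect to q, dp/dq ≤ 1/μ for some 0 < μ ≤ 1, and let α ≤ 1/2, α ∈ (0,1). Assume c = ∫_0^∞ sup_{x∈ℝ^d} ⟨φ(x), (Σ_p + βI)^{-1} φ(x)⟩_H² dβ is finite. Let p̂ and q̂ be empirical measures supported on n and m i.i.d. samples from p and q respectively. Then E| KKL_α(p̂||q̂) − KKL_α(p||q) | ≤ (35/√(m∧n)) · (1/(αμ)) · (2√c + log n) + (1/(m∧n)) · ( 1 + 1/μ + (c (24 log n)² / (α μ²)) (1 + n/(m∧n)) ). -/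

import Mathlib

open MeasureTheory RealInnerProductSpace
open scoped ENNReal

noncomputable section

universe u

/-- Rank-one operator `u v^*` : `f ↦ ⟪v, f⟫ • u`. -/
def rankOne {H : Type u} [NormedAddCommGroup H] [InnerProductSpace ℝ H] (u v : H) :
    H →L[ℝ] H := (innerSL ℝ v).smulRight u

/-- Covariance operator `Σ_p = ∫ φ(x) ⊗ φ(x) dp(x)`. -/
def covOp {d : ℕ} {H : Type u} [NormedAddCommGroup H] [InnerProductSpace ℝ H]
    [CompleteSpace H] (φ : EuclideanSpace ℝ (Fin d) → H)
    (p : Measure (EuclideanSpace ℝ (Fin d))) : H →L[ℝ] H :=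
  ∫ x, rankOne (φ x) (φ x) ∂p

/-- The empirical measure `(1/n) ∑ᵢ δ_{x_i}`. -/
def empMeas {d n : ℕ} (xs : Fin n → EuclideanSpace ℝ (Fin d)) :
    Measure (EuclideanSpace ℝ (Fin d)) :=
  (n : ℝ≥0∞)⁻¹ • ∑ i, Measure.dirac (xs i)

/-- `v` is the value of the regularized divergence
`KKL_α(p‖q) = Tr(Σ_p log Σ_p) - Tr(Σ_p log(αΣ_p + (1-α)Σ_q))`, expressed through
spectral decompositions of `Σ_p` and `αΣ_p + (1-α)Σ_q`. -/
def IsKKLa {d : ℕ} {H : Type u} [NormedAddCommGroup H] [InnerProductSpace ℝ H]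
    [CompleteSpace H] (φ : EuclideanSpace ℝ (Fin d) → H) (α : ℝ)
    (p q : Measure (EuclideanSpace ℝ (Fin d))) (v : ℝ) : Prop :=
  ∃ (ι : Type u) (f : HilbertBasis ι ℝ H) (lam : ι → ℝ)
    (g : HilbertBasis ι ℝ H) (gam : ι → ℝ),
    (∀ i, covOp φ p (f i) = lam i • f i) ∧ (∀ i, 0 ≤ lam i) ∧
    (∀ j, (α • covOp φ p + (1 - α) • covOp φ q) (g j) = gam j • g j) ∧ (∀ j, 0 ≤ gam j) ∧
    Summable (fun ij : ι × ι =>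
      lam ij.1 * Real.log (lam ij.1 / gam ij.2) * ⟪(f ij.1 : H), (g ij.2 : H)⟫ ^ 2) ∧
    v = ∑' ij : ι × ι,
      lam ij.1 * Real.log (lam ij.1 / gam ij.2) * ⟪(f ij.1 : H), (g ij.2 : H)⟫ ^ 2

namespace KKLp

section resolvent
variable {H : Type u} [NormedAddCommGroup H] [InnerProductSpace ℝ H]

/-- Symmetric positive semidefinite operators. -/
def PosOp (T : H →L[ℝ] H) : Prop :=
  (∀ a b : H, ⟪T a, b⟫ = ⟪a, T b⟫) ∧ ∀ a : H, 0 ≤ ⟪a, T a⟫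

lemma PosOp.add {S T : H →L[ℝ] H} (hS : PosOp S) (hT : PosOp T) : PosOp (S + T) := by
  refine ⟨fun a b => ?_, fun a => ?_⟩
  · simp [inner_add_left, inner_add_right, hS.1, hT.1]
  · simp only [ContinuousLinearMap.add_apply, inner_add_right]
    exact add_nonneg (hS.2 a) (hT.2 a)

lemma PosOp.smul {T : H →L[ℝ] H} (hT : PosOp T) {w : ℝ} (hw : 0 ≤ w) : PosOp (w • T) := by
  refine ⟨fun a b => ?_, fun a => ?_⟩
  · simp [inner_smul_left, inner_smul_right, hT.1]
  · simp only [ContinuousLinearMap.smul_apply, inner_smul_right]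
    exact mul_nonneg hw (hT.2 a)

lemma PosOp.zero : PosOp (0 : H →L[ℝ] H) := ⟨by simp, by simp⟩

lemma PosOp.sum {ι : Type*} (s : Finset ι) (T : ι → H →L[ℝ] H) (h : ∀ i ∈ s, PosOp (T i)) :
    PosOp (∑ i ∈ s, T i) := by
  classical
  induction s using Finset.induction_on with
  | empty => simpa using PosOp.zero
  | insert i s hi ih =>
    rw [Finset.sum_insert hi]
    exact (h i (by simp)).add (ih fun j hj => h j (by simp [hj]))

lemma rankOne_apply (a b f : H) : rankOne a b f = ⟪b, f⟫ • a := by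
  simp [rankOne]

lemma PosOp.rankOne (a : H) : PosOp (rankOne a a) := by
  refine ⟨fun x y => ?_, fun x => ?_⟩
  · simp only [rankOne_apply, inner_smul_left, inner_smul_right]
    simp [real_inner_comm, mul_comm]
  · simp only [rankOne_apply, inner_smul_right]
    rw [real_inner_comm a x]
    exact mul_self_nonneg _

/-- The resolvent `(T + β)⁻¹`. -/
def res (T : H →L[ℝ] H) (β : ℝ) : H →L[ℝ] H := Ring.inverse (T + β • 1)

variable [CompleteSpace H]

lemma PosOp.isUnit {T : H →L[ℝ] H} (hT : PosOp T) {β : ℝ} (hβ : 0 < β) :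
    IsUnit (T + β • (1 : H →L[ℝ] H)) := by
  refine ContinuousLinearMap.isUnit_of_forall_le_norm_inner_map _ (c := ⟨β, hβ.le⟩) hβ fun x => ?_
  have h1 : ⟪(T + β • (1 : H →L[ℝ] H)) x, x⟫ = ⟪x, T x⟫ + β * ‖x‖ ^ 2 := by
    simp [inner_add_left, inner_smul_left, real_inner_comm]
  rw [h1, Real.norm_eq_abs, abs_of_nonneg (add_nonneg (hT.2 x) (by positivity))]
  have := hT.2 x
  show ‖x‖ ^ 2 * β ≤ _
  nlinarith

lemma res_mul {T : H →L[ℝ] H} (hT : PosOp T) {β : ℝ} (hβ : 0 < β) :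
    res T β * (T + β • 1) = 1 := Ring.inverse_mul_cancel _ (hT.isUnit hβ)

lemma mul_res {T : H →L[ℝ] H} (hT : PosOp T) {β : ℝ} (hβ : 0 < β) :
    (T + β • 1) * res T β = 1 := Ring.mul_inverse_cancel _ (hT.isUnit hβ)

lemma res_eq {T : H →L[ℝ] H} (hT : PosOp T) {β : ℝ} (hβ : 0 < β) {R : H →L[ℝ] H}
    (h : R ∘L (T + β • 1) = 1) : R = res T β := by
  have h' : R * (T + β • 1) = 1 := h
  calc R = R * ((T + β • 1) * res T β) := by rw [mul_res hT hβ, mul_one]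
    _ = res T β := by rw [← mul_assoc, h', one_mul]

lemma mul_res_apply {T : H →L[ℝ] H} (hT : PosOp T) {β : ℝ} (hβ : 0 < β) (a : H) :
    T (res T β a) + β • res T β a = a := by
  have := congrArg (fun S : H →L[ℝ] H => S a) (mul_res hT hβ)
  simpa using this

lemma res_mul_apply {T : H →L[ℝ] H} (hT : PosOp T) {β : ℝ} (hβ : 0 < β) (a : H) :
    res T β (T a) + β • res T β a = a := by
  have := congrArg (fun S : H →L[ℝ] H => S a) (res_mul hT hβ)
  simpa using this

lemma res_symm {T : H →L[ℝ] H} (hT : PosOp T) {β : ℝ} (hβ : 0 < β) (a b : H) :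
    ⟪res T β a, b⟫ = ⟪a, res T β b⟫ := by
  conv_lhs => rw [← mul_res_apply hT hβ b]
  conv_rhs => rw [← mul_res_apply hT hβ a]
  simp [inner_add_left, inner_add_right, inner_smul_left, inner_smul_right, hT.1]

/-- `⟨a, R a⟩ = ⟨R a, T R a⟩ + β ‖R a‖²` -/
lemma res_quad {T : H →L[ℝ] H} (hT : PosOp T) {β : ℝ} (hβ : 0 < β) (a : H) :
    ⟪a, res T β a⟫ = ⟪res T β a, T (res T β a)⟫ + β * ‖res T β a‖ ^ 2 := by
  conv_lhs => rw [← mul_res_apply hT hβ a, map_add, map_smul]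
  have h := mul_res_apply hT hβ a
  have : res T β (T (res T β a)) + β • res T β (res T β a) = res T β a :=
    res_mul_apply hT hβ _
  rw [this, h, ]
  conv_lhs => rw [← h]
  rw [inner_add_left, inner_smul_left, real_inner_comm, h]
  simp

lemma res_nonneg {T : H →L[ℝ] H} (hT : PosOp T) {β : ℝ} (hβ : 0 < β) (a : H) :
    0 ≤ ⟪a, res T β a⟫ := by
  rw [res_quad hT hβ]
  exact add_nonneg (hT.2 _) (by positivity)

lemma res_quad_le {T : H →L[ℝ] H} (hT : PosOp T) {β : ℝ} (hβ : 0 < β) (a : H) :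
    ⟪res T β a, T (res T β a)⟫ ≤ ⟪a, res T β a⟫ := by
  rw [res_quad hT hβ a]
  have : 0 ≤ β * ‖res T β a‖ ^ 2 := by positivity
  linarith

/-- Cauchy-Schwarz for positive operators. -/
lemma PosOp.cs {S : H →L[ℝ] H} (hS : PosOp S) (a b : H) :
    ⟪a, S b⟫ ^ 2 ≤ ⟪a, S a⟫ * ⟪b, S b⟫ := by
  have hab : ⟪b, S a⟫ = ⟪a, S b⟫ := by rw [← hS.1, real_inner_comm]
  have key : ∀ t : ℝ, 0 ≤ ⟪b, S b⟫ * (t * t) + (2 * ⟪a, S b⟫) * t + ⟪a, S a⟫ := by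
    intro t
    have := hS.2 (a + t • b)
    simp only [map_add, map_smul, inner_add_left, inner_add_right, inner_smul_left,
      inner_smul_right, hab] at this
    simp at this
    nlinarith
  have := discrim_le_zero key
  unfold discrim at this
  nlinarith

lemma res_posOp {T : H →L[ℝ] H} (hT : PosOp T) {β : ℝ} (hβ : 0 < β) : PosOp (res T β) :=
  ⟨res_symm hT hβ, res_nonneg hT hβ⟩

lemma norm_res_le {T : H →L[ℝ] H} (hT : PosOp T) {β : ℝ} (hβ : 0 < β) (a : H) :
    ‖res T β a‖ ≤ ‖a‖ / β := by
  have h1 := res_quad hT hβ a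
  have h2 := hT.2 (res T β a)
  have h3 := real_inner_le_norm a (res T β a)
  rw [le_div_iff₀ hβ]
  by_cases h0 : ‖res T β a‖ = 0
  · rw [h0]; simp
  · have : 0 < ‖res T β a‖ := lt_of_le_of_ne (norm_nonneg _) (Ne.symm h0)
    have : ‖res T β a‖ * (‖res T β a‖ * β) ≤ ‖res T β a‖ * ‖a‖ := by nlinarith
    exact le_of_mul_le_mul_left this ‹_›

lemma abs_res_le {T : H →L[ℝ] H} (hT : PosOp T) {β : ℝ} (hβ : 0 < β) (a b : H) :
    |⟪a, res T β b⟫| ≤ ‖a‖ * ‖b‖ / β := by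
  calc _ ≤ ‖a‖ * ‖res T β b‖ := abs_real_inner_le_norm _ _
    _ ≤ ‖a‖ * (‖b‖ / β) := by gcongr; exact norm_res_le hT hβ b
    _ = _ := by ring

lemma res_le {T : H →L[ℝ] H} (hT : PosOp T) {β : ℝ} (hβ : 0 < β) (a : H) :
    ⟪a, res T β a⟫ ≤ ‖a‖ ^ 2 / β := by
  have := (le_abs_self _).trans (abs_res_le hT hβ a a)
  rwa [← sq] at this

/-- lower bound: `‖a‖⁴ ≤ ⟨a,Ra⟩ (⟨a,Ta⟩ + β‖a‖²)` -/
lemma res_lower {T : H →L[ℝ] H} (hT : PosOp T) {β : ℝ} (hβ : 0 < β) (a : H) :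
    (‖a‖ ^ 2) ^ 2 ≤ ⟪a, res T β a⟫ * (⟪a, T a⟫ + β * ‖a‖ ^ 2) := by
  have h := (res_posOp hT hβ).cs a (T a + β • a)
  have h1 : res T β (T a + β • a) = a := by
    rw [map_add, map_smul]; exact res_mul_apply hT hβ a
  rw [h1] at h
  simpa [inner_add_left, inner_smul_left, real_inner_comm] using h

/-- resolvent identity -/
lemma res_sub {S T : H →L[ℝ] H} (hS : PosOp S) (hT : PosOp T) {β : ℝ} (hβ : 0 < β) (a b : H) :
    ⟪a, res S β b⟫ - ⟪a, res T β b⟫ = ⟪res T β a, (T - S) (res S β b)⟫ := by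
  have e1 : ⟪a, res S β b⟫ = ⟪res T β a, T (res S β b)⟫ + β * ⟪res T β a, res S β b⟫ := by
    conv_lhs => rw [← mul_res_apply hT hβ a]
    simp [inner_add_left, inner_smul_left, hT.1]
  have e2 : ⟪a, res T β b⟫ = ⟪res T β a, S (res S β b)⟫ + β * ⟪res T β a, res S β b⟫ := by
    rw [← res_symm hT hβ]
    conv_lhs => rw [← mul_res_apply hS hβ b]
    simp [inner_add_right, inner_smul_right]
  rw [e1, e2, ContinuousLinearMap.sub_apply, inner_sub_right]
  ring

/-- antitonicity of the inverse -/
lemma res_anti {S T : H →L[ℝ] H} (hS : PosOp S) (hT : PosOp T) {β κ : ℝ} (hβ : 0 < β)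
    (hκ : 0 < κ) (h : ∀ a, κ * ⟪a, T a⟫ ≤ ⟪a, S a⟫) (a : H) :
    ⟪a, res S β a⟫ ≤ (1 / κ) * ⟪a, res T (β / κ) a⟫ := by
  have hβκ : 0 < β / κ := by positivity
  set x := res S β a with hx
  set y := res T (β / κ) a with hy
  have h1 : ⟪a, x⟫ = ⟪y, T x⟫ + (β / κ) * ⟪y, x⟫ := by
    conv_lhs => rw [← mul_res_apply hT hβκ a]
    simp [inner_add_left, inner_smul_left, hT.1, hy]
  -- `(T + β/κ)` is positive
  have hP : PosOp (T + (β / κ) • (1 : H →L[ℝ] H)) :=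
    hT.add (PosOp.smul ⟨by simp, by simp⟩ hβκ.le)
  have h2 := hP.cs y x
  have h3 : ⟪y, (T + (β / κ) • (1 : H →L[ℝ] H)) x⟫ = ⟪a, x⟫ := by
    rw [h1]; simp [inner_add_right, inner_smul_right]
  have h4 : ⟪y, (T + (β / κ) • (1 : H →L[ℝ] H)) y⟫ = ⟪a, y⟫ := by
    have := mul_res_apply hT hβκ a
    rw [← hy] at this
    rw [show (T + (β / κ) • (1 : H →L[ℝ] H)) y = a by simpa using this, real_inner_comm]
  have h5 : κ * ⟪x, (T + (β / κ) • (1 : H →L[ℝ] H)) x⟫ ≤ ⟪a, x⟫ := by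
    rw [hx, res_quad hS hβ a, ← hx]
    have := h x
    have e : κ * ⟪x, (T + (β / κ) • (1 : H →L[ℝ] H)) x⟫ = κ * ⟪x, T x⟫ + β * ‖x‖ ^ 2 := by
      simp [inner_add_right, inner_smul_right]
      field_simp
    linarith
  rw [h3, h4] at h2
  have hx0 : 0 ≤ ⟪a, x⟫ := res_nonneg hS hβ a
  have hy0 : 0 ≤ ⟪a, y⟫ := res_nonneg hT hβκ a
  rcases hx0.eq_or_lt with h0 | h0
  · rw [← h0]; positivity
  · have : κ * ⟪a, x⟫ ^ 2 ≤ ⟪a, y⟫ * ⟪a, x⟫ := by nlinarith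
    have : κ * ⟪a, x⟫ ≤ ⟪a, y⟫ := by nlinarith
    rw [one_div, ← div_eq_inv_mul, le_div_iff₀ hκ]; linarith

/-! rank-one updates -/

section rankone
variable {T S : H →L[ℝ] H} (hT : PosOp T) {β w : ℝ} (hβ : 0 < β) (hw : 0 ≤ w) (v : H)
  (hS : S = T + w • rankOne v v)
include hT hβ hw hS

lemma upd_pos : PosOp S := by
  rw [hS]; exact hT.add ((PosOp.rankOne v).smul hw)

/-- `⟨a, R₁ b⟩ = ⟨a, R b⟩ - w ⟨a, R v⟩ ⟨v, R₁ b⟩` -/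
lemma upd_eq (a b : H) :
    ⟪a, res S β b⟫ = ⟪a, res T β b⟫ - w * ⟪a, res T β v⟫ * ⟪v, res S β b⟫ := by
  have h := res_sub (upd_pos hT hβ hw v hS) hT hβ a b
  have e : (T - S) (res S β b) = -(w • (⟪v, res S β b⟫ • v)) := by
    rw [hS]; simp [rankOne_apply]
  rw [e, inner_neg_right, inner_smul_right, inner_smul_right, res_symm hT hβ] at h
  linarith

lemma upd_v (b : H) :
    ⟪v, res S β b⟫ * (1 + w * ⟪v, res T β v⟫) = ⟪v, res T β b⟫ := by
  have := upd_eq hT hβ hw v hS v b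
  linarith

lemma upd_abs_le (b : H) : |⟪v, res S β b⟫| ≤ |⟪v, res T β b⟫| := by
  rw [← upd_v hT hβ hw v hS b, abs_mul]
  have h0 := mul_nonneg hw (res_nonneg hT hβ v)
  rw [abs_of_nonneg (by linarith : (0:ℝ) ≤ 1 + w * ⟪v, res T β v⟫)]
  nlinarith [abs_nonneg ⟪v, res S β b⟫]

lemma upd_quad_le (a : H) : ⟪a, res S β a⟫ ≤ ⟪a, res T β a⟫ := by
  have h := upd_eq hT hβ hw v hS a a
  have h2 := upd_v hT hβ hw v hS a
  have h3 : ⟪a, res T β v⟫ = ⟪v, res T β a⟫ := by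
    rw [← res_symm hT hβ, real_inner_comm]
  rw [h3, ← h2] at h
  have h0 := mul_nonneg hw (res_nonneg hT hβ v)
  have : 0 ≤ w * (⟪v, res S β a⟫ * (1 + w * ⟪v, res T β v⟫)) * ⟪v, res S β a⟫ := by
    have : w * (⟪v, res S β a⟫ * (1 + w * ⟪v, res T β v⟫)) * ⟪v, res S β a⟫
      = w * (1 + w * ⟪v, res T β v⟫) * ⟪v, res S β a⟫ ^ 2 := by ring
    rw [this]; positivity
  linarith

/-- removing a point changes the quadratic form by a factor at most `1 + δ` -/
lemma upd_quad_ge (hv : ‖v‖ = 1) {δ : ℝ} (hδ : w ≤ δ * β) (a : H) :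
    ⟪a, res T β a⟫ ≤ (1 + δ) * ⟪a, res S β a⟫ := by
  have h := upd_eq hT hβ hw v hS a a
  have h2 := upd_v hT hβ hw v hS a
  have h3 : ⟪a, res T β v⟫ = ⟪v, res T β a⟫ := by
    rw [← res_symm hT hβ, real_inner_comm]
  have hcs := (res_posOp hT hβ).cs v a
  have hx0 := res_nonneg hT hβ v
  have hx1 : ⟪v, res T β v⟫ ≤ 1 / β := by simpa [hv] using res_le hT hβ v
  have hwx : w * ⟪v, res T β v⟫ ≤ δ := by
    calc _ ≤ w * (1 / β) := by gcongr
      _ ≤ δ := by rw [mul_one_div, div_le_iff₀ hβ]; exact hδ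
  have hwx0 := mul_nonneg hw hx0
  have hz := res_nonneg hT hβ a
  have hz' := res_nonneg (upd_pos hT hβ hw v hS) hβ a
  rw [h3] at h
  set x := ⟪v, res T β v⟫
  set z := ⟪a, res T β a⟫
  set z' := ⟪a, res S β a⟫
  set b := ⟪v, res S β a⟫
  set b0 := ⟪v, res T β a⟫
  have e : (1 + w * x) * z' = (1 + w * x) * z - w * b0 ^ 2 := by
    rw [h, ← h2]; ring
  have : w * b0 ^ 2 ≤ w * (x * z) := by gcongr
  have : z ≤ (1 + w * x) * z' := by rw [e]; nlinarith
  nlinarith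

lemma upd_abs_ge (hv : ‖v‖ = 1) {δ : ℝ} (hδ : w ≤ δ * β) (b : H) :
    |⟪v, res T β b⟫| ≤ (1 + δ) * |⟪v, res S β b⟫| := by
  have hx0 := res_nonneg hT hβ v
  have hx1 : ⟪v, res T β v⟫ ≤ 1 / β := by simpa [hv] using res_le hT hβ v
  have hwx : w * ⟪v, res T β v⟫ ≤ δ := by
    calc _ ≤ w * (1 / β) := by gcongr
      _ ≤ δ := by rw [mul_one_div, div_le_iff₀ hβ]; exact hδ
  rw [← upd_v hT hβ hw v hS b, abs_mul, abs_of_nonneg (a := 1 + _)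
    (by have := mul_nonneg hw hx0; linarith), mul_comm]
  gcongr

end rankone
end resolvent

section prob
set_option linter.unusedSectionVars false

/-- bounded measurable real functions -/
def BM {Ω : Type*} [MeasurableSpace Ω] (f : Ω → ℝ) : Prop :=
  Measurable f ∧ ∃ C : ℝ, ∀ z, |f z| ≤ C

section BMbasic
variable {Ω : Type*} [MeasurableSpace Ω] {f g : Ω → ℝ}

lemma BM.integrable (hf : BM f) (P : Measure Ω) [IsFiniteMeasure P] : Integrable f P := by
  obtain ⟨hm, C, hC⟩ := hf
  exact Integrable.of_bound hm.aestronglyMeasurable C (ae_of_all _ fun z => by simpa using hC z)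

lemma BM.const (a : ℝ) : BM (fun _ : Ω => a) := ⟨measurable_const, |a|, fun _ => le_rfl⟩

lemma BM.add (hf : BM f) (hg : BM g) : BM (fun z => f z + g z) := by
  obtain ⟨hm, C, hC⟩ := hf
  obtain ⟨hm', D, hD⟩ := hg
  exact ⟨hm.add hm', C + D, fun z => (abs_add_le _ _).trans (add_le_add (hC z) (hD z))⟩

lemma BM.mul (hf : BM f) (hg : BM g) : BM (fun z => f z * g z) := by
  obtain ⟨hm, C, hC⟩ := hf
  obtain ⟨hm', D, hD⟩ := hg
  refine ⟨hm.mul hm', C * D, fun z => ?_⟩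
  rw [abs_mul]
  exact mul_le_mul (hC z) (hD z) (abs_nonneg _) ((abs_nonneg _).trans (hC z))

lemma BM.const_mul (a : ℝ) (hf : BM f) : BM (fun z => a * f z) := (BM.const a).mul hf

lemma BM.neg (hf : BM f) : BM (fun z => - f z) := by
  obtain ⟨hm, C, hC⟩ := hf
  exact ⟨hm.neg, C, fun z => by rw [abs_neg]; exact hC z⟩

lemma BM.sub (hf : BM f) (hg : BM g) : BM (fun z => f z - g z) := by
  simpa [sub_eq_add_neg] using hf.add hg.neg

lemma BM.abs (hf : BM f) : BM (fun z => |f z|) := by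
  obtain ⟨hm, C, hC⟩ := hf
  exact ⟨by simpa using hm.norm, C, fun z => by rw [abs_abs]; exact hC z⟩

lemma BM.pow (hf : BM f) (k : ℕ) : BM (fun z => f z ^ k) := by
  obtain ⟨hm, C, hC⟩ := hf
  refine ⟨hm.pow_const k, C ^ k, fun z => ?_⟩
  rw [abs_pow]; exact pow_le_pow_left₀ (abs_nonneg _) (hC z) k

lemma BM.sum {κ : Type*} (s : Finset κ) {F : κ → Ω → ℝ} (h : ∀ i ∈ s, BM (F i)) :
    BM (fun z => ∑ i ∈ s, F i z) := by
  classical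
  induction s using Finset.induction_on with
  | empty => simpa using BM.const 0
  | insert i s hi ih =>
    simp only [Finset.sum_insert hi]
    exact (h i (by simp)).add (ih fun j hj => h j (by simp [hj]))

lemma BM.comp {Ω' : Type*} [MeasurableSpace Ω'] (hf : BM f) {e : Ω' → Ω} (he : Measurable e) :
    BM (fun z => f (e z)) := by
  obtain ⟨hm, C, hC⟩ := hf
  exact ⟨hm.comp he, C, fun z => hC _⟩

lemma BM.of_cont [TopologicalSpace Ω] [BorelSpace Ω] (hf : Continuous f) (C : ℝ)
    (h : ∀ z, |f z| ≤ C) : BM f := ⟨hf.measurable, C, h⟩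

lemma BM.integral_right {X : Type*} [MeasurableSpace X] {F : Ω × X → ℝ} (hF : BM F)
    (P : Measure X) [IsProbabilityMeasure P] : BM (fun z => ∫ t, F (z, t) ∂P) := by
  obtain ⟨hm, C, hC⟩ := hF
  refine ⟨(StronglyMeasurable.integral_prod_right (ν := P) (f := fun z t => F (z, t)) hm.stronglyMeasurable).measurable, C, fun z => ?_⟩
  have := norm_integral_le_of_norm_le_const (μ := P) (f := fun t => F (z, t)) (C := C)
    (ae_of_all _ fun t => by simpa using hC (z, t))
  simpa using this

lemma BM.sq_integral_le (hf : BM f) (P : Measure Ω) [IsProbabilityMeasure P] :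
    (∫ z, f z ∂P) ^ 2 ≤ ∫ z, f z ^ 2 ∂P := by
  set c := ∫ z, f z ∂P with hc
  have h : 0 ≤ ∫ z, (f z - c) ^ 2 ∂P := integral_nonneg fun z => sq_nonneg _
  have e : ∫ z, (f z - c) ^ 2 ∂P = ∫ z, f z ^ 2 ∂P - c ^ 2 := by
    have : (fun z => (f z - c) ^ 2) = fun z => f z ^ 2 - (2 * c) * f z + c ^ 2 := by
      funext z; ring
    rw [this, integral_add (((hf.pow 2).sub (hf.const_mul _)).integrable P) (by simp),
      integral_sub ((hf.pow 2).integrable P) ((hf.const_mul _).integrable P), integral_const_mul,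
      ← hc]
    simp; ring
  linarith

lemma BM.integral_abs_le (hf : BM f) (P : Measure Ω) [IsProbabilityMeasure P] {v : ℝ}
    (hv : ∫ z, f z ^ 2 ∂P ≤ v ^ 2) (h0 : 0 ≤ v) : ∫ z, |f z| ∂P ≤ v := by
  have := hf.abs.sq_integral_le P
  simp only [sq_abs] at this
  exact abs_le_of_sq_le_sq' (this.trans hv) h0 |>.2

end BMbasic

section resample
variable {ι : Type*} [Fintype ι] [DecidableEq ι] {X : Type*} [MeasurableSpace X]
  (P : ι → Measure X) [∀ i, IsProbabilityMeasure (P i)]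

lemma measurable_upd (k : ι) :
    Measurable (fun a : (ι → X) × X => Function.update a.1 k a.2) := by
  refine measurable_pi_lambda _ fun i => ?_
  by_cases h : i = k
  · subst h; simpa using measurable_snd
  · simp only [Function.update_of_ne h]
    exact (measurable_pi_apply i).comp measurable_fst

lemma map_upd (k : ι) :
    ((Measure.pi P).prod (P k)).map (fun a : (ι → X) × X => Function.update a.1 k a.2)
      = Measure.pi P := by
  refine (Measure.pi_eq fun s hs => ?_).symm
  rw [Measure.map_apply (measurable_upd k) (MeasurableSet.univ_pi hs)]
  have : (fun a : (ι → X) × X => Function.update a.1 k a.2) ⁻¹' Set.univ.pi s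
      = (Set.univ.pi (Function.update s k Set.univ)) ×ˢ s k := by
    ext ⟨z, t⟩
    simp only [Set.mem_preimage, Set.mem_pi, Set.mem_univ, true_implies, Set.mem_prod]
    constructor
    · intro h
      refine ⟨fun i => ?_, by simpa using h k⟩
      by_cases hi : i = k
      · subst hi; simp
      · simpa [Function.update_of_ne hi] using h i
    · rintro ⟨h, h'⟩ i
      by_cases hi : i = k
      · subst hi; simpa using h'
      · simpa [Function.update_of_ne hi] using h i
  rw [this, Measure.prod_prod, Measure.pi_pi, ← Finset.mul_prod_erase Finset.univ (fun i => P i (s i)) (Finset.mem_univ k),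
    ← Finset.mul_prod_erase Finset.univ (fun i => P i (Function.update s k Set.univ i)) (Finset.mem_univ k)]
  simp only [Function.update_self, measure_univ, one_mul]
  rw [mul_comm]
  congr 1
  refine Finset.prod_congr rfl fun i hi => ?_
  rw [Function.update_of_ne (Finset.ne_of_mem_erase hi)]

variable {f : (ι → X) → ℝ}

lemma BM.upd (hf : BM f) (k : ι) :
    BM (fun a : (ι → X) × X => f (Function.update a.1 k a.2)) := hf.comp (measurable_upd k)

/-- averaging over one coordinate -/
def avg (k : ι) (f : (ι → X) → ℝ) (z : ι → X) : ℝ := ∫ t, f (Function.update z k t) ∂(P k)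

lemma BM.avg (hf : BM f) (k : ι) : BM (avg P k f) := (hf.upd k).integral_right (P k)

lemma integral_avg (hf : BM f) (k : ι) :
    ∫ z, avg P k f z ∂(Measure.pi P) = ∫ z, f z ∂(Measure.pi P) := by
  conv_rhs => rw [← map_upd P k]
  rw [integral_map (measurable_upd k).aemeasurable hf.1.aestronglyMeasurable,
    integral_prod _ ((hf.upd k).integrable _)]
  rfl

/-- resampling for a function of `(z, t)` whose first argument ignores coordinate `k` -/
lemma integral_resample {F : (ι → X) × X → ℝ} (hF : BM F) (k : ι)
    (hi : ∀ z t s, F (Function.update z k s, t) = F (z, t)) :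
    ∫ z, F (z, z k) ∂(Measure.pi P) = ∫ z, ∫ t, F (z, t) ∂(P k) ∂(Measure.pi P) := by
  have h : BM (fun z : ι → X => F (z, z k)) :=
    hF.comp (measurable_id.prodMk (measurable_pi_apply k))
  rw [← integral_avg P h k]
  simp [avg, hi]

lemma avg_indep (k : ι) (f : (ι → X) → ℝ) (z : ι → X) (t : X) :
    avg P k f (Function.update z k t) = avg P k f z := by
  simp [avg]

lemma avg_indep' {k j : ι} (hjk : j ≠ k) (f : (ι → X) → ℝ)
    (h : ∀ z t, f (Function.update z j t) = f z) (z : ι → X) (t : X) :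
    avg P k f (Function.update z j t) = avg P k f z := by
  simp only [avg]
  congr 1; funext s
  rw [Function.update_comm hjk, h]

lemma avg_sub {g : (ι → X) → ℝ} (hf : BM f) (hg : BM g) (k : ι) (z : ι → X) :
    avg P k (fun z => f z - g z) z = avg P k f z - avg P k g z := by
  simp only [avg]
  exact integral_sub
    (((hf.upd k).comp (measurable_const.prodMk measurable_id : Measurable fun t => (z, t))).integrable _)
    (((hg.upd k).comp (measurable_const.prodMk measurable_id : Measurable fun t => (z, t))).integrable _)

lemma avg_sq_le (hf : BM f) (k : ι) (z : ι → X) :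
    (avg P k f z) ^ 2 ≤ avg P k (fun z => f z ^ 2) z := by
  exact BM.sq_integral_le
    ((hf.upd k).comp (measurable_const.prodMk measurable_id : Measurable fun t => (z, t))) _

lemma avg_mul_indep (k : ι) (f g : (ι → X) → ℝ)
    (h : ∀ z t, g (Function.update z k t) = g z) (z : ι → X) :
    avg P k (fun z => f z * g z) z = avg P k f z * g z := by
  simp only [avg, h, integral_mul_const]

lemma efron_stein_aux (S : Finset ι) : ∀ (f : (ι → X) → ℝ) (g : ι → (ι → X) → ℝ), BM f →
    (∀ k, BM (g k)) → (∀ k z t, g k (Function.update z k t) = g k z) →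
    (∀ k ∉ S, ∀ z t, f (Function.update z k t) = f z) →
    ∫ z, f z ^ 2 ∂(Measure.pi P) - (∫ z, f z ∂(Measure.pi P)) ^ 2
      ≤ ∑ k ∈ S, ∫ z, (f z - g k z) ^ 2 ∂(Measure.pi P) := by
  induction S using Finset.induction_on with
  | empty =>
    intro f g hf hg hgi hfi
    have hconst : ∀ z z' : ι → X, f z = f z' := by
      intro z z'
      have key : ∀ s : Finset ι, f (fun i => if i ∈ s then z' i else z i) = f z := by
        intro s
        induction s using Finset.induction_on with
        | empty => simp
        | insert a s ha ih =>
          rw [← ih, ← hfi a (by simp) (fun i => if i ∈ s then z' i else z i) (z' a)]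
          congr 1; funext i
          by_cases hi : i = a
          · subst hi; simp
          · simp [Function.update_of_ne hi, hi]
      simpa using (key Finset.univ).symm
    have hne : Nonempty (ι → X) := by
      by_contra hne
      rw [not_nonempty_iff] at hne
      have h1 := measure_univ (μ := Measure.pi P)
      have : (Set.univ : Set (ι → X)) = ∅ := Set.eq_empty_of_isEmpty _
      rw [this] at h1; simp at h1
    obtain ⟨z0⟩ := hne
    have : f = fun _ => f z0 := funext fun z => hconst z z0
    rw [this]; simp
  | insert k S hk ih =>
    intro f g hf hg hgi hfi
    have hf' := hf.avg P k
    have h1 := ih (KKLp.avg P k f) (fun j => KKLp.avg P k (g j)) hf' (fun j => (hg j).avg P k) (by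
      intro j z t
      by_cases hj : j = k
      · subst hj; exact avg_indep P _ _ _ _
      · exact avg_indep' P hj _ (hgi j) _ _) (by
      intro j hj z t
      by_cases hjk : j = k
      · subst hjk; exact avg_indep P _ _ _ _
      · exact avg_indep' P hjk _ (hfi j (by simp [hjk, hj])) _ _)
    rw [integral_avg P hf k] at h1
    rw [Finset.sum_insert hk]
    have h2 : ∑ j ∈ S, ∫ z, (KKLp.avg P k f z - KKLp.avg P k (g j) z) ^ 2 ∂(Measure.pi P)
        ≤ ∑ j ∈ S, ∫ z, (f z - g j z) ^ 2 ∂(Measure.pi P) := by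
      refine Finset.sum_le_sum fun j _ => ?_
      rw [← integral_avg P ((hf.sub (hg j)).pow 2) k]
      refine integral_mono (((hf'.sub ((hg j).avg P k)).pow 2).integrable _)
        ((((hf.sub (hg j)).pow 2).avg P k).integrable _) fun z => ?_
      simp only [← avg_sub P hf (hg j)]
      exact avg_sq_le P (hf.sub (hg j)) k z
    have h3 : ∫ z, f z ^ 2 ∂(Measure.pi P) - ∫ z, KKLp.avg P k f z ^ 2 ∂(Measure.pi P)
        ≤ ∫ z, (f z - g k z) ^ 2 ∂(Measure.pi P) := by
      have e1 : ∫ z, f z * g k z ∂(Measure.pi P)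
          = ∫ z, KKLp.avg P k f z * g k z ∂(Measure.pi P) := by
        rw [← integral_avg P (hf.mul (hg k)) k]
        simp only [avg_mul_indep P k f (g k) (hgi k)]
      have e2 : ∀ F : (ι → X) → ℝ, BM F → ∫ z, (F z - g k z) ^ 2 ∂(Measure.pi P)
          = ∫ z, F z ^ 2 ∂(Measure.pi P) - 2 * ∫ z, F z * g k z ∂(Measure.pi P)
            + ∫ z, g k z ^ 2 ∂(Measure.pi P) := by
        intro F hF
        have : (fun z => (F z - g k z) ^ 2)
            = fun z => F z ^ 2 - 2 * (F z * g k z) + g k z ^ 2 := by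
          funext z; ring
        rw [this, integral_add (((hF.pow 2).sub ((hF.mul (hg k)).const_mul 2)).integrable _)
          (((hg k).pow 2).integrable _), integral_sub ((hF.pow 2).integrable _)
          (((hF.mul (hg k)).const_mul 2).integrable _), integral_const_mul]
      have e3 : 0 ≤ ∫ z, (KKLp.avg P k f z - g k z) ^ 2 ∂(Measure.pi P) :=
        integral_nonneg fun z => sq_nonneg _
      rw [e2 _ hf'] at e3
      rw [e2 _ hf, e1]
      linarith
    linarith

lemma efron_stein (f : (ι → X) → ℝ) (g : ι → (ι → X) → ℝ) (hf : BM f)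
    (hg : ∀ k, BM (g k)) (hgi : ∀ k z t, g k (Function.update z k t) = g k z) :
    ∫ z, (f z - ∫ y, f y ∂(Measure.pi P)) ^ 2 ∂(Measure.pi P)
      ≤ ∑ k, ∫ z, (f z - g k z) ^ 2 ∂(Measure.pi P) := by
  refine le_trans (le_of_eq ?_)
    (efron_stein_aux P Finset.univ f g hf hg hgi (fun k hk => absurd (Finset.mem_univ k) hk))
  set c := ∫ z, f z ∂(Measure.pi P) with hc
  have : (fun z => (f z - c) ^ 2) = fun z => f z ^ 2 - (2 * c) * f z + c ^ 2 := by
    funext z; ring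
  rw [this, integral_add (((hf.pow 2).sub (hf.const_mul _)).integrable _) (by simp),
    integral_sub ((hf.pow 2).integrable _) ((hf.const_mul _).integrable _), integral_const_mul,
    ← hc]
  simp; ring

end resample
end prob

section setting
set_option linter.unusedSectionVars false
variable {H : Type u} [NormedAddCommGroup H] [InnerProductSpace ℝ H] [CompleteSpace H]

lemma continuous_rankOne : Continuous (fun v : H => rankOne v v) := by
  have : (fun v : H => rankOne v v)
      = fun v => ContinuousLinearMap.smulRightL ℝ H H (innerSL ℝ v) v := by
    funext v; ext x; simp [rankOne]
  rw [this]
  fun_prop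

lemma continuousOn_res {Ω : Type*} [TopologicalSpace Ω] {s : Set Ω} {T : Ω → H →L[ℝ] H}
    {b : Ω → ℝ} (hT : ContinuousOn T s) (hb : ContinuousOn b s) (hp : ∀ ω ∈ s, PosOp (T ω))
    (hb0 : ∀ ω ∈ s, 0 < b ω) : ContinuousOn (fun ω => res (T ω) (b ω)) s := by
  intro ω hω
  have hu := (hp ω hω).isUnit (hb0 ω hω)
  obtain ⟨U, hU⟩ := hu
  have h1 : ContinuousAt Ring.inverse (T ω + b ω • (1 : H →L[ℝ] H)) := by
    rw [← hU]; exact NormedRing.inverse_continuousAt U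
  have h2 : ContinuousWithinAt (fun ω => T ω + b ω • (1 : H →L[ℝ] H)) s ω :=
    (hT ω hω).add ((hb ω hω).smul continuousWithinAt_const)
  exact ContinuousAt.comp_continuousWithinAt h1 h2

lemma continuous_res {Ω : Type*} [TopologicalSpace Ω] {T : Ω → H →L[ℝ] H}
    {β : ℝ} (hT : Continuous T) (hp : ∀ ω, PosOp (T ω)) (hβ : 0 < β) :
    Continuous (fun ω => res (T ω) β) := by
  rw [← continuousOn_univ]
  exact continuousOn_res hT.continuousOn continuousOn_const (fun ω _ => hp ω) (fun _ _ => hβ)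

lemma bm_res {Ω : Type*} [TopologicalSpace Ω] [MeasurableSpace Ω] [BorelSpace Ω]
    {T : Ω → H →L[ℝ] H} {β : ℝ} (hT : Continuous T) (hp : ∀ ω, PosOp (T ω)) (hβ : 0 < β)
    {x y : Ω → H} (hx : Continuous x) (hy : Continuous y) {C D : ℝ} (hxC : ∀ ω, ‖x ω‖ ≤ C)
    (hyD : ∀ ω, ‖y ω‖ ≤ D) : BM (fun ω => ⟪x ω, res (T ω) β (y ω)⟫) := by
  refine BM.of_cont (hx.inner ((continuous_res hT hp hβ).clm_apply hy)) (C * D / β) fun ω => ?_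
  refine (abs_res_le (hp ω) hβ _ _).trans ?_
  have := hxC ω
  have := hyD ω
  have : 0 ≤ C := (norm_nonneg _).trans (hxC ω)
  gcongr

variable {X : Type*} [TopologicalSpace X] [SecondCountableTopology X] [MeasurableSpace X]
  [BorelSpace X]
variable {ι : Type*} [Fintype ι] [DecidableEq ι]

/-- weighted empirical covariance -/
def Bh (φ : X → H) (w : ι → ℝ) (z : ι → X) : H →L[ℝ] H :=
  ∑ i, w i • rankOne (φ (z i)) (φ (z i))

lemma Bh_pos (φ : X → H) {w : ι → ℝ} (hw : ∀ i, 0 ≤ w i) (z : ι → X) : PosOp (Bh φ w z) :=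
  PosOp.sum _ _ fun i _ => (PosOp.rankOne _).smul (hw i)

lemma upd_nonneg {w : ι → ℝ} (hw : ∀ i, 0 ≤ w i) (k : ι) (i : ι) :
    0 ≤ Function.update w k 0 i := by
  by_cases h : i = k
  · subst h; simp
  · simpa [Function.update_of_ne h] using hw i

lemma Bh_split (φ : X → H) (w : ι → ℝ) (z : ι → X) (k : ι) :
    Bh φ w z = Bh φ (Function.update w k 0) z + w k • rankOne (φ (z k)) (φ (z k)) := by
  unfold Bh
  rw [← Finset.add_sum_erase Finset.univ _ (Finset.mem_univ k),
    ← Finset.add_sum_erase Finset.univ (fun i => Function.update w k 0 i • _) (Finset.mem_univ k)]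
  simp only [Function.update_self, zero_smul, zero_add]
  rw [add_comm]
  congr 1
  refine Finset.sum_congr rfl fun i hi => ?_
  rw [Function.update_of_ne (Finset.ne_of_mem_erase hi)]

lemma Bh_indep (φ : X → H) (w : ι → ℝ) (z : ι → X) (k : ι) (t : X) :
    Bh φ (Function.update w k 0) (Function.update z k t) = Bh φ (Function.update w k 0) z := by
  unfold Bh
  refine Finset.sum_congr rfl fun i _ => ?_
  by_cases h : i = k
  · subst h; simp
  · simp [Function.update_of_ne h]

lemma Bh_inner (φ : X → H) (w : ι → ℝ) (z : ι → X) (a b : H) :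
    ⟪a, Bh φ w z b⟫ = ∑ i, w i * (⟪φ (z i), a⟫ * ⟪φ (z i), b⟫) := by
  unfold Bh
  rw [_root_.sum_apply, inner_sum]
  refine Finset.sum_congr rfl fun i _ => ?_
  simp [rankOne_apply, inner_smul_right, real_inner_comm]
  left; ring

lemma continuous_Bh {φ : X → H} (hφ : Continuous φ) (w : ι → ℝ) : Continuous (Bh φ w) := by
  unfold Bh
  refine continuous_finsetSum _ fun i _ => ?_
  have h : Continuous fun z : ι → X => rankOne (φ (z i)) (φ (z i)) :=
    continuous_rankOne.comp (hφ.comp (continuous_apply i))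
  exact h.const_smul (w i)

/-- data of the general setting -/
structure Setup (φ : X → H) (P : ι → Measure X) (w : ι → ℝ) (β : ℝ) (B : H →L[ℝ] H) : Prop where
  hφ : Continuous φ
  hn : ∀ x, ‖φ x‖ = 1
  hβ : 0 < β
  hw : ∀ i, 0 ≤ w i
  hwβ : ∀ i, w i ≤ 1 / 16 * β
  hB : PosOp B
  hBf : ∀ a b, ⟪a, B b⟫ = ∑ i, w i * ∫ t, ⟪φ t, a⟫ * ⟪φ t, b⟫ ∂(P i)

variable {φ : X → H} {P : ι → Measure X} [∀ i, IsProbabilityMeasure (P i)] {w : ι → ℝ} {β : ℝ}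
  {B : H →L[ℝ] H}

/-- empirical resolvent -/
def Rh (φ : X → H) (w : ι → ℝ) (β : ℝ) (z : ι → X) : H →L[ℝ] H := res (Bh φ w z) β

/-- leave-one-out resolvent -/
def Qh (φ : X → H) (w : ι → ℝ) (β : ℝ) (k : ι) (z : ι → X) : H →L[ℝ] H :=
  res (Bh φ (Function.update w k 0) z) β

lemma Qh_indep (z : ι → X) (k : ι) (t : X) :
    Qh φ w β k (Function.update z k t) = Qh φ w β k z := by
  unfold Qh; rw [Bh_indep]

namespace Setup
variable (S : Setup φ P w β B)
include S

lemma bmR {Ω : Type*} [TopologicalSpace Ω] [MeasurableSpace Ω] [BorelSpace Ω]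
    {e : Ω → ι → X} (he : Continuous e) {x y : Ω → H} (hx : Continuous x) (hy : Continuous y)
    {C D : ℝ} (hxC : ∀ ω, ‖x ω‖ ≤ C) (hyD : ∀ ω, ‖y ω‖ ≤ D) :
    BM (fun ω => ⟪x ω, Rh φ w β (e ω) (y ω)⟫) :=
  bm_res ((continuous_Bh S.hφ w).comp he) (fun _ => Bh_pos φ S.hw _) S.hβ hx hy hxC hyD

lemma bmQ {Ω : Type*} [TopologicalSpace Ω] [MeasurableSpace Ω] [BorelSpace Ω] (k : ι)
    {e : Ω → ι → X} (he : Continuous e) {x y : Ω → H} (hx : Continuous x) (hy : Continuous y)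
    {C D : ℝ} (hxC : ∀ ω, ‖x ω‖ ≤ C) (hyD : ∀ ω, ‖y ω‖ ≤ D) :
    BM (fun ω => ⟪x ω, Qh φ w β k (e ω) (y ω)⟫) :=
  bm_res ((continuous_Bh S.hφ _).comp he) (fun _ => Bh_pos φ (upd_nonneg S.hw k) _) S.hβ hx hy
    hxC hyD

lemma posR (z : ι → X) : PosOp (Rh φ w β z) := res_posOp (Bh_pos φ S.hw _) S.hβ
lemma posQ (k : ι) (z : ι → X) : PosOp (Qh φ w β k z) :=
  res_posOp (Bh_pos φ (upd_nonneg S.hw k) _) S.hβ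
lemma posB : PosOp (res B β) := res_posOp S.hB S.hβ

/-- resolvent difference -/
lemma diff (z : ι → X) (x y : H) :
    ⟪x, Rh φ w β z y⟫ - ⟪x, res B β y⟫
      = ∑ i, w i * ((∫ t, ⟪φ t, res B β x⟫ * ⟪φ t, Rh φ w β z y⟫ ∂(P i))
        - ⟪φ (z i), res B β x⟫ * ⟪φ (z i), Rh φ w β z y⟫) := by
  have := res_sub (Bh_pos φ S.hw z) S.hB S.hβ x y
  rw [Rh, this, _root_.sub_apply, inner_sub_right, S.hBf, Bh_inner,
    ← Finset.sum_sub_distrib]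
  refine Finset.sum_congr rfl fun i _ => ?_
  rw [mul_sub]

lemma sumA (u : H) :
    ∑ i, w i * ∫ t, ⟪φ t, res B β u⟫ ^ 2 ∂(P i) ≤ ⟪u, res B β u⟫ := by
  have := res_quad_le S.hB S.hβ u
  rw [S.hBf] at this
  simpa [sq] using this

lemma sumb (z : ι → X) (u : H) :
    ∑ i, w i * ⟪φ (z i), Rh φ w β z u⟫ ^ 2 ≤ ⟪u, Rh φ w β z u⟫ := by
  have := res_quad_le (Bh_pos φ S.hw z) S.hβ u
  rw [Bh_inner] at this
  simpa [sq, Rh] using this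

/-- `R̂ = Q - w Q φ φ R̂` -/
lemma rq (k : ι) (z : ι → X) (a b : H) :
    ⟪a, Rh φ w β z b⟫ = ⟪a, Qh φ w β k z b⟫
      - w k * ⟪a, Qh φ w β k z (φ (z k))⟫ * ⟪φ (z k), Rh φ w β z b⟫ :=
  upd_eq (Bh_pos φ (upd_nonneg S.hw k) z) S.hβ (S.hw k) _ (Bh_split φ w z k) a b

lemma rq_v (k : ι) (z : ι → X) (b : H) :
    ⟪φ (z k), Rh φ w β z b⟫ * (1 + w k * ⟪φ (z k), Qh φ w β k z (φ (z k))⟫)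
      = ⟪φ (z k), Qh φ w β k z b⟫ :=
  upd_v (Bh_pos φ (upd_nonneg S.hw k) z) S.hβ (S.hw k) _ (Bh_split φ w z k) b

lemma rq_abs_le (k : ι) (z : ι → X) (b : H) :
    |⟪φ (z k), Rh φ w β z b⟫| ≤ |⟪φ (z k), Qh φ w β k z b⟫| :=
  upd_abs_le (Bh_pos φ (upd_nonneg S.hw k) z) S.hβ (S.hw k) _ (Bh_split φ w z k) b

lemma rq_quad_le (k : ι) (z : ι → X) (a : H) :
    ⟪a, Rh φ w β z a⟫ ≤ ⟪a, Qh φ w β k z a⟫ :=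
  upd_quad_le (Bh_pos φ (upd_nonneg S.hw k) z) S.hβ (S.hw k) _ (Bh_split φ w z k) a

lemma rq_quad_ge (k : ι) (z : ι → X) (a : H) :
    ⟪a, Qh φ w β k z a⟫ ≤ (1 + 1 / 16) * ⟪a, Rh φ w β z a⟫ :=
  upd_quad_ge (Bh_pos φ (upd_nonneg S.hw k) z) S.hβ (S.hw k) _ (Bh_split φ w z k) (S.hn _)
    (S.hwβ k) a

lemma rq_abs_ge (k : ι) (z : ι → X) (b : H) :
    |⟪φ (z k), Qh φ w β k z b⟫| ≤ (1 + 1 / 16) * |⟪φ (z k), Rh φ w β z b⟫| :=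
  upd_abs_ge (Bh_pos φ (upd_nonneg S.hw k) z) S.hβ (S.hw k) _ (Bh_split φ w z k) (S.hn _)
    (S.hwβ k) b

lemma wQ_le (k : ι) (z : ι → X) (t : X) :
    w k * |⟪φ t, Qh φ w β k z (φ (z k))⟫| ≤ 1 / 16 := by
  have h : |⟪φ t, Qh φ w β k z (φ (z k))⟫| ≤ ‖φ t‖ * ‖φ (z k)‖ / β :=
    abs_res_le (Bh_pos φ (upd_nonneg S.hw k) z) S.hβ _ _
  rw [S.hn, S.hn] at h
  calc _ ≤ w k * (1 * 1 / β) := by gcongr; exact S.hw k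
    _ ≤ 1 / 16 := by
      rw [one_mul, mul_one_div, div_le_iff₀ S.hβ]; exact S.hwβ k

end Setup
end setting

section setting2
set_option linter.unusedSectionVars false
variable {H : Type u} [NormedAddCommGroup H] [InnerProductSpace ℝ H] [CompleteSpace H]
variable {X : Type*} [TopologicalSpace X] [SecondCountableTopology X] [MeasurableSpace X]
  [BorelSpace X]
variable {ι : Type*} [Fintype ι] [DecidableEq ι]
variable {φ : X → H} {P : ι → Measure X} [∀ i, IsProbabilityMeasure (P i)] {w : ι → ℝ} {β : ℝ}
  {B : H →L[ℝ] H}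

namespace Setup
variable (S : Setup φ P w β B)
include S

lemma bmφ (x : H) : BM (fun t => ⟪φ t, x⟫) := by
  refine BM.of_cont (S.hφ.inner continuous_const) ‖x‖ fun t => ?_
  simpa [S.hn] using abs_real_inner_le_norm (φ t) x

lemma cφ (i : ι) : Continuous (fun z : ι → X => φ (z i)) := S.hφ.comp (continuous_apply i)

lemma nφ (x : X) : ‖φ x‖ ≤ 1 := (S.hn x).le

lemma pt2 (u : H) (z : ι → X) (i : ι) :
    ⟪u, Rh φ w β z u⟫ * ((∫ t, ⟪φ t, res B β u⟫ * ⟪φ t, Rh φ w β z u⟫ ∂(P i))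
        - ⟪φ (z i), res B β u⟫ * ⟪φ (z i), Rh φ w β z u⟫)
    ≤ (∫ t, ⟪u, Qh φ w β i z u⟫ * (5 / 4 * ⟪φ t, res B β u⟫ ^ 2
          + 1 / 5 * ⟪φ t, Qh φ w β i z u⟫ ^ 2) ∂(P i))
      + ⟪u, Qh φ w β i z u⟫ * (5 / 4 * ⟪φ (z i), res B β u⟫ ^ 2
          + 1 / 5 * ⟪φ (z i), Qh φ w β i z u⟫ ^ 2)
      + (5 / 64 * (⟪u, Rh φ w β z u⟫ * ∫ t, ⟪φ t, res B β u⟫ ^ 2 ∂(P i))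
        + 1 / 80 * (⟪u, Rh φ w β z u⟫ * ⟪φ (z i), Rh φ w β z u⟫ ^ 2)) := by
  have hZ0 := (S.posR z).2 u
  have hZi := S.rq_quad_le i z u
  have hb := S.rq_abs_le i z u
  set Z := ⟪u, Rh φ w β z u⟫
  set Zi := ⟪u, Qh φ w β i z u⟫
  have key : ∀ (a q y b bi wy : ℝ), |b| ≤ |q| + 1 / 16 * |bi| → 
      Z * (a * b) ≤ Zi * (5 / 4 * a ^ 2 + 1 / 5 * q ^ 2)
        + (5 / 64 * (Z * a ^ 2) + 1 / 80 * (Z * bi ^ 2)) := by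
    intro a q y b bi wy hb
    have h1 : a * b ≤ |a| * |q| + 1 / 16 * (|a| * |bi|) := by
      calc a * b ≤ |a| * |b| := by rw [← abs_mul]; exact le_abs_self _
        _ ≤ |a| * (|q| + 1 / 16 * |bi|) := by gcongr
        _ = _ := by ring
    have h2 : |a| * |q| ≤ 5 / 4 * a ^ 2 + 1 / 5 * q ^ 2 := by
      rw [← sq_abs a, ← sq_abs q]; nlinarith [sq_nonneg (5 * |a| - 2 * |q|)]
    have h3 : |a| * |bi| ≤ 5 / 4 * a ^ 2 + 1 / 5 * bi ^ 2 := by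
      rw [← sq_abs a, ← sq_abs bi]; nlinarith [sq_nonneg (5 * |a| - 2 * |bi|)]
    have h4 : 0 ≤ 5 / 4 * a ^ 2 + 1 / 5 * q ^ 2 := by positivity
    calc Z * (a * b) ≤ Z * ((5 / 4 * a ^ 2 + 1 / 5 * q ^ 2)
          + 1 / 16 * (5 / 4 * a ^ 2 + 1 / 5 * bi ^ 2)) := by
          gcongr; linarith
      _ = Z * (5 / 4 * a ^ 2 + 1 / 5 * q ^ 2)
          + (5 / 64 * (Z * a ^ 2) + 1 / 80 * (Z * bi ^ 2)) := by ring
      _ ≤ _ := by gcongr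
  have hI : ∀ t, |⟪φ t, Rh φ w β z u⟫|
      ≤ |⟪φ t, Qh φ w β i z u⟫| + 1 / 16 * |⟪φ (z i), Rh φ w β z u⟫| := by
    intro t
    rw [S.rq i z (φ t) u]
    refine (abs_sub _ _).trans ?_
    rw [abs_mul, abs_mul, abs_of_nonneg (S.hw i)]
    gcongr
    exact S.wQ_le i z t
  have first : Z * (∫ t, ⟪φ t, res B β u⟫ * ⟪φ t, Rh φ w β z u⟫ ∂(P i))
      ≤ (∫ t, Zi * (5 / 4 * ⟪φ t, res B β u⟫ ^ 2 + 1 / 5 * ⟪φ t, Qh φ w β i z u⟫ ^ 2) ∂(P i))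
        + (5 / 64 * (Z * ∫ t, ⟪φ t, res B β u⟫ ^ 2 ∂(P i))
        + 1 / 80 * (Z * ⟪φ (z i), Rh φ w β z u⟫ ^ 2)) := by
    have b1 : BM fun t => Zi * (5 / 4 * ⟪φ t, res B β u⟫ ^ 2
        + 1 / 5 * ⟪φ t, Qh φ w β i z u⟫ ^ 2) :=
      ((((S.bmφ _).pow 2).const_mul _).add (((S.bmφ _).pow 2).const_mul _)).const_mul _
    have b2 : BM fun t => 5 / 64 * (Z * ⟪φ t, res B β u⟫ ^ 2) :=
      (((S.bmφ _).pow 2).const_mul _).const_mul _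
    have b3 : BM fun _ : X => 1 / 80 * (Z * ⟪φ (z i), Rh φ w β z u⟫ ^ 2) := BM.const _
    have b4 : BM fun t => Z * (⟪φ t, res B β u⟫ * ⟪φ t, Rh φ w β z u⟫) :=
      ((S.bmφ _).mul (S.bmφ _)).const_mul _
    have := integral_mono (b4.integrable (P i)) ((b1.add (b2.add b3)).integrable (P i))
      (fun t => key _ _ 0 _ _ 0 (hI t))
    rw [integral_add (b1.integrable _) ((b2.add b3).integrable _),
      integral_add (b2.integrable _) (b3.integrable _)] at this
    simpa only [integral_const_mul, integral_const, probReal_univ, one_smul] using this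
  have second : -(Z * (⟪φ (z i), res B β u⟫ * ⟪φ (z i), Rh φ w β z u⟫))
      ≤ Zi * (5 / 4 * ⟪φ (z i), res B β u⟫ ^ 2 + 1 / 5 * ⟪φ (z i), Qh φ w β i z u⟫ ^ 2) := by
    have h := key ⟪φ (z i), res B β u⟫ ⟪φ (z i), Qh φ w β i z u⟫ 0
      (-⟪φ (z i), Rh φ w β z u⟫) 0 0 (by simpa using hb)
    set a := ⟪φ (z i), res B β u⟫
    have h2 : |a| * |⟪φ (z i), Qh φ w β i z u⟫|
        ≤ 5 / 4 * a ^ 2 + 1 / 5 * ⟪φ (z i), Qh φ w β i z u⟫ ^ 2 := by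
      rw [← sq_abs a, ← sq_abs ⟪φ (z i), Qh φ w β i z u⟫]
      nlinarith [sq_nonneg (5 * |a| - 2 * |⟪φ (z i), Qh φ w β i z u⟫|)]
    have h1 : -(a * ⟪φ (z i), Rh φ w β z u⟫) ≤ |a| * |⟪φ (z i), Qh φ w β i z u⟫| := by
      calc _ ≤ |a * ⟪φ (z i), Rh φ w β z u⟫| := neg_le_abs _
        _ ≤ _ := by rw [abs_mul]; gcongr
    calc _ = Z * (-(a * ⟪φ (z i), Rh φ w β z u⟫)) := by ring
      _ ≤ Z * (5 / 4 * a ^ 2 + 1 / 5 * ⟪φ (z i), Qh φ w β i z u⟫ ^ 2) := by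
        gcongr; linarith
      _ ≤ _ := by gcongr
  rw [mul_sub]
  linarith

lemma two_aux (u : H) (i : ι) :
    ∫ z, ((∫ t, ⟪u, Qh φ w β i z u⟫ * (5 / 4 * ⟪φ t, res B β u⟫ ^ 2
          + 1 / 5 * ⟪φ t, Qh φ w β i z u⟫ ^ 2) ∂(P i))
      + ⟪u, Qh φ w β i z u⟫ * (5 / 4 * ⟪φ (z i), res B β u⟫ ^ 2
          + 1 / 5 * ⟪φ (z i), Qh φ w β i z u⟫ ^ 2)
      + (5 / 64 * (⟪u, Rh φ w β z u⟫ * ∫ t, ⟪φ t, res B β u⟫ ^ 2 ∂(P i))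
        + 1 / 80 * (⟪u, Rh φ w β z u⟫ * ⟪φ (z i), Rh φ w β z u⟫ ^ 2))) ∂(Measure.pi P)
    ≤ 88 / 32 * (∫ t, ⟪φ t, res B β u⟫ ^ 2 ∂(P i)) * (∫ z, ⟪u, Rh φ w β z u⟫ ∂(Measure.pi P))
      + 0.4924 * ∫ z, ⟪u, Rh φ w β z u⟫ * ⟪φ (z i), Rh φ w β z u⟫ ^ 2 ∂(Measure.pi P) := by
  set A := ∫ t, ⟪φ t, res B β u⟫ ^ 2 ∂(P i) with hA
  have hA0 : 0 ≤ A := integral_nonneg fun t => sq_nonneg _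
  have bZ : BM fun z : ι → X => ⟪u, Rh φ w β z u⟫ :=
    S.bmR continuous_id continuous_const continuous_const (fun _ => le_rfl) (fun _ => le_rfl)
  have bZi : BM fun z : ι → X => ⟪u, Qh φ w β i z u⟫ :=
    S.bmQ i continuous_id continuous_const continuous_const (fun _ => le_rfl) (fun _ => le_rfl)
  have bb : BM fun z : ι → X => ⟪φ (z i), Rh φ w β z u⟫ :=
    S.bmR continuous_id (S.cφ i) continuous_const (fun _ => S.nφ _) (fun _ => le_rfl)
  have bq : BM fun z : ι → X => ⟪φ (z i), Qh φ w β i z u⟫ :=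
    S.bmQ i continuous_id (S.cφ i) continuous_const (fun _ => S.nφ _) (fun _ => le_rfl)
  have ba : BM fun z : ι → X => ⟪φ (z i), res B β u⟫ := (S.bmφ _).comp (measurable_pi_apply i)
  -- joint
  have jZi : BM fun p : (ι → X) × X => ⟪u, Qh φ w β i p.1 u⟫ := bZi.comp measurable_fst
  have ja : BM fun p : (ι → X) × X => ⟪φ p.2, res B β u⟫ := (S.bmφ _).comp measurable_snd
  have jq : BM fun p : (ι → X) × X => ⟪φ p.2, Qh φ w β i p.1 u⟫ :=
    S.bmQ i continuous_fst (S.hφ.comp continuous_snd) continuous_const (fun _ => S.nφ _)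
      (fun _ => le_rfl)
  have r1 := integral_resample P (F := fun p => ⟪u, Qh φ w β i p.1 u⟫ * ⟪φ p.2, res B β u⟫ ^ 2)
    (jZi.mul (ja.pow 2)) i (fun z t s => by simp only [Qh_indep])
  have r2 := integral_resample P
    (F := fun p => ⟪u, Qh φ w β i p.1 u⟫ * ⟪φ p.2, Qh φ w β i p.1 u⟫ ^ 2)
    (jZi.mul (jq.pow 2)) i (fun z t s => by simp only [Qh_indep])
  simp only [integral_const_mul, integral_mul_const, ← hA] at r1
  simp only [integral_const_mul] at r2
  have hin : ∀ z, (∫ t, ⟪u, Qh φ w β i z u⟫ * (5 / 4 * ⟪φ t, res B β u⟫ ^ 2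
          + 1 / 5 * ⟪φ t, Qh φ w β i z u⟫ ^ 2) ∂(P i))
        = 5 / 4 * (⟪u, Qh φ w β i z u⟫ * A)
          + 1 / 5 * (⟪u, Qh φ w β i z u⟫ * ∫ t, ⟪φ t, Qh φ w β i z u⟫ ^ 2 ∂(P i)) := by
    intro z
    rw [integral_const_mul, integral_add ((((S.bmφ _).pow 2).const_mul _).integrable _)
      ((((S.bmφ _).pow 2).const_mul _).integrable _), integral_const_mul, integral_const_mul]
    ring
  have bI : BM fun z : ι → X => ∫ t, ⟪φ t, Qh φ w β i z u⟫ ^ 2 ∂(P i) :=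
    (jq.pow 2).integral_right (P i)
  simp only [hin]
  have f1 := ((bZi.mul (BM.const A)).const_mul (5 / 4))
  have f2 := ((bZi.mul bI).const_mul (1 / 5))
  have f3 := ((bZi.mul (ba.pow 2)).const_mul (5 / 4))
  have f4 := ((bZi.mul (bq.pow 2)).const_mul (1 / 5))
  have f5 := ((bZ.mul (BM.const A)).const_mul (5 / 64))
  have f6 := ((bZ.mul (bb.pow 2)).const_mul (1 / 80))
  have e : ∫ z, (5 / 4 * (⟪u, Qh φ w β i z u⟫ * A)
          + 1 / 5 * (⟪u, Qh φ w β i z u⟫ * ∫ t, ⟪φ t, Qh φ w β i z u⟫ ^ 2 ∂(P i))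
      + ⟪u, Qh φ w β i z u⟫ * (5 / 4 * ⟪φ (z i), res B β u⟫ ^ 2
          + 1 / 5 * ⟪φ (z i), Qh φ w β i z u⟫ ^ 2)
      + (5 / 64 * (⟪u, Rh φ w β z u⟫ * A)
        + 1 / 80 * (⟪u, Rh φ w β z u⟫ * ⟪φ (z i), Rh φ w β z u⟫ ^ 2))) ∂(Measure.pi P)
      = 5 / 2 * ((∫ z, ⟪u, Qh φ w β i z u⟫ ∂(Measure.pi P)) * A)
        + 2 / 5 * ∫ z, ⟪u, Qh φ w β i z u⟫ * ⟪φ (z i), Qh φ w β i z u⟫ ^ 2 ∂(Measure.pi P)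
        + 5 / 64 * ((∫ z, ⟪u, Rh φ w β z u⟫ ∂(Measure.pi P)) * A)
        + 1 / 80 * ∫ z, ⟪u, Rh φ w β z u⟫ * ⟪φ (z i), Rh φ w β z u⟫ ^ 2 ∂(Measure.pi P) := by
    have e0 : ∀ z : ι → X, ⟪u, Qh φ w β i z u⟫ * (5 / 4 * ⟪φ (z i), res B β u⟫ ^ 2
          + 1 / 5 * ⟪φ (z i), Qh φ w β i z u⟫ ^ 2)
        = 5 / 4 * (⟪u, Qh φ w β i z u⟫ * ⟪φ (z i), res B β u⟫ ^ 2)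
          + 1 / 5 * (⟪u, Qh φ w β i z u⟫ * ⟪φ (z i), Qh φ w β i z u⟫ ^ 2) := by
      intro z; ring
    simp only [e0]
    rw [integral_add (((f1.add f2).add (f3.add f4)).integrable _) ((f5.add f6).integrable _),
      integral_add ((f1.add f2).integrable _) ((f3.add f4).integrable _),
      integral_add (f1.integrable _) (f2.integrable _),
      integral_add (f3.integrable _) (f4.integrable _),
      integral_add (f5.integrable _) (f6.integrable _)]
    simp only [integral_const_mul, integral_mul_const]
    rw [r1, ← r2]
    ring
  rw [e]
  have g1 : ∫ z, ⟪u, Qh φ w β i z u⟫ ∂(Measure.pi P)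
      ≤ 17 / 16 * ∫ z, ⟪u, Rh φ w β z u⟫ ∂(Measure.pi P) := by
    rw [← integral_const_mul]
    refine integral_mono (bZi.integrable _) ((bZ.const_mul _).integrable _) fun z => ?_
    have := S.rq_quad_ge i z u
    simp only; linarith
  have g2 : ∫ z, ⟪u, Qh φ w β i z u⟫ * ⟪φ (z i), Qh φ w β i z u⟫ ^ 2 ∂(Measure.pi P)
      ≤ (17 / 16) ^ 3 * ∫ z, ⟪u, Rh φ w β z u⟫ * ⟪φ (z i), Rh φ w β z u⟫ ^ 2 ∂(Measure.pi P) := by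
    rw [← integral_const_mul]
    refine integral_mono ((bZi.mul (bq.pow 2)).integrable _)
      (((bZ.mul (bb.pow 2)).const_mul _).integrable _) fun z => ?_
    have h1 := S.rq_quad_ge i z u
    have h2 := S.rq_abs_ge i z u
    have h3 : ⟪φ (z i), Qh φ w β i z u⟫ ^ 2 ≤ (17 / 16) ^ 2 * ⟪φ (z i), Rh φ w β z u⟫ ^ 2 := by
      rw [← sq_abs, ← sq_abs ⟪φ (z i), Rh φ w β z u⟫, ← mul_pow]
      refine pow_le_pow_left₀ (abs_nonneg _) (by linarith) 2
    have h4 := (S.posR z).2 u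
    calc _ ≤ ((1 + 1 / 16) * ⟪u, Rh φ w β z u⟫) * ((17 / 16) ^ 2 * ⟪φ (z i), Rh φ w β z u⟫ ^ 2) := by
          refine mul_le_mul h1 h3 (sq_nonneg _) (by positivity)
      _ = _ := by ring
  have g3 : 0 ≤ ∫ z, ⟪u, Rh φ w β z u⟫ * ⟪φ (z i), Rh φ w β z u⟫ ^ 2 ∂(Measure.pi P) :=
    integral_nonneg fun z => mul_nonneg ((S.posR z).2 u) (sq_nonneg _)
  have g4 : 0 ≤ ∫ z, ⟪u, Rh φ w β z u⟫ ∂(Measure.pi P) :=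
    integral_nonneg fun z => (S.posR z).2 u
  have g5 := mul_le_mul_of_nonneg_right g1 hA0
  have g6 := mul_nonneg g4 hA0
  norm_num at g2 ⊢
  linarith

/-- second moment of the resolvent form -/
lemma two (u : H) :
    ∫ z, ⟪u, Rh φ w β z u⟫ ^ 2 ∂(Measure.pi P)
      ≤ 8 * ⟪u, res B β u⟫ * ∫ z, ⟪u, Rh φ w β z u⟫ ∂(Measure.pi P) := by
  have bZ : BM fun z : ι → X => ⟪u, Rh φ w β z u⟫ :=
    S.bmR continuous_id continuous_const continuous_const (fun _ => le_rfl) (fun _ => le_rfl)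
  set r := ⟪u, res B β u⟫ with hr
  have hr0 : 0 ≤ r := S.posB.2 u
  set EZ := ∫ z, ⟪u, Rh φ w β z u⟫ ∂(Measure.pi P) with hEZ
  have hEZ0 : 0 ≤ EZ := integral_nonneg fun z => (S.posR z).2 u
  have bb : ∀ i, BM fun z : ι → X => ⟪φ (z i), Rh φ w β z u⟫ := fun i =>
    S.bmR continuous_id (S.cφ i) continuous_const (fun _ => S.nφ _) (fun _ => le_rfl)
  have bG : ∀ i, BM fun z : ι → X => ((∫ t, ⟪u, Qh φ w β i z u⟫ * (5 / 4 * ⟪φ t, res B β u⟫ ^ 2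
          + 1 / 5 * ⟪φ t, Qh φ w β i z u⟫ ^ 2) ∂(P i))
      + ⟪u, Qh φ w β i z u⟫ * (5 / 4 * ⟪φ (z i), res B β u⟫ ^ 2
          + 1 / 5 * ⟪φ (z i), Qh φ w β i z u⟫ ^ 2)
      + (5 / 64 * (⟪u, Rh φ w β z u⟫ * ∫ t, ⟪φ t, res B β u⟫ ^ 2 ∂(P i))
        + 1 / 80 * (⟪u, Rh φ w β z u⟫ * ⟪φ (z i), Rh φ w β z u⟫ ^ 2))) := by
    intro i
    have bZi : BM fun z : ι → X => ⟪u, Qh φ w β i z u⟫ :=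
      S.bmQ i continuous_id continuous_const continuous_const (fun _ => le_rfl) (fun _ => le_rfl)
    have bq : BM fun z : ι → X => ⟪φ (z i), Qh φ w β i z u⟫ :=
      S.bmQ i continuous_id (S.cφ i) continuous_const (fun _ => S.nφ _) (fun _ => le_rfl)
    have ba : BM fun z : ι → X => ⟪φ (z i), res B β u⟫ := (S.bmφ _).comp (measurable_pi_apply i)
    have jZi : BM fun p : (ι → X) × X => ⟪u, Qh φ w β i p.1 u⟫ := bZi.comp measurable_fst
    have ja : BM fun p : (ι → X) × X => ⟪φ p.2, res B β u⟫ := (S.bmφ _).comp measurable_snd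
    have jq : BM fun p : (ι → X) × X => ⟪φ p.2, Qh φ w β i p.1 u⟫ :=
      S.bmQ i continuous_fst (S.hφ.comp continuous_snd) continuous_const (fun _ => S.nφ _)
        (fun _ => le_rfl)
    have j1 := (jZi.mul (((ja.pow 2).const_mul (5 / 4)).add
      ((jq.pow 2).const_mul (1 / 5)))).integral_right (P i)
    have j2 := (bZi.mul (((ba.pow 2).const_mul (5 / 4)).add ((bq.pow 2).const_mul (1 / 5))))
    exact (j1.add j2).add (((bZ.mul (BM.const _)).const_mul _).add
      ((bZ.mul ((bb i).pow 2)).const_mul _))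
  have h1 : ∫ z, ⟪u, Rh φ w β z u⟫ ^ 2 ∂(Measure.pi P)
      ≤ r * EZ + ∑ i, w i * (88 / 32 * (∫ t, ⟪φ t, res B β u⟫ ^ 2 ∂(P i)) * EZ
      + 0.4924 * ∫ z, ⟪u, Rh φ w β z u⟫ * ⟪φ (z i), Rh φ w β z u⟫ ^ 2 ∂(Measure.pi P)) := by
    have hp := fun z => S.diff z u u
    have bS := BM.sum Finset.univ (fun i _ => (bG i).const_mul (w i))
    have := integral_mono ((bZ.pow 2).integrable (Measure.pi P))
      (((bZ.const_mul r).add bS).integrable (Measure.pi P)) (fun z => by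
        have e : ⟪u, Rh φ w β z u⟫ ^ 2 = r * ⟪u, Rh φ w β z u⟫
          + ⟪u, Rh φ w β z u⟫ * (⟪u, Rh φ w β z u⟫ - r) := by ring
        simp only
        rw [e, hr, hp z, Finset.mul_sum]
        refine add_le_add le_rfl (Finset.sum_le_sum fun i _ => ?_)
        rw [mul_left_comm]
        exact mul_le_mul_of_nonneg_left (S.pt2 u z i) (S.hw i))
    rw [integral_add ((bZ.const_mul r).integrable _) (bS.integrable _), integral_const_mul,
      integral_finsetSum _ (fun i _ => ((bG i).const_mul (w i)).integrable _)] at this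
    refine this.trans ?_
    gcongr with i hi
    rw [integral_const_mul]
    exact mul_le_mul_of_nonneg_left (S.two_aux u i) (S.hw i)
  have h2 : ∑ i, w i * (88 / 32 * (∫ t, ⟪φ t, res B β u⟫ ^ 2 ∂(P i)) * EZ
      + 0.4924 * ∫ z, ⟪u, Rh φ w β z u⟫ * ⟪φ (z i), Rh φ w β z u⟫ ^ 2 ∂(Measure.pi P))
      = 88 / 32 * EZ * (∑ i, w i * ∫ t, ⟪φ t, res B β u⟫ ^ 2 ∂(P i))
        + 0.4924 * ∫ z, ⟪u, Rh φ w β z u⟫ *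
          (∑ i, w i * ⟪φ (z i), Rh φ w β z u⟫ ^ 2) ∂(Measure.pi P) := by
    have : ∀ z : ι → X, ⟪u, Rh φ w β z u⟫ * (∑ i, w i * ⟪φ (z i), Rh φ w β z u⟫ ^ 2)
      = ∑ i, w i * (⟪u, Rh φ w β z u⟫ * ⟪φ (z i), Rh φ w β z u⟫ ^ 2) := by
      intro z; rw [Finset.mul_sum]; exact Finset.sum_congr rfl fun i _ => by ring
    simp only [this]
    rw [integral_finsetSum _ (fun i _ => ((bZ.mul ((bb i).pow 2)).const_mul (w i)).integrable _),
      Finset.mul_sum, Finset.mul_sum, ← Finset.sum_add_distrib]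
    refine Finset.sum_congr rfl fun i _ => ?_
    rw [integral_const_mul]; ring
  have h3 : ∫ z, ⟪u, Rh φ w β z u⟫ *
          (∑ i, w i * ⟪φ (z i), Rh φ w β z u⟫ ^ 2) ∂(Measure.pi P)
      ≤ ∫ z, ⟪u, Rh φ w β z u⟫ ^ 2 ∂(Measure.pi P) := by
    refine integral_mono ((bZ.mul (BM.sum Finset.univ (fun i _ =>
      ((bb i).pow 2).const_mul (w i)))).integrable _) ((bZ.pow 2).integrable _) fun z => ?_
    simp only [sq ⟪u, Rh φ w β z u⟫]
    exact mul_le_mul_of_nonneg_left (S.sumb z u) ((S.posR z).2 u)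
  have h4 := mul_le_mul_of_nonneg_left (S.sumA u) (by positivity : 0 ≤ 88 / 32 * EZ)
  rw [h2] at h1
  rw [← hr] at h4
  norm_num at h1
  nlinarith [mul_nonneg hr0 hEZ0]

lemma mean_le (u : H) :
    ∫ z, ⟪u, Rh φ w β z u⟫ ∂(Measure.pi P) ≤ 8 * ⟪u, res B β u⟫ := by
  have bZ : BM fun z : ι → X => ⟪u, Rh φ w β z u⟫ :=
    S.bmR continuous_id continuous_const continuous_const (fun _ => le_rfl) (fun _ => le_rfl)
  have h1 := bZ.sq_integral_le (Measure.pi P)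
  have h2 := S.two u
  have h0 : 0 ≤ ∫ z, ⟪u, Rh φ w β z u⟫ ∂(Measure.pi P) := integral_nonneg fun z => (S.posR z).2 u
  rcases h0.eq_or_lt with h | h
  · rw [← h]; have := S.posB.2 u; positivity
  · have := h1.trans h2
    rw [sq] at this
    exact le_of_mul_le_mul_right this h

lemma sq_le (u : H) (i : ι) :
    ∫ z, ⟪u, Qh φ w β i z u⟫ ^ 2 ∂(Measure.pi P) ≤ 73 * ⟪u, res B β u⟫ ^ 2 := by
  have bZ : BM fun z : ι → X => ⟪u, Rh φ w β z u⟫ :=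
    S.bmR continuous_id continuous_const continuous_const (fun _ => le_rfl) (fun _ => le_rfl)
  have bZi : BM fun z : ι → X => ⟪u, Qh φ w β i z u⟫ :=
    S.bmQ i continuous_id continuous_const continuous_const (fun _ => le_rfl) (fun _ => le_rfl)
  have h1 : ∫ z, ⟪u, Qh φ w β i z u⟫ ^ 2 ∂(Measure.pi P)
      ≤ (17 / 16) ^ 2 * ∫ z, ⟪u, Rh φ w β z u⟫ ^ 2 ∂(Measure.pi P) := by
    rw [← integral_const_mul]
    refine integral_mono ((bZi.pow 2).integrable _) (((bZ.pow 2).const_mul _).integrable _)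
      fun z => ?_
    simp only
    rw [← mul_pow]
    refine pow_le_pow_left₀ ((S.posQ i z).2 u) ?_ 2
    have := S.rq_quad_ge i z u
    linarith
  have h2 := S.two u
  have h3 := S.mean_le u
  have h0 : 0 ≤ ⟪u, res B β u⟫ := S.posB.2 u
  have h4 : ∫ z, ⟪u, Rh φ w β z u⟫ ^ 2 ∂(Measure.pi P) ≤ 64 * ⟪u, res B β u⟫ ^ 2 := by
    calc _ ≤ _ := h2
      _ ≤ 8 * ⟪u, res B β u⟫ * (8 * ⟪u, res B β u⟫) := by gcongr
      _ = _ := by ring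
  nlinarith [sq_nonneg ⟪u, res B β u⟫]

end Setup
end setting2

section setting3
set_option linter.unusedSectionVars false
variable {H : Type u} [NormedAddCommGroup H] [InnerProductSpace ℝ H] [CompleteSpace H]
variable {X : Type*} [TopologicalSpace X] [SecondCountableTopology X] [MeasurableSpace X]
  [BorelSpace X]
variable {ι : Type*} [Fintype ι] [DecidableEq ι]
variable {φ : X → H} {P : ι → Measure X} [∀ i, IsProbabilityMeasure (P i)] {w : ι → ℝ} {β : ℝ}
  {B : H →L[ℝ] H}

namespace Setup
variable (S : Setup φ P w β B)
include S

lemma jx (i : ι) : BM fun p : (ι → X) × X => ⟪φ p.2, Qh φ w β i p.1 (φ p.2)⟫ :=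
  S.bmQ i continuous_fst (S.hφ.comp continuous_snd) (S.hφ.comp continuous_snd) (fun _ => S.nφ _)
      (fun _ => S.nφ _)

lemma xg {s : ℝ} (hs : ∀ t, ⟪φ t, res B β (φ t)⟫ ≤ s) (i : ι) {g : X → ℝ} (hg : BM g)
    (hg0 : ∀ t, 0 ≤ g t) :
    ∫ z, ∫ t, g t * ⟪φ t, Qh φ w β i z (φ t)⟫ ^ 2 ∂(P i) ∂(Measure.pi P)
      ≤ 73 * s ^ 2 * ∫ t, g t ∂(P i) := by
  have j := (hg.comp (measurable_snd (α := ι → X))).mul ((S.jx i).pow 2)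
  rw [integral_integral_swap (f := fun z t => g t * ⟪φ t, Qh φ w β i z (φ t)⟫ ^ 2)
    (j.integrable ((Measure.pi P).prod (P i)))]
  have j' : BM fun p : X × (ι → X) => g p.1 * ⟪φ p.1, Qh φ w β i p.2 (φ p.1)⟫ ^ 2 :=
    j.comp measurable_swap
  rw [← integral_const_mul]
  refine integral_mono ((j'.integral_right (Measure.pi P)).integrable _)
    ((hg.const_mul _).integrable _) fun t => ?_
  simp only [integral_const_mul]
  rw [mul_comm]
  refine mul_le_mul_of_nonneg_right ((S.sq_le (φ t) i).trans ?_) (hg0 t)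
  have := S.posB.2 (φ t)
  have := hs t
  gcongr

lemma xg' {s : ℝ} (hs : ∀ t, ⟪φ t, res B β (φ t)⟫ ≤ s) (i : ι) {g : X → ℝ} (hg : BM g)
    (hg0 : ∀ t, 0 ≤ g t) :
    ∫ z, g (z i) * ⟪φ (z i), Qh φ w β i z (φ (z i))⟫ ^ 2 ∂(Measure.pi P)
      ≤ 73 * s ^ 2 * ∫ t, g t ∂(P i) := by
  refine le_trans (le_of_eq ?_) (S.xg hs i hg hg0)
  exact integral_resample P (F := fun p => g p.2 * ⟪φ p.2, Qh φ w β i p.1 (φ p.2)⟫ ^ 2)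
    ((hg.comp measurable_snd).mul ((S.jx i).pow 2)) i (fun z t s => by simp only [Qh_indep])

lemma xx {s : ℝ} (hs : ∀ t, ⟪φ t, res B β (φ t)⟫ ≤ s) (i : ι) :
    ∫ z, ⟪φ (z i), Qh φ w β i z (φ (z i))⟫ ^ 2 ∂(Measure.pi P) ≤ 73 * s ^ 2 := by
  simpa using S.xg' hs i (BM.const 1) (fun _ => zero_le_one)

lemma xx' {s : ℝ} (hs : ∀ t, ⟪φ t, res B β (φ t)⟫ ≤ s) (i : ι) :
    ∫ z, ∫ t, ⟪φ t, Qh φ w β i z (φ t)⟫ ^ 2 ∂(P i) ∂(Measure.pi P) ≤ 73 * s ^ 2 := by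
  simpa using S.xg hs i (BM.const 1) (fun _ => zero_le_one)

lemma y_sq (i : ι) (z : ι → X) (t : X) :
    ⟪φ t, Qh φ w β i z (φ (z i))⟫ ^ 2 ≤
      1 / 2 * ⟪φ t, Qh φ w β i z (φ t)⟫ ^ 2
        + 1 / 2 * ⟪φ (z i), Qh φ w β i z (φ (z i))⟫ ^ 2 := by
  have h := (S.posQ i z).cs (φ t) (φ (z i))
  nlinarith [sq_nonneg (⟪φ t, Qh φ w β i z (φ t)⟫ - ⟪φ (z i), Qh φ w β i z (φ (z i))⟫)]

lemma bmy (i : ι) (z : ι → X) : BM fun t => ⟪φ t, Qh φ w β i z (φ (z i))⟫ := S.bmφ _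

lemma bmxt (i : ι) (z : ι → X) : BM fun t => ⟪φ t, Qh φ w β i z (φ t)⟫ :=
  (S.jx i).comp (measurable_const.prodMk measurable_id : Measurable fun t : X => (z, t))

/-- bias of the resolvent form at a fixed vector -/
lemma three {s η : ℝ} (hs0 : 0 < s) (hs : ∀ t, ⟪φ t, res B β (φ t)⟫ ≤ s) (hη0 : 0 ≤ η)
    (hη : ∀ i, w i ≤ η) (u : H) :
    |∫ z, ⟪u, Rh φ w β z u⟫ ∂(Measure.pi P) - ⟪u, res B β u⟫| ≤ 49 * η * s * ⟪u, res B β u⟫ := by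
  set r := ⟪u, res B β u⟫ with hr
  have hr0 : 0 ≤ r := S.posB.2 u
  have bZ : BM fun z : ι → X => ⟪u, Rh φ w β z u⟫ :=
    S.bmR continuous_id continuous_const continuous_const (fun _ => le_rfl) (fun _ => le_rfl)
  have bb : ∀ i, BM fun z : ι → X => ⟪φ (z i), Rh φ w β z u⟫ := fun i =>
    S.bmR continuous_id (S.cφ i) continuous_const (fun _ => S.nφ _) (fun _ => le_rfl)
  have bq : ∀ i, BM fun z : ι → X => ⟪φ (z i), Qh φ w β i z u⟫ := fun i =>
    S.bmQ i continuous_id (S.cφ i) continuous_const (fun _ => S.nφ _) (fun _ => le_rfl)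
  have bx : ∀ i, BM fun z : ι → X => ⟪φ (z i), Qh φ w β i z (φ (z i))⟫ := fun i =>
    S.bmQ i continuous_id (S.cφ i) (S.cφ i) (fun _ => S.nφ _) (fun _ => S.nφ _)
  have ba : ∀ i, BM fun z : ι → X => ⟪φ (z i), res B β u⟫ := fun i =>
    (S.bmφ _).comp (measurable_pi_apply i)
  have ja : BM fun p : (ι → X) × X => ⟪φ p.2, res B β u⟫ := (S.bmφ _).comp measurable_snd
  have jq : ∀ i, BM fun p : (ι → X) × X => ⟪φ p.2, Qh φ w β i p.1 u⟫ := fun i =>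
    S.bmQ i continuous_fst (S.hφ.comp continuous_snd) continuous_const (fun _ => S.nφ _)
      (fun _ => le_rfl)
  have jy : ∀ i, BM fun p : (ι → X) × X => ⟪φ p.2, Qh φ w β i p.1 (φ (p.1 i))⟫ := fun i =>
    S.bmQ i continuous_fst (S.hφ.comp continuous_snd) ((S.cφ i).comp continuous_fst)
      (fun _ => S.nφ _) (fun _ => S.nφ _)
  -- the two parts
  set M : ι → (ι → X) → ℝ := fun i z => (∫ t, ⟪φ t, res B β u⟫ * ⟪φ t, Qh φ w β i z u⟫ ∂(P i))
    - ⟪φ (z i), res B β u⟫ * ⟪φ (z i), Qh φ w β i z u⟫ with hM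
  set N : ι → (ι → X) → ℝ := fun i z =>
    ⟪φ (z i), res B β u⟫ * ⟪φ (z i), Qh φ w β i z (φ (z i))⟫ * ⟪φ (z i), Rh φ w β z u⟫
    - (∫ t, ⟪φ t, res B β u⟫ * ⟪φ t, Qh φ w β i z (φ (z i))⟫ ∂(P i)) * ⟪φ (z i), Rh φ w β z u⟫
    with hN
  have bM : ∀ i, BM (M i) := fun i =>
    ((ja.mul (jq i)).integral_right (P i)).sub ((ba i).mul (bq i))
  have bN : ∀ i, BM (N i) := fun i =>
    (((ba i).mul (bx i)).mul (bb i)).sub (((ja.mul (jy i)).integral_right (P i)).mul (bb i))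
  have hdec : ∀ z, ⟪u, Rh φ w β z u⟫ - r = ∑ i, (w i * M i z + w i * (w i * N i z)) := by
    intro z
    rw [hr, S.diff z u u]
    refine Finset.sum_congr rfl fun i _ => ?_
    have e1 : (∫ t, ⟪φ t, res B β u⟫ * ⟪φ t, Rh φ w β z u⟫ ∂(P i))
        = (∫ t, ⟪φ t, res B β u⟫ * ⟪φ t, Qh φ w β i z u⟫ ∂(P i))
          - w i * ⟪φ (z i), Rh φ w β z u⟫
            * ∫ t, ⟪φ t, res B β u⟫ * ⟪φ t, Qh φ w β i z (φ (z i))⟫ ∂(P i) := by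
      rw [← integral_const_mul, ← integral_sub (((S.bmφ _).mul (S.bmφ _)).integrable _)
        ((((S.bmφ _).mul (S.bmφ _)).const_mul _).integrable _)]
      congr 1; funext t
      rw [S.rq i z (φ t) u]; ring
    have e2 := S.rq i z (φ (z i)) u
    have e3 : ⟪φ (z i), res B β u⟫ * ⟪φ (z i), Rh φ w β z u⟫
        = ⟪φ (z i), res B β u⟫ * ⟪φ (z i), Qh φ w β i z u⟫
          - w i * (⟪φ (z i), res B β u⟫ * ⟪φ (z i), Qh φ w β i z (φ (z i))⟫
            * ⟪φ (z i), Rh φ w β z u⟫) := by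
      conv_lhs => rw [e2]
      ring
    rw [e1, e3]
    simp only [hM, hN]
    ring
  have hM0 : ∀ i, ∫ z, M i z ∂(Measure.pi P) = 0 := by
    intro i
    have := integral_resample P
      (F := fun p => ⟪φ p.2, res B β u⟫ * ⟪φ p.2, Qh φ w β i p.1 u⟫)
      (ja.mul (jq i)) i (fun z t s => by simp only [Qh_indep])
    simp only [hM]
    rw [integral_sub (((ja.mul (jq i)).integral_right (P i)).integrable _)
      (((ba i).mul (bq i)).integrable _), this, sub_self]
  -- bound on N
  have hA : ∀ i, 0 ≤ ∫ t, ⟪φ t, res B β u⟫ ^ 2 ∂(P i) :=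
    fun i => integral_nonneg fun t => sq_nonneg _
  have hNb : ∀ i, ∫ z, |N i z| ∂(Measure.pi P) ≤ s * (73 / 3 * ∫ t, ⟪φ t, res B β u⟫ ^ 2 ∂(P i)
      + 3 * ∫ z, ⟪φ (z i), Rh φ w β z u⟫ ^ 2 ∂(Measure.pi P)) := by
    intro i
    have am : ∀ a y b Y : ℝ, y ^ 2 ≤ Y →
        |a * y * b| ≤ 1 / (6 * s) * (a ^ 2 * Y) + 3 / 2 * s * b ^ 2 := by
      intro a y b Y hY
      have h1 : 1 / (6 * s) * (a * y) ^ 2 + 3 / 2 * s * b ^ 2 - |a * y| * |b|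
          = 1 / (6 * s) * (|a * y| - 3 * s * |b|) ^ 2 := by
        rw [← sq_abs (a * y), ← sq_abs b]; field_simp; ring
      have h2 : 0 ≤ 1 / (6 * s) * (|a * y| - 3 * s * |b|) ^ 2 := by positivity
      have h3 : 1 / (6 * s) * (a * y) ^ 2 ≤ 1 / (6 * s) * (a ^ 2 * Y) := by
        rw [mul_pow]; gcongr
      rw [abs_mul]; linarith
    have pt : ∀ z, |N i z| ≤ (1 / (6 * s) * (⟪φ (z i), res B β u⟫ ^ 2 *
          ⟪φ (z i), Qh φ w β i z (φ (z i))⟫ ^ 2) + 3 / 2 * s * ⟪φ (z i), Rh φ w β z u⟫ ^ 2)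
        + (1 / (12 * s) * (∫ t, ⟪φ t, res B β u⟫ ^ 2 * ⟪φ t, Qh φ w β i z (φ t)⟫ ^ 2 ∂(P i))
          + 1 / (12 * s) * (∫ t, ⟪φ t, res B β u⟫ ^ 2 ∂(P i))
            * ⟪φ (z i), Qh φ w β i z (φ (z i))⟫ ^ 2
          + 3 / 2 * s * ⟪φ (z i), Rh φ w β z u⟫ ^ 2) := by
      intro z
      simp only [hN]
      refine (abs_sub _ _).trans (add_le_add (am _ _ _ _ le_rfl) ?_)
      rw [← integral_mul_const]
      refine (abs_integral_le_integral_abs).trans ?_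
      have b1 : BM fun t => 1 / (12 * s) * (⟪φ t, res B β u⟫ ^ 2
          * ⟪φ t, Qh φ w β i z (φ t)⟫ ^ 2) :=
        (((S.bmφ _).pow 2).mul ((S.bmxt i z).pow 2)).const_mul _
      have b2 : BM fun t => 1 / (12 * s) * ⟪φ t, res B β u⟫ ^ 2
            * ⟪φ (z i), Qh φ w β i z (φ (z i))⟫ ^ 2 :=
        (((S.bmφ _).pow 2).const_mul _).mul (BM.const _)
      have b3 : BM fun _ : X => 3 / 2 * s * ⟪φ (z i), Rh φ w β z u⟫ ^ 2 := BM.const _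
      have := integral_mono ((((S.bmφ (res B β u)).mul (S.bmy i z)).mul
        (BM.const ⟪φ (z i), Rh φ w β z u⟫)).abs.integrable (P i))
        (((b1.add b2).add b3).integrable (P i)) (fun t => by
          refine (am _ _ _ _ (S.y_sq i z t)).trans (le_of_eq ?_)
          field_simp; ring)
      refine this.trans (le_of_eq ?_)
      rw [integral_add ((b1.add b2).integrable _) (b3.integrable _),
        integral_add (b1.integrable _) (b2.integrable _)]
      simp only [integral_const_mul, integral_mul_const, integral_const, probReal_univ, one_smul]
    have c1 : BM fun z : ι → X => 1 / (6 * s) * (⟪φ (z i), res B β u⟫ ^ 2 *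
          ⟪φ (z i), Qh φ w β i z (φ (z i))⟫ ^ 2) :=
      (((ba i).pow 2).mul ((bx i).pow 2)).const_mul _
    have c2 : BM fun z : ι → X => 3 / 2 * s * ⟪φ (z i), Rh φ w β z u⟫ ^ 2 :=
      ((bb i).pow 2).const_mul _
    have c3 : BM fun z : ι → X =>
        1 / (12 * s) * (∫ t, ⟪φ t, res B β u⟫ ^ 2 * ⟪φ t, Qh φ w β i z (φ t)⟫ ^ 2 ∂(P i)) :=
      (((ja.pow 2).mul ((S.jx i).pow 2)).integral_right (P i)).const_mul _
    have c4 : BM fun z : ι → X => 1 / (12 * s) * (∫ t, ⟪φ t, res B β u⟫ ^ 2 ∂(P i))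
            * ⟪φ (z i), Qh φ w β i z (φ (z i))⟫ ^ 2 := ((bx i).pow 2).const_mul _
    have := integral_mono ((bN i).abs.integrable (Measure.pi P))
      (((c1.add c2).add ((c3.add c4).add c2)).integrable (Measure.pi P)) pt
    refine this.trans ?_
    rw [integral_add ((c1.add c2).integrable _) (((c3.add c4).add c2).integrable _),
      integral_add (c1.integrable _) (c2.integrable _),
      integral_add ((c3.add c4).integrable _) (c2.integrable _),
      integral_add (c3.integrable _) (c4.integrable _)]
    simp only [integral_const_mul]
    have d1 := S.xg' hs i ((S.bmφ (res B β u)).pow 2) (fun _ => sq_nonneg _)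
    have d2 := S.xg hs i ((S.bmφ (res B β u)).pow 2) (fun _ => sq_nonneg _)
    have d3 := S.xx hs i
    set A := ∫ t, ⟪φ t, res B β u⟫ ^ 2 ∂(P i)
    have hA := hA i
    set b2 := ∫ z, ⟪φ (z i), Rh φ w β z u⟫ ^ 2 ∂(Measure.pi P)
    calc _ ≤ 1 / (6 * s) * (73 * s ^ 2 * A) + 3 / 2 * s * b2
          + (1 / (12 * s) * (73 * s ^ 2 * A) + 1 / (12 * s) * A * (73 * s ^ 2) + 3 / 2 * s * b2) := by
          gcongr
      _ = _ := by field_simp; ring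
  have hE : ∫ z, ⟪u, Rh φ w β z u⟫ ∂(Measure.pi P) - r
      = ∑ i, w i * (w i * ∫ z, N i z ∂(Measure.pi P)) := by
    have : ∫ z, (⟪u, Rh φ w β z u⟫ - r) ∂(Measure.pi P)
        = ∫ z, ⟪u, Rh φ w β z u⟫ ∂(Measure.pi P) - r := by
      rw [integral_sub (bZ.integrable _) (by simp)]; simp
    rw [← this]
    simp only [hdec]
    rw [integral_finsetSum _ (fun i _ => (((bM i).const_mul _).add
      (((bN i).const_mul _).const_mul _)).integrable _)]
    refine Finset.sum_congr rfl fun i _ => ?_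
    rw [integral_add (((bM i).const_mul _).integrable _)
      ((((bN i).const_mul _).const_mul _).integrable _)]
    simp only [integral_const_mul, hM0]
    ring
  rw [hE]
  have h1 : |∑ i, w i * (w i * ∫ z, N i z ∂(Measure.pi P))|
      ≤ ∑ i, η * s * (73 / 3 * (w i * ∫ t, ⟪φ t, res B β u⟫ ^ 2 ∂(P i))
        + 3 * (w i * ∫ z, ⟪φ (z i), Rh φ w β z u⟫ ^ 2 ∂(Measure.pi P))) := by
    refine (Finset.abs_sum_le_sum_abs _ _).trans (Finset.sum_le_sum fun i _ => ?_)
    rw [abs_mul, abs_mul, abs_of_nonneg (S.hw i)]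
    have hw := S.hw i
    have h1 : |∫ z, N i z ∂(Measure.pi P)| ≤ _ := (abs_integral_le_integral_abs).trans (hNb i)
    have h2 : 0 ≤ ∫ z, ⟪φ (z i), Rh φ w β z u⟫ ^ 2 ∂(Measure.pi P) :=
      integral_nonneg fun z => sq_nonneg _
    have h3 := hA i
    calc _ ≤ w i * (η * (s * (73 / 3 * ∫ t, ⟪φ t, res B β u⟫ ^ 2 ∂(P i)
      + 3 * ∫ z, ⟪φ (z i), Rh φ w β z u⟫ ^ 2 ∂(Measure.pi P)))) := by
          gcongr
          exact hη i
      _ = _ := by ring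
  refine h1.trans ?_
  rw [← Finset.mul_sum, Finset.sum_add_distrib, ← Finset.mul_sum, ← Finset.mul_sum]
  have h2 := S.sumA u
  have h3 : ∑ i, w i * ∫ z, ⟪φ (z i), Rh φ w β z u⟫ ^ 2 ∂(Measure.pi P) ≤ 8 * r := by
    refine le_trans ?_ (S.mean_le u)
    simp only [← integral_const_mul]
    rw [← integral_finsetSum _ (fun i _ => (((bb i).pow 2).const_mul _).integrable _)]
    exact integral_mono ((BM.sum _ (fun i _ => ((bb i).pow 2).const_mul (w i))).integrable _)
      (bZ.integrable _) (fun z => S.sumb z u)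
  calc _ ≤ η * s * (73 / 3 * r + 3 * (8 * r)) := by gcongr
    _ ≤ η * s * (49 * r) := by gcongr; linarith
    _ = _ := by ring

end Setup
end setting3

section setting4
set_option linter.unusedSectionVars false
variable {H : Type u} [NormedAddCommGroup H] [InnerProductSpace ℝ H] [CompleteSpace H]
variable {X : Type*} [TopologicalSpace X] [SecondCountableTopology X] [MeasurableSpace X]
  [BorelSpace X]
variable {ι : Type*} [Fintype ι] [DecidableEq ι]
variable {φ : X → H} {P : ι → Measure X} [∀ i, IsProbabilityMeasure (P i)] {w : ι → ℝ} {β : ℝ}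
  {B : H →L[ℝ] H}

namespace Setup
variable (S : Setup φ P w β B)
include S

lemma bmξ (i k : ι) : BM fun z : ι → X => ⟪φ (z i), Rh φ w β z (φ (z k))⟫ :=
  S.bmR continuous_id (S.cφ i) (S.cφ k) (fun _ => S.nφ _) (fun _ => S.nφ _)

lemma bmx (i j k : ι) : BM fun z : ι → X => ⟪φ (z i), Qh φ w β j z (φ (z k))⟫ :=
  S.bmQ j continuous_id (S.cφ i) (S.cφ k) (fun _ => S.nφ _) (fun _ => S.nφ _)

/-- bias, one index -/
lemma four {s η : ℝ} (hs0 : 0 < s) (hs : ∀ t, ⟪φ t, res B β (φ t)⟫ ≤ s) (hη0 : 0 ≤ η)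
    (hη : ∀ i, w i ≤ η) (i : ι) :
    |∫ z, ⟪φ (z i), Rh φ w β z (φ (z i))⟫ ∂(Measure.pi P)
      - ∫ t, ⟪φ t, res B β (φ t)⟫ ∂(P i)| ≤ 195 * η * s ^ 2 := by
  have bξ := S.bmξ i i
  have bx := S.bmx i i i
  have jρ : BM fun p : (ι → X) × X => ⟪φ p.2, Rh φ w β p.1 (φ p.2)⟫ :=
    S.bmR continuous_fst (S.hφ.comp continuous_snd) (S.hφ.comp continuous_snd) (fun _ => S.nφ _)
      (fun _ => S.nφ _)
  have hx0 : ∀ z : ι → X, 0 ≤ ⟪φ (z i), Qh φ w β i z (φ (z i))⟫ := fun z => (S.posQ i z).2 _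
  have s1 : |∫ z, ⟪φ (z i), Rh φ w β z (φ (z i))⟫ ∂(Measure.pi P)
      - ∫ z, ⟪φ (z i), Qh φ w β i z (φ (z i))⟫ ∂(Measure.pi P)| ≤ 73 * η * s ^ 2 := by
    rw [← integral_sub (bξ.integrable _) (bx.integrable _)]
    refine (abs_integral_le_integral_abs).trans ?_
    have : ∫ z, |⟪φ (z i), Rh φ w β z (φ (z i))⟫ - ⟪φ (z i), Qh φ w β i z (φ (z i))⟫|
          ∂(Measure.pi P)
        ≤ ∫ z, η * ⟪φ (z i), Qh φ w β i z (φ (z i))⟫ ^ 2 ∂(Measure.pi P) := by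
      refine integral_mono ((bξ.sub bx).abs.integrable _) (((bx.pow 2).const_mul _).integrable _)
        fun z => ?_
      have h1 := S.rq i z (φ (z i)) (φ (z i))
      have h2 := S.rq_quad_le i z (φ (z i))
      have h3 := (S.posR z).2 (φ (z i))
      have h4 := hx0 z
      have h5 := S.hw i
      have h6 := hη i
      simp only
      set x := ⟪φ (z i), Qh φ w β i z (φ (z i))⟫
      set ξ := ⟪φ (z i), Rh φ w β z (φ (z i))⟫
      have e : ξ - x = -(w i * x * ξ) := by linarith
      rw [e, abs_neg, abs_of_nonneg (by positivity)]
      calc w i * x * ξ ≤ η * x * x := by gcongr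
        _ = _ := by ring
    rw [integral_const_mul] at this
    have := mul_le_mul_of_nonneg_left (S.xx hs i) hη0
    linarith
  have s2 : ∫ z, ⟪φ (z i), Qh φ w β i z (φ (z i))⟫ ∂(Measure.pi P)
      = ∫ z, ∫ t, ⟪φ t, Qh φ w β i z (φ t)⟫ ∂(P i) ∂(Measure.pi P) :=
    integral_resample P (F := fun p => ⟪φ p.2, Qh φ w β i p.1 (φ p.2)⟫) (S.jx i) i
      (fun z t s => by simp only [Qh_indep])
  have bI1 := (S.jx i).integral_right (P i)
  have bI2 := jρ.integral_right (P i)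
  have bI3 := ((S.jx i).pow 2).integral_right (P i)
  have bρt : ∀ z : ι → X, BM fun t => ⟪φ t, Rh φ w β z (φ t)⟫ := fun z =>
    jρ.comp (measurable_const.prodMk measurable_id : Measurable fun t : X => (z, t))
  have s3 : |∫ z, ∫ t, ⟪φ t, Qh φ w β i z (φ t)⟫ ∂(P i) ∂(Measure.pi P)
      - ∫ z, ∫ t, ⟪φ t, Rh φ w β z (φ t)⟫ ∂(P i) ∂(Measure.pi P)| ≤ 73 * η * s ^ 2 := by
    rw [← integral_sub (bI1.integrable _) (bI2.integrable _)]
    refine (abs_integral_le_integral_abs).trans ?_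
    have : ∫ z, |(∫ t, ⟪φ t, Qh φ w β i z (φ t)⟫ ∂(P i)) - ∫ t, ⟪φ t, Rh φ w β z (φ t)⟫ ∂(P i)|
          ∂(Measure.pi P)
        ≤ ∫ z, (η * (1 / 2 * ∫ t, ⟪φ t, Qh φ w β i z (φ t)⟫ ^ 2 ∂(P i))
          + η * (1 / 2 * ⟪φ (z i), Qh φ w β i z (φ (z i))⟫ ^ 2)) ∂(Measure.pi P) := by
      refine integral_mono ((bI1.sub bI2).abs.integrable _)
        ((((bI3.const_mul _).const_mul _).add (((bx.pow 2).const_mul _).const_mul _)).integrable _)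
        fun z => ?_
      simp only
      rw [← integral_sub ((S.bmxt i z).integrable _) ((bρt z).integrable _)]
      refine (abs_integral_le_integral_abs).trans ?_
      have b1 : BM fun t => η * (1 / 2 * ⟪φ t, Qh φ w β i z (φ t)⟫ ^ 2) :=
        (((S.bmxt i z).pow 2).const_mul _).const_mul _
      have b2 : BM fun _ : X => η * (1 / 2 * ⟪φ (z i), Qh φ w β i z (φ (z i))⟫ ^ 2) := BM.const _
      have := integral_mono (((S.bmxt i z).sub (bρt z)).abs.integrable (P i))
        ((b1.add b2).integrable (P i)) (fun t => by
          have h1 := S.rq i z (φ t) (φ t)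
          have h2 := S.rq_abs_le i z (φ t)
          have h3 : ⟪φ t, Qh φ w β i z (φ (z i))⟫ = ⟪φ (z i), Qh φ w β i z (φ t)⟫ := by
            rw [← (S.posQ i z).1, real_inner_comm]
          have h4 := S.y_sq i z t
          have h5 := S.hw i
          have h6 := hη i
          rw [← h3] at h2
          simp only
          set y := ⟪φ t, Qh φ w β i z (φ (z i))⟫
          have e : ⟪φ t, Qh φ w β i z (φ t)⟫ - ⟪φ t, Rh φ w β z (φ t)⟫
            = w i * y * ⟪φ (z i), Rh φ w β z (φ t)⟫ := by linarith
          rw [e, abs_mul, abs_mul, abs_of_nonneg h5]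
          calc _ ≤ η * |y| * |y| := by gcongr
            _ = η * y ^ 2 := by rw [mul_assoc, ← sq, sq_abs]
            _ ≤ η * (1 / 2 * ⟪φ t, Qh φ w β i z (φ t)⟫ ^ 2
        + 1 / 2 * ⟪φ (z i), Qh φ w β i z (φ (z i))⟫ ^ 2) := by gcongr
            _ = _ := by ring)
      refine this.trans (le_of_eq ?_)
      rw [integral_add (b1.integrable _) (b2.integrable _)]
      simp only [integral_const_mul, integral_const, probReal_univ, one_smul]
    refine this.trans ?_
    rw [integral_add (((bI3.const_mul _).const_mul _).integrable _)
      ((((bx.pow 2).const_mul _).const_mul _).integrable _)]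
    simp only [integral_const_mul]
    have h1 := mul_le_mul_of_nonneg_left (S.xx hs i) hη0
    have h2 := mul_le_mul_of_nonneg_left (S.xx' hs i) hη0
    linarith
  have s4 : |∫ z, ∫ t, ⟪φ t, Rh φ w β z (φ t)⟫ ∂(P i) ∂(Measure.pi P)
      - ∫ t, ⟪φ t, res B β (φ t)⟫ ∂(P i)| ≤ 49 * η * s ^ 2 := by
    rw [integral_integral_swap (f := fun z t => ⟪φ t, Rh φ w β z (φ t)⟫)
      (jρ.integrable ((Measure.pi P).prod (P i)))]
    have j' : BM fun p : X × (ι → X) => ⟪φ p.1, Rh φ w β p.2 (φ p.1)⟫ := jρ.comp measurable_swap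
    have b1 := j'.integral_right (Measure.pi P)
    have b2 : BM fun t => ⟪φ t, res B β (φ t)⟫ :=
      bm_res (T := fun _ => B) continuous_const (fun _ => S.hB) S.hβ S.hφ S.hφ S.nφ S.nφ
    rw [← integral_sub (b1.integrable _) (b2.integrable _)]
    refine (abs_integral_le_integral_abs).trans ?_
    have := integral_mono ((b1.sub b2).abs.integrable (P i))
      ((BM.const (49 * η * s ^ 2)).integrable (P i)) (fun t => by
        refine (S.three hs0 hs hη0 hη (φ t)).trans ?_
        have := hs t
        calc _ ≤ 49 * η * s * s := by gcongr
          _ = _ := by ring)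
    simpa using this
  rw [s2] at s1
  rw [abs_le] at *
  constructor <;> linarith

/-- the statistic -/
def _root_.KKLp.Fh (φ : X → H) (w v : ι → ℝ) (β : ℝ) (z : ι → X) : ℝ :=
  ∑ i, v i * ⟪φ (z i), Rh φ w β z (φ (z i))⟫

lemma bmF (v : ι → ℝ) : BM (Fh φ w v β) := BM.sum _ fun i _ => (S.bmξ i i).const_mul (v i)

lemma bias {s η : ℝ} (hs0 : 0 < s) (hs : ∀ t, ⟪φ t, res B β (φ t)⟫ ≤ s) (hη0 : 0 ≤ η)
    (hη : ∀ i, w i ≤ η) {v : ι → ℝ} (hv : ∀ i, 0 ≤ v i) (hv1 : ∑ i, v i = 1) :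
    |∫ z, Fh φ w v β z ∂(Measure.pi P)
      - ∑ i, v i * ∫ t, ⟪φ t, res B β (φ t)⟫ ∂(P i)| ≤ 195 * η * s ^ 2 := by
  unfold Fh
  rw [integral_finsetSum _ (fun i _ => ((S.bmξ i i).const_mul _).integrable _),
    ← Finset.sum_sub_distrib]
  refine (Finset.abs_sum_le_sum_abs _ _).trans ?_
  calc _ ≤ ∑ i, v i * (195 * η * s ^ 2) := by
        refine Finset.sum_le_sum fun i _ => ?_
        rw [integral_const_mul, ← mul_sub, abs_mul, abs_of_nonneg (hv i)]
        exact mul_le_mul_of_nonneg_left (S.four hs0 hs hη0 hη i) (hv i)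
    _ = _ := by rw [← Finset.sum_mul, hv1, one_mul]

/-- the cross term when removing point `k` -/
lemma cross_nonneg (k i : ι) (z : ι → X) :
    0 ≤ ⟪φ (z i), Qh φ w β k z (φ (z k))⟫ * ⟪φ (z k), Rh φ w β z (φ (z i))⟫ := by
  have h3 : ⟪φ (z i), Qh φ w β k z (φ (z k))⟫ = ⟪φ (z k), Qh φ w β k z (φ (z i))⟫ := by
    rw [← (S.posQ k z).1, real_inner_comm]
  rw [h3, ← S.rq_v k z (φ (z i))]
  have := (S.posQ k z).2 (φ (z k))
  have := S.hw k
  set y := ⟪φ (z k), Rh φ w β z (φ (z i))⟫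
  have e : y * (1 + w k * ⟪φ (z k), Qh φ w β k z (φ (z k))⟫) * y
    = (1 + w k * ⟪φ (z k), Qh φ w β k z (φ (z k))⟫) * y ^ 2 := by ring
  rw [e]; positivity

/-- leave-one-out statistic -/
def _root_.KKLp.Fk (φ : X → H) (w v : ι → ℝ) (β C : ℝ) (k : ι) (z : ι → X) : ℝ :=
  (∑ i ∈ Finset.univ.erase k, v i * ⟪φ (z i), Qh φ w β k z (φ (z i))⟫) + v k * C

lemma Fk_indep (v : ι → ℝ) (C : ℝ) (k : ι) (z : ι → X) (t : X) :
    Fk φ w v β C k (Function.update z k t) = Fk φ w v β C k z := by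
  unfold Fk
  congr 1
  refine Finset.sum_congr rfl fun i hi => ?_
  rw [Qh_indep, Function.update_of_ne (Finset.ne_of_mem_erase hi)]

lemma bmFk (v : ι → ℝ) (C : ℝ) (k : ι) : BM (Fk φ w v β C k) :=
  (BM.sum _ fun i _ => (S.bmx i k i).const_mul (v i)).add (BM.const _)

lemma F_sub (v : ι → ℝ) (C : ℝ) (k : ι) (z : ι → X) :
    Fh φ w v β z - Fk φ w v β C k z = v k * (⟪φ (z k), Rh φ w β z (φ (z k))⟫ - C)
      - ∑ i ∈ Finset.univ.erase k, v i * (w k *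
        (⟪φ (z i), Qh φ w β k z (φ (z k))⟫ * ⟪φ (z k), Rh φ w β z (φ (z i))⟫)) := by
  unfold Fh Fk
  rw [← Finset.add_sum_erase Finset.univ _ (Finset.mem_univ k)]
  have : ∀ i, v i * ⟪φ (z i), Rh φ w β z (φ (z i))⟫ = v i * ⟪φ (z i), Qh φ w β k z (φ (z i))⟫
      - v i * (w k * (⟪φ (z i), Qh φ w β k z (φ (z k))⟫ * ⟪φ (z k), Rh φ w β z (φ (z i))⟫)) := by
    intro i
    rw [S.rq k z (φ (z i)) (φ (z i))]; ring
  rw [Finset.sum_congr rfl fun i (_ : i ∈ Finset.univ.erase k) => this i, Finset.sum_sub_distrib]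
  ring

lemma loo1 {v : ι → ℝ} (hv : ∀ i, 0 ≤ v i) {a : ℝ} (ha : 0 < a) (hav : ∀ i, a * v i ≤ w i)
    (k : ι) (z : ι → X) :
    |Fh φ w v β z - Fk φ w v β 0 k z| ≤ w k / a * ⟪φ (z k), Qh φ w β k z (φ (z k))⟫ := by
  have hva : ∀ i, v i ≤ w i / a := fun i => by rw [le_div_iff₀ ha, mul_comm]; exact hav i
  have hwk := S.hw k
  have hx0 := (S.posQ k z).2 (φ (z k))
  have hξ0 := (S.posR z).2 (φ (z k))
  rw [S.F_sub v 0 k z, sub_zero]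
  have h1 : v k * ⟪φ (z k), Rh φ w β z (φ (z k))⟫
      ≤ w k / a * ⟪φ (z k), Qh φ w β k z (φ (z k))⟫ :=
    mul_le_mul (hva k) (S.rq_quad_le k z _) hξ0 (by positivity)
  have h2 : 0 ≤ ∑ i ∈ Finset.univ.erase k, v i * (w k *
        (⟪φ (z i), Qh φ w β k z (φ (z k))⟫ * ⟪φ (z k), Rh φ w β z (φ (z i))⟫)) :=
    Finset.sum_nonneg fun i _ => mul_nonneg (hv i) (mul_nonneg hwk (S.cross_nonneg k i z))
  have h3 : ∑ i ∈ Finset.univ.erase k, v i * (w k *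
        (⟪φ (z i), Qh φ w β k z (φ (z k))⟫ * ⟪φ (z k), Rh φ w β z (φ (z i))⟫))
      ≤ w k / a * ⟪φ (z k), Qh φ w β k z (φ (z k))⟫ := by
    calc _ ≤ ∑ i, v i * (w k *
        (⟪φ (z i), Qh φ w β k z (φ (z k))⟫ * ⟪φ (z k), Rh φ w β z (φ (z i))⟫)) :=
          Finset.sum_le_sum_of_subset_of_nonneg (Finset.erase_subset _ _) fun i _ _ =>
            mul_nonneg (hv i) (mul_nonneg hwk (S.cross_nonneg k i z))
      _ ≤ ∑ i, (w i / a) * (w k *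
        (⟪φ (z i), Qh φ w β k z (φ (z k))⟫ * ⟪φ (z k), Rh φ w β z (φ (z i))⟫)) :=
          Finset.sum_le_sum fun i _ =>
            mul_le_mul_of_nonneg_right (hva i) (mul_nonneg hwk (S.cross_nonneg k i z))
      _ = w k / a * (1 + w k * ⟪φ (z k), Qh φ w β k z (φ (z k))⟫)
          * ∑ i, w i * ⟪φ (z i), Rh φ w β z (φ (z k))⟫ ^ 2 := by
          rw [Finset.mul_sum]
          refine Finset.sum_congr rfl fun i _ => ?_
          have e1 : ⟪φ (z i), Qh φ w β k z (φ (z k))⟫ = ⟪φ (z k), Qh φ w β k z (φ (z i))⟫ := by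
            rw [← (S.posQ k z).1, real_inner_comm]
          have e2 : ⟪φ (z i), Rh φ w β z (φ (z k))⟫ = ⟪φ (z k), Rh φ w β z (φ (z i))⟫ := by
            rw [← (S.posR z).1, real_inner_comm]
          rw [e1, e2, ← S.rq_v k z (φ (z i))]; ring
      _ ≤ w k / a * (1 + w k * ⟪φ (z k), Qh φ w β k z (φ (z k))⟫)
          * ⟪φ (z k), Rh φ w β z (φ (z k))⟫ := by
          gcongr
          exact S.sumb z (φ (z k))
      _ = _ := by rw [mul_assoc, mul_comm (1 + _), S.rq_v k z (φ (z k))]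
  have h4 : 0 ≤ v k * ⟪φ (z k), Rh φ w β z (φ (z k))⟫ := mul_nonneg (hv k) hξ0
  rw [abs_le]; constructor <;> linarith

lemma loo2 (hw1 : ∑ i, w i ≤ 1) {v : ι → ℝ} (hv : ∀ i, 0 ≤ v i) (hv1 : ∑ i, v i = 1) {a : ℝ}
    (ha : 0 < a) (ha1 : a ≤ 1)
    (hav : ∀ i, a * v i ≤ w i) (k : ι) (z : ι → X) :
    |Fh φ w v β z - Fk φ w v β (1 / β) k z| ≤ w k / a * (2 / β ^ 2) := by
  have hβ := S.hβ
  have hva : ∀ i, v i ≤ w i / a := fun i => by rw [le_div_iff₀ ha, mul_comm]; exact hav i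
  have hwk := S.hw k
  rw [S.F_sub v _ k z]
  have h1 : |⟪φ (z k), Rh φ w β z (φ (z k))⟫ - 1 / β| ≤ 1 / β ^ 2 := by
    have u1 : ⟪φ (z k), Rh φ w β z (φ (z k))⟫ ≤ 1 / β := by
      have := res_le (Bh_pos φ S.hw z) hβ (φ (z k))
      rw [S.hn] at this; simpa [Rh] using this
    have u2 := res_lower (Bh_pos φ S.hw z) hβ (φ (z k))
    have u3 : ⟪φ (z k), Bh φ w z (φ (z k))⟫ ≤ 1 := by
      rw [Bh_inner]
      refine le_trans (Finset.sum_le_sum fun i _ => ?_) hw1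
      have := abs_real_inner_le_norm (φ (z i)) (φ (z k))
      rw [S.hn, S.hn, one_mul] at this
      have h2 : ⟪φ (z i), φ (z k)⟫ * ⟪φ (z i), φ (z k)⟫ ≤ 1 := by
        rw [← abs_mul_abs_self]; nlinarith [abs_nonneg ⟪φ (z i), φ (z k)⟫]
      nlinarith [S.hw i]
    have hξ0 := (S.posR z).2 (φ (z k))
    rw [S.hn] at u2
    change _ ≤ ⟪φ (z k), Rh φ w β z (φ (z k))⟫ * _ at u2
    set ξ := ⟪φ (z k), Rh φ w β z (φ (z k))⟫
    have u4 : 1 ≤ ξ * (1 + β) := by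
      norm_num at u2
      nlinarith
    have u5 : 1 / β - ξ ≤ 1 / β ^ 2 := by
      have : 1 / β - 1 / β ^ 2 ≤ 1 / (1 + β) := by
        rw [div_sub_div _ _ hβ.ne' (by positivity), div_le_div_iff₀ (by positivity) (by positivity)]
        nlinarith
      have : 1 / (1 + β) ≤ ξ := by rw [div_le_iff₀ (by positivity)]; exact u4
      linarith
    have : 0 ≤ 1 / β ^ 2 := by positivity
    rw [abs_le]; constructor <;> linarith
  have h2 : |∑ i ∈ Finset.univ.erase k, v i * (w k *
        (⟪φ (z i), Qh φ w β k z (φ (z k))⟫ * ⟪φ (z k), Rh φ w β z (φ (z i))⟫))|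
      ≤ w k / a * (1 / β ^ 2) := by
    rw [abs_of_nonneg (Finset.sum_nonneg fun i _ => mul_nonneg (hv i) (mul_nonneg hwk
      (S.cross_nonneg k i z)))]
    calc _ ≤ ∑ i, v i * (w k *
        (⟪φ (z i), Qh φ w β k z (φ (z k))⟫ * ⟪φ (z k), Rh φ w β z (φ (z i))⟫)) :=
          Finset.sum_le_sum_of_subset_of_nonneg (Finset.erase_subset _ _) fun i _ _ =>
            mul_nonneg (hv i) (mul_nonneg hwk (S.cross_nonneg k i z))
      _ ≤ ∑ i, v i * (w k * (1 / β ^ 2)) := by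
          refine Finset.sum_le_sum fun i _ => ?_
          have e1 : |⟪φ (z i), Qh φ w β k z (φ (z k))⟫| ≤ ‖φ (z i)‖ * ‖φ (z k)‖ / β :=
            abs_res_le (Bh_pos φ (upd_nonneg S.hw k) z) hβ _ _
          have e2 : |⟪φ (z k), Rh φ w β z (φ (z i))⟫| ≤ ‖φ (z k)‖ * ‖φ (z i)‖ / β :=
            abs_res_le (Bh_pos φ S.hw z) hβ _ _
          rw [S.hn, S.hn, one_mul] at e1 e2
          refine mul_le_mul_of_nonneg_left (mul_le_mul_of_nonneg_left ?_ hwk) (hv i)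
          calc _ ≤ |⟪φ (z i), Qh φ w β k z (φ (z k))⟫| * |⟪φ (z k), Rh φ w β z (φ (z i))⟫| := by
                rw [← abs_mul]; exact le_abs_self _
            _ ≤ 1 / β * (1 / β) := by gcongr
            _ = _ := by rw [div_mul_div_comm, one_mul, sq]
      _ = w k * (1 / β ^ 2) := by rw [← Finset.sum_mul, hv1, one_mul]
      _ ≤ _ := by
          gcongr
          rw [le_div_iff₀ ha]; nlinarith
  refine (abs_sub _ _).trans ?_
  rw [abs_mul, abs_of_nonneg (hv k)]
  have h3 : v k * |⟪φ (z k), Rh φ w β z (φ (z k))⟫ - 1 / β| ≤ w k / a * (1 / β ^ 2) := by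
    gcongr
    exact hva k
  calc _ ≤ w k / a * (1 / β ^ 2) + w k / a * (1 / β ^ 2) := add_le_add h3 h2
    _ = _ := by ring

/-- deviation from a variance bound -/
lemma six_aux {v : ι → ℝ} {F b σ : ℝ} (hσ : 0 ≤ σ)
    (hb : |∫ z, Fh φ w v β z ∂(Measure.pi P) - F| ≤ b) (C : ℝ)
    (hvar : ∑ k, ∫ z, (Fh φ w v β z - Fk φ w v β C k z) ^ 2 ∂(Measure.pi P) ≤ σ ^ 2) :
    ∫ z, |Fh φ w v β z - F| ∂(Measure.pi P) ≤ b + σ := by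
  have bF := S.bmF v
  have h := (efron_stein P (Fh φ w v β) (Fk φ w v β C) bF (S.bmFk v C)
    (fun k z t => S.Fk_indep v C k z t)).trans hvar
  set m := ∫ z, Fh φ w v β z ∂(Measure.pi P) with hm
  have h1 := (bF.sub (BM.const m)).integral_abs_le (Measure.pi P) h hσ
  have h2 : ∫ z, |Fh φ w v β z - F| ∂(Measure.pi P)
      ≤ ∫ z, (b + |Fh φ w v β z - m|) ∂(Measure.pi P) := by
    refine integral_mono ((bF.sub (BM.const F)).abs.integrable _)
      (((BM.const b).add (bF.sub (BM.const m)).abs).integrable _) fun z => ?_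
    simp only
    calc _ = |(m - F) + (Fh φ w v β z - m)| := by congr 1; ring
      _ ≤ _ := (abs_add_le _ _).trans (add_le_add hb le_rfl)
  rw [integral_add ((BM.const b).integrable _) ((bF.sub (BM.const m)).abs.integrable _)] at h2
  simp only [integral_const, probReal_univ, one_smul] at h2
  linarith

lemma six {s η : ℝ} (hs0 : 0 < s) (hs : ∀ t, ⟪φ t, res B β (φ t)⟫ ≤ s) (hη0 : 0 ≤ η)
    (hη : ∀ i, w i ≤ η) (hw1 : ∑ i, w i ≤ 1) {v : ι → ℝ} (hv : ∀ i, 0 ≤ v i)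
    (hv1 : ∑ i, v i = 1) {a : ℝ} (ha : 0 < a) (ha1 : a ≤ 1) (hav : ∀ i, a * v i ≤ w i) :
    ∫ z, |Fh φ w v β z - ∑ i, v i * ∫ t, ⟪φ t, res B β (φ t)⟫ ∂(P i)| ∂(Measure.pi P)
      ≤ 195 * η * s ^ 2 + Real.sqrt η / a * min (9 * s) (2 / β ^ 2) := by
  have hβ := S.hβ
  have hb := S.bias hs0 hs hη0 hη hv hv1
  have hsum : ∑ k, w k ^ 2 ≤ η := by
    calc ∑ k, w k ^ 2 ≤ ∑ k, η * w k := Finset.sum_le_sum fun k _ => by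
          rw [sq]; exact mul_le_mul_of_nonneg_right (hη k) (S.hw k)
      _ = η * ∑ k, w k := by rw [Finset.mul_sum]
      _ ≤ η * 1 := by gcongr
      _ = η := mul_one _
  have h1 := S.six_aux (σ := Real.sqrt η / a * (9 * s)) (by positivity) hb 0 (by
    have : ∀ k, ∫ z, (Fh φ w v β z - Fk φ w v β 0 k z) ^ 2 ∂(Measure.pi P)
        ≤ w k ^ 2 * (81 * s ^ 2 / a ^ 2) := by
      intro k
      have : ∫ z, (Fh φ w v β z - Fk φ w v β 0 k z) ^ 2 ∂(Measure.pi P)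
          ≤ ∫ z, (w k / a) ^ 2 * ⟪φ (z k), Qh φ w β k z (φ (z k))⟫ ^ 2 ∂(Measure.pi P) := by
        refine integral_mono ((((S.bmF v).sub (S.bmFk v 0 k)).pow 2).integrable _)
          ((((S.bmx k k k).pow 2).const_mul _).integrable _) fun z => ?_
        simp only
        rw [← sq_abs, ← mul_pow]
        exact pow_le_pow_left₀ (abs_nonneg _) (S.loo1 hv ha hav k z) 2
      rw [integral_const_mul] at this
      have h2 := mul_le_mul_of_nonneg_left (S.xx hs k) (sq_nonneg (w k / a))
      calc _ ≤ (w k / a) ^ 2 * (73 * s ^ 2) := this.trans h2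
        _ ≤ (w k / a) ^ 2 * (81 * s ^ 2) := by gcongr; norm_num
        _ = _ := by rw [div_pow]; ring
    calc _ ≤ ∑ k, w k ^ 2 * (81 * s ^ 2 / a ^ 2) := Finset.sum_le_sum fun k _ => this k
      _ = (∑ k, w k ^ 2) * (81 * s ^ 2 / a ^ 2) := by rw [Finset.sum_mul]
      _ ≤ η * (81 * s ^ 2 / a ^ 2) := by gcongr
      _ = _ := by rw [mul_pow, div_pow, Real.sq_sqrt hη0]; ring)
  have h2 := S.six_aux (σ := Real.sqrt η / a * (2 / β ^ 2)) (by positivity) hb (1 / β) (by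
    have : ∀ k, ∫ z, (Fh φ w v β z - Fk φ w v β (1 / β) k z) ^ 2 ∂(Measure.pi P)
        ≤ w k ^ 2 * ((2 / β ^ 2) ^ 2 / a ^ 2) := by
      intro k
      have := integral_mono ((((S.bmF v).sub (S.bmFk v (1 / β) k)).pow 2).integrable (Measure.pi P))
          ((BM.const ((w k / a * (2 / β ^ 2)) ^ 2)).integrable (Measure.pi P)) (fun z => by
        simp only
        rw [← sq_abs]
        exact pow_le_pow_left₀ (abs_nonneg _) (S.loo2 hw1 hv hv1 ha ha1 hav k z) 2)
      simp only [integral_const, probReal_univ, one_smul] at this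
      refine this.trans (le_of_eq ?_)
      rw [mul_pow, div_pow]; ring
    calc _ ≤ ∑ k, w k ^ 2 * ((2 / β ^ 2) ^ 2 / a ^ 2) := Finset.sum_le_sum fun k _ => this k
      _ = (∑ k, w k ^ 2) * ((2 / β ^ 2) ^ 2 / a ^ 2) := by rw [Finset.sum_mul]
      _ ≤ η * ((2 / β ^ 2) ^ 2 / a ^ 2) := by gcongr
      _ = _ := by rw [mul_pow, div_pow (Real.sqrt η), Real.sq_sqrt hη0]; ring)
  rcases min_choice (9 * s) (2 / β ^ 2) with h | h <;> rw [h] <;> assumption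

end Setup
end setting4

section series

lemma hasSum_prod_nonneg {ι κ : Type*} {F : ι × κ → ℝ} (hF : ∀ x, 0 ≤ F x) {r : ι → ℝ} {R : ℝ}
    (h1 : ∀ i, HasSum (fun j => F (i, j)) (r i)) (h2 : HasSum r R) : HasSum F R := by
  have hs : Summable F := by
    rw [summable_prod_of_nonneg (fun x => hF x)]
    refine ⟨fun i => (h1 i).summable, ?_⟩
    simp_rw [fun i => (h1 i).tsum_eq]
    exact h2.summable
  have := hs.hasSum.prod_fiberwise h1
  rw [this.unique h2] at *
  exact (hs.hasSum.prod_fiberwise h1).unique h2 ▸ hs.hasSum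

lemma hasSum_prod_nonneg' {ι κ : Type*} {F : ι × κ → ℝ} (hF : ∀ x, 0 ≤ F x) {r : κ → ℝ} {R : ℝ}
    (h1 : ∀ j, HasSum (fun i => F (i, j)) (r j)) (h2 : HasSum r R) : HasSum F R := by
  have h := hasSum_prod_nonneg (F := fun x : κ × ι => F (x.2, x.1)) (fun x => hF _) h1 h2
  exact ((Equiv.prodComm ι κ).symm.hasSum_iff (f := F)).1 h

lemma integrable_hasSum_countable {Ω : Type*} [MeasurableSpace Ω] {ν : Measure Ω} {J : Type*} [Countable J]
    {F : J → Ω → ℝ} {G : Ω → ℝ} (hF : ∀ j, Integrable (F j) ν)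
    (hs : Summable fun j => ∫ ω, ‖F j ω‖ ∂ν) (hG : ∀ᵐ ω ∂ν, HasSum (fun j => F j ω) (G ω)) :
    Integrable G ν ∧ HasSum (fun j => ∫ ω, F j ω ∂ν) (∫ ω, G ω ∂ν) := by
  have h0 := hasSum_integral_of_summable_integral_norm hF hs
  have e : ∫ ω, ∑' j, F j ω ∂ν = ∫ ω, G ω ∂ν :=
    integral_congr_ae (hG.mono fun ω h => h.tsum_eq)
  rw [e] at h0
  refine ⟨⟨?_, ?_⟩, h0⟩
  · refine aestronglyMeasurable_of_tendsto_ae (Filter.atTop : Filter (Finset J))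
      (f := fun s ω => ∑ j ∈ s, F j ω) (fun s => ?_) hG
    have := Finset.aestronglyMeasurable_sum s (f := F) (μ := ν) (fun j _ => (hF j).1)
    refine this.congr (Filter.Eventually.of_forall fun ω => ?_)
    simp
  · have h1 : ∫⁻ ω, ‖G ω‖ₑ ∂ν ≤ ∫⁻ ω, ∑' j, ‖F j ω‖ₑ ∂ν := by
      refine lintegral_mono_ae (hG.mono fun ω h => ?_)
      rw [← h.tsum_eq]
      exact enorm_tsum_le_tsum_enorm
    refine h1.trans_lt ?_
    rw [lintegral_tsum fun j => (hF j).1.enorm]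
    have e2 : ∀ j, ∫⁻ ω, ‖F j ω‖ₑ ∂ν = ENNReal.ofReal (∫ ω, ‖F j ω‖ ∂ν) := fun j =>
      (ofReal_integral_norm_eq_lintegral_enorm (hF j)).symm
    simp_rw [e2]
    rw [← ENNReal.ofReal_tsum_of_nonneg (fun j => integral_nonneg fun _ => norm_nonneg _) hs]
    exact ENNReal.ofReal_lt_top

/-- the same with a possibly uncountable index set but countable support -/
lemma integrable_hasSum {Ω : Type*} [MeasurableSpace Ω] {ν : Measure Ω} {J : Type*}
    {F : J → Ω → ℝ} {G : Ω → ℝ} (hc : {j | ∃ ω, F j ω ≠ 0}.Countable)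
    (hF : ∀ j, Integrable (F j) ν)
    (hs : Summable fun j => ∫ ω, ‖F j ω‖ ∂ν) (hG : ∀ᵐ ω ∂ν, HasSum (fun j => F j ω) (G ω)) :
    Integrable G ν ∧ HasSum (fun j => ∫ ω, F j ω ∂ν) (∫ ω, G ω ∂ν) := by
  set S := {j | ∃ ω, F j ω ≠ 0} with hS
  have : Countable S := hc
  have hz : ∀ j, j ∉ S → ∀ ω, F j ω = 0 := fun j hj ω => by
    by_contra h; exact hj ⟨ω, h⟩
  obtain ⟨h1, h2⟩ := integrable_hasSum_countable (ν := ν) (J := S) (F := fun j => F j) (G := G)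
    (fun j => hF j) (hs.subtype S) (hG.mono fun ω h => by
      have := (hasSum_subtype_iff_of_support_subset (s := S) (f := fun j => F j ω) (a := G ω)
        (fun j hj => ⟨ω, hj⟩)).2 h
      exact this)
  refine ⟨h1, ?_⟩
  refine (hasSum_subtype_iff_of_support_subset (s := S) (f := fun j => ∫ ω, F j ω ∂ν) ?_).1 h2
  intro j hj
  by_contra h
  apply hj
  simp [hz j h]

/-- the scalar integral -/
lemma log_integral {a b : ℝ} (ha : 0 < a) (hb : 0 < b) :
    IntegrableOn (fun β => 1 / (b + β) - 1 / (a + β)) (Set.Ioi 0) ∧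
    ∫ β in Set.Ioi 0, (1 / (b + β) - 1 / (a + β)) = Real.log (a / b) ∧
    ∫ β in Set.Ioi 0, ‖1 / (b + β) - 1 / (a + β)‖ = |Real.log (a / b)| := by
  have main : ∀ {a b : ℝ}, 0 < a → 0 < b → b ≤ a →
    IntegrableOn (fun β => 1 / (b + β) - 1 / (a + β)) (Set.Ioi 0) ∧
    ∫ β in Set.Ioi 0, (1 / (b + β) - 1 / (a + β)) = Real.log (a / b) ∧
    ∫ β in Set.Ioi 0, ‖1 / (b + β) - 1 / (a + β)‖ = |Real.log (a / b)| := by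
    intro a b ha hb hab
    have hd : ∀ x ∈ Set.Ici (0:ℝ), HasDerivAt (fun β => Real.log (b + β) - Real.log (a + β))
        (1 / (b + x) - 1 / (a + x)) x := by
      intro x hx
      have hx : 0 ≤ x := hx
      have h1 := ((hasDerivAt_id x).const_add b).log (by simp; positivity)
      have h2 := ((hasDerivAt_id x).const_add a).log (by simp; positivity)
      exact h1.sub h2
    have hp : ∀ x ∈ Set.Ioi (0:ℝ), 0 ≤ 1 / (b + x) - 1 / (a + x) := by
      intro x hx
      have hx : 0 < x := hx
      have : 1 / (a + x) ≤ 1 / (b + x) := by gcongr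
      linarith
    have ht : Filter.Tendsto (fun β => Real.log (b + β) - Real.log (a + β)) Filter.atTop (nhds 0) := by
      have h1 : Filter.Tendsto (fun β : ℝ => (b + β) / (a + β)) Filter.atTop (nhds 1) := by
        have h2 : Filter.Tendsto (fun β : ℝ => 1 + (b - a) / (a + β)) Filter.atTop (nhds (1 + 0)) :=
          (tendsto_const_nhds).add ((tendsto_const_nhds).div_atTop
            (Filter.tendsto_atTop_add_const_left _ a Filter.tendsto_id))
        rw [add_zero] at h2
        refine h2.congr' ?_
        filter_upwards [Filter.eventually_gt_atTop 0] with β hβ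
        field_simp; ring
      have h3 := (Real.continuousAt_log one_ne_zero).tendsto.comp h1
      rw [Real.log_one] at h3
      refine h3.congr' ?_
      filter_upwards [Filter.eventually_gt_atTop 0] with β hβ
      simp only [Function.comp]
      rw [Real.log_div (by positivity) (by positivity)]
    have i1 := integrableOn_Ioi_deriv_of_nonneg' hd hp ht
    have i2 := integral_Ioi_of_hasDerivAt_of_nonneg' hd hp ht
    have i3 : ∫ β in Set.Ioi 0, (1 / (b + β) - 1 / (a + β)) = Real.log (a / b) := by
      rw [i2, Real.log_div ha.ne' hb.ne']; simp
    refine ⟨i1, i3, ?_⟩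
    rw [abs_of_nonneg (Real.log_nonneg ((one_le_div hb).2 hab)), ← i3]
    refine setIntegral_congr_fun measurableSet_Ioi fun x hx => ?_
    exact Real.norm_of_nonneg (hp x hx)
  rcases le_total b a with h | h
  · exact main ha hb h
  · obtain ⟨h1, h2, h3⟩ := main hb ha h
    have e : ∀ β, 1 / (b + β) - 1 / (a + β) = -(1 / (a + β) - 1 / (b + β)) := fun β => by ring
    have e2 : Real.log (a / b) = - Real.log (b / a) := by
      rw [← Real.log_inv, inv_div]
    refine ⟨?_, ?_, ?_⟩
    · simp_rw [e]; exact h1.neg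
    · simp_rw [e]; rw [integral_neg, h2, e2]
    · simp_rw [e, norm_neg]; rw [h3, e2, abs_neg]

end series

section cov
set_option linter.unusedSectionVars false
variable {d : ℕ} {H : Type u} [NormedAddCommGroup H] [InnerProductSpace ℝ H] [CompleteSpace H]
variable {φ : EuclideanSpace ℝ (Fin d) → H}

lemma bm_inner2 (hφ : Continuous φ) (hn : ∀ x, ‖φ x‖ = 1) (a b : H) :
    BM fun t => ⟪φ t, a⟫ * ⟪φ t, b⟫ := by
  refine BM.of_cont (by fun_prop) (‖a‖ * ‖b‖) fun t => ?_
  rw [abs_mul]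
  have h1 := abs_real_inner_le_norm (φ t) a
  have h2 := abs_real_inner_le_norm (φ t) b
  rw [hn, one_mul] at h1 h2
  gcongr

lemma bm_inner_sq (hφ : Continuous φ) (hn : ∀ x, ‖φ x‖ = 1) (a : H) :
    BM fun t => ⟪φ t, a⟫ ^ 2 := by
  simpa [sq] using bm_inner2 hφ hn a a

lemma covOp_inner (hφ : Continuous φ) (hn : ∀ x, ‖φ x‖ = 1)
    (p : Measure (EuclideanSpace ℝ (Fin d))) [IsProbabilityMeasure p] (a b : H) :
    ⟪a, covOp φ p b⟫ = ∫ t, ⟪φ t, a⟫ * ⟪φ t, b⟫ ∂p := by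
  have hi : Integrable (fun x => rankOne (φ x) (φ x)) p := by
    refine Integrable.of_bound ((continuous_rankOne.comp hφ).aestronglyMeasurable) 1
      (Filter.Eventually.of_forall fun x => ?_)
    refine ContinuousLinearMap.opNorm_le_bound _ zero_le_one fun y => ?_
    rw [rankOne_apply, norm_smul, hn, mul_one]
    have := norm_inner_le_norm (𝕜 := ℝ) (φ x) y
    rwa [hn] at this
  have h := ((innerSL ℝ a) ∘L (ContinuousLinearMap.apply ℝ H b)).integral_comp_comm hi
  simp only [ContinuousLinearMap.comp_apply, ContinuousLinearMap.apply_apply, innerSL_apply_apply]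
    at h
  unfold covOp
  rw [← h]
  refine integral_congr_ae (Filter.Eventually.of_forall fun x => ?_)
  simp only [rankOne_apply, inner_smul_right]
  rw [real_inner_comm a (φ x)]; ring

lemma covOp_pos (hφ : Continuous φ) (hn : ∀ x, ‖φ x‖ = 1)
    (p : Measure (EuclideanSpace ℝ (Fin d))) [IsProbabilityMeasure p] : PosOp (covOp φ p) := by
  refine ⟨fun a b => ?_, fun a => ?_⟩
  · rw [real_inner_comm, covOp_inner hφ hn, covOp_inner hφ hn]
    simp_rw [mul_comm]
  · rw [covOp_inner hφ hn]
    exact integral_nonneg fun t => mul_self_nonneg _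

lemma covOp_quad (hφ : Continuous φ) (hn : ∀ x, ‖φ x‖ = 1)
    (p : Measure (EuclideanSpace ℝ (Fin d))) [IsProbabilityMeasure p] (a : H) :
    ⟪a, covOp φ p a⟫ = ∫ t, ⟪φ t, a⟫ ^ 2 ∂p := by
  rw [covOp_inner hφ hn]; simp_rw [sq]

lemma countable_basis (hφ : Continuous φ) {ι : Type*} (g : HilbertBasis ι ℝ H) :
    {j | ∃ x, ⟪φ x, g j⟫ ≠ 0}.Countable := by
  have : {j | ∃ x, ⟪φ x, g j⟫ ≠ 0} ⊆
      ⋃ k : ℕ, {j | ⟪φ (TopologicalSpace.denseSeq (EuclideanSpace ℝ (Fin d)) k), g j⟫ ≠ 0} := by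
    rintro j ⟨x, hx⟩
    have ho : IsOpen {x | ⟪φ x, g j⟫ ≠ 0} := by
      refine isOpen_ne_fun (by fun_prop) continuous_const
    obtain ⟨y, hy, k, rfl⟩ :=
      (TopologicalSpace.denseRange_denseSeq (EuclideanSpace ℝ (Fin d))).inter_open_nonempty _ ho ⟨x, hx⟩
    exact Set.mem_iUnion.2 ⟨k, hy⟩
  refine Set.Countable.mono this (Set.countable_iUnion fun k => ?_)
  set x := φ (TopologicalSpace.denseSeq (EuclideanSpace ℝ (Fin d)) k)
  have h := (g.summable_inner_mul_inner x x).countable_support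
  refine h.mono fun j hj => ?_
  have hj : ⟪x, g j⟫ ≠ 0 := hj
  simp only [Function.mem_support]
  rw [real_inner_comm x (g j)]
  exact mul_ne_zero hj hj

lemma hasSum_sq {ι : Type*} (g : HilbertBasis ι ℝ H) (x : H) :
    HasSum (fun j => ⟪x, g j⟫ ^ 2) (‖x‖ ^ 2) := by
  have := g.hasSum_inner_mul_inner x x
  rw [real_inner_self_eq_norm_sq] at this
  refine this.congr_fun fun j => ?_
  rw [real_inner_comm x (g j)]; ring

/-- trace identity with bounded weights -/
lemma trace_hasSum (hφ : Continuous φ) (hn : ∀ x, ‖φ x‖ = 1)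
    (p : Measure (EuclideanSpace ℝ (Fin d))) [IsProbabilityMeasure p]
    {ι : Type*} (g : HilbertBasis ι ℝ H) (t : ι → ℝ) (M : ℝ) (ht : ∀ j, 0 ≤ t j)
    (htM : ∀ j, t j ≤ M) {F : EuclideanSpace ℝ (Fin d) → ℝ}
    (hF : ∀ x, HasSum (fun j => t j * ⟪φ x, g j⟫ ^ 2) (F x)) :
    HasSum (fun j => t j * ⟪g j, covOp φ p (g j)⟫) (∫ x, F x ∂p) := by
  have hb : ∀ j, BM fun x => t j * ⟪φ x, g j⟫ ^ 2 := fun j => (bm_inner_sq hφ hn _).const_mul _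
  have hnn : ∀ j x, 0 ≤ t j * ⟪φ x, g j⟫ ^ 2 := fun j x => mul_nonneg (ht j) (sq_nonneg _)
  have h := integrable_hasSum (ν := p) (F := fun j x => t j * ⟪φ x, g j⟫ ^ 2) (G := F)
    ((countable_basis hφ g).mono (by
      rintro j ⟨x, hx⟩
      exact ⟨x, fun h0 => hx (by simp [h0])⟩))
    (fun j => (hb j).integrable p) (by
      refine summable_of_sum_le (c := M) (fun j => integral_nonneg fun x => norm_nonneg _) fun s => ?_
      rw [← integral_finsetSum _ (fun j _ => ((hb j).integrable p).norm)]
      have : ∫ x, ∑ j ∈ s, ‖t j * ⟪φ x, g j⟫ ^ 2‖ ∂p ≤ ∫ x, M ∂p := by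
        refine integral_mono (integrable_finsetSum _ fun j _ => ((hb j).integrable p).norm)
          (integrable_const _) fun x => ?_
        calc _ = ∑ j ∈ s, t j * ⟪φ x, g j⟫ ^ 2 :=
              Finset.sum_congr rfl fun j _ => Real.norm_of_nonneg (hnn j x)
          _ ≤ ∑ j ∈ s, M * ⟪φ x, g j⟫ ^ 2 := by
              refine Finset.sum_le_sum fun j _ => ?_
              exact mul_le_mul_of_nonneg_right (htM j) (sq_nonneg _)
          _ = M * ∑ j ∈ s, ⟪φ x, g j⟫ ^ 2 := by rw [Finset.mul_sum]
          _ ≤ M * 1 := by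
              by_cases hs : s.Nonempty
              · obtain ⟨j, _⟩ := hs
                have hM : 0 ≤ M := (ht j).trans (htM j)
                refine mul_le_mul_of_nonneg_left ?_ hM
                have := sum_le_hasSum s (fun j _ => sq_nonneg _) (hasSum_sq g (φ x))
                simpa [hn] using this
              · rw [Finset.not_nonempty_iff_eq_empty] at hs
                have h0 : F x = 0 ∨ True := Or.inr trivial
                have hM : 0 ≤ M := by
                  by_cases hι : Nonempty ι
                  · obtain ⟨j⟩ := hι; exact (ht j).trans (htM j)
                  · exfalso
                    rw [not_nonempty_iff] at hι
                    have := hasSum_sq g (φ x)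
                    rw [hn] at this
                    have h1 := this.unique (hasSum_empty)
                    norm_num at h1
                simp [hs, hM]
          _ = M := mul_one M
      simpa using this)
    (Filter.Eventually.of_forall hF)
  convert h.2 using 2 with j
  rw [integral_const_mul, covOp_quad hφ hn]

lemma res_eig {T : H →L[ℝ] H} (hT : PosOp T) {β : ℝ} (hβ : 0 < β) {g : H} {c : ℝ} (hc : 0 ≤ c)
    (h : T g = c • g) : res T β g = (1 / (c + β)) • g := by
  have h1 := res_mul_apply hT hβ g
  rw [h, map_smul, ← add_smul] at h1
  have h2 : c + β ≠ 0 := by positivity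
  calc res T β g = (1 / (c + β)) • ((c + β) • res T β g) := by
        rw [smul_smul, one_div, inv_mul_cancel₀ h2, one_smul]
    _ = _ := by rw [h1]

lemma res_hasSum {T : H →L[ℝ] H} (hT : PosOp T) {β : ℝ} (hβ : 0 < β) {ι : Type*}
    (g : HilbertBasis ι ℝ H) {gam : ι → ℝ} (hg : ∀ j, T (g j) = gam j • g j) (h0 : ∀ j, 0 ≤ gam j)
    (x : H) : HasSum (fun j => (1 / (gam j + β)) * ⟪x, g j⟫ ^ 2) ⟪x, res T β x⟫ := by
  have := g.hasSum_inner_mul_inner x (res T β x)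
  refine this.congr_fun fun j => ?_
  rw [← res_symm hT hβ, res_eig hT hβ (h0 j) (hg j), inner_smul_left, real_inner_comm x (g j)]
  simp only [conj_trivial]
  ring

end cov

section link
set_option linter.unusedSectionVars false
variable {d : ℕ} {H : Type u} [NormedAddCommGroup H] [InnerProductSpace ℝ H] [CompleteSpace H]
variable {φ : EuclideanSpace ℝ (Fin d) → H}

/-- the mixture covariance operator -/
def mix (φ : EuclideanSpace ℝ (Fin d) → H) (α : ℝ) (p q : Measure (EuclideanSpace ℝ (Fin d))) :
    H →L[ℝ] H := α • covOp φ p + (1 - α) • covOp φ q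

lemma mix_pos (hφ : Continuous φ) (hn : ∀ x, ‖φ x‖ = 1) {α : ℝ} (hα : 0 < α) (hα1 : α ≤ 1)
    (p q : Measure (EuclideanSpace ℝ (Fin d))) [IsProbabilityMeasure p] [IsProbabilityMeasure q] :
    PosOp (mix φ α p q) :=
  ((covOp_pos hφ hn p).smul hα.le).add ((covOp_pos hφ hn q).smul (by linarith))

lemma mix_inner (α : ℝ) (p q : Measure (EuclideanSpace ℝ (Fin d))) (a b : H) :
    ⟪a, mix φ α p q b⟫ = α * ⟪a, covOp φ p b⟫ + (1 - α) * ⟪a, covOp φ q b⟫ := by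
  simp [mix, inner_add_right, inner_smul_right]

lemma mix_ge (hφ : Continuous φ) (hn : ∀ x, ‖φ x‖ = 1) {α : ℝ} (hα1 : α ≤ 1)
    (p q : Measure (EuclideanSpace ℝ (Fin d))) [IsProbabilityMeasure p] [IsProbabilityMeasure q]
    (a : H) : α * ⟪a, covOp φ p a⟫ ≤ ⟪a, mix φ α p q a⟫ := by
  rw [mix_inner]
  have := mul_nonneg (by linarith : 0 ≤ 1 - α) ((covOp_pos hφ hn q).2 a)
  linarith

/-- the integrand -/
def Gf (φ : EuclideanSpace ℝ (Fin d) → H) (α : ℝ) (p q : Measure (EuclideanSpace ℝ (Fin d)))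
    (β : ℝ) : ℝ :=
  ∫ x, ⟪φ x, res (mix φ α p q) β (φ x)⟫ ∂p - ∫ x, ⟪φ x, res (covOp φ p) β (φ x)⟫ ∂p

lemma trace_one (hφ : Continuous φ) (hn : ∀ x, ‖φ x‖ = 1)
    (p : Measure (EuclideanSpace ℝ (Fin d))) [IsProbabilityMeasure p]
    {ι : Type*} (g : HilbertBasis ι ℝ H) : HasSum (fun j => ⟪g j, covOp φ p (g j)⟫) 1 := by
  have := trace_hasSum hφ hn p g (fun _ => 1) 1 (fun _ => zero_le_one) (fun _ => le_rfl)
    (F := fun _ => 1) (fun x => by simpa [hn] using hasSum_sq g (φ x))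
  simpa using this

lemma basis_norm {ι : Type*} (g : HilbertBasis ι ℝ H) (j : ι) : ⟪g j, g j⟫ = 1 := by
  rw [real_inner_self_eq_norm_sq, g.orthonormal.1 j]; norm_num

theorem kkl_link (hφ : Continuous φ) (hn : ∀ x, ‖φ x‖ = 1) {α : ℝ} (hα : 0 < α) (hα1 : α ≤ 1)
    (p q : Measure (EuclideanSpace ℝ (Fin d))) [IsProbabilityMeasure p] [IsProbabilityMeasure q]
    {v : ℝ} (hv : IsKKLa φ α p q v) :
    IntegrableOn (Gf φ α p q) (Set.Ioi 0) ∧ v = ∫ β in Set.Ioi 0, Gf φ α p q β ∧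
      0 ≤ v ∧ v ≤ 1 / α := by
  obtain ⟨ι, f, lam, g, gam, hf, hl, hg, hgm, hsum, hv⟩ := hv
  have hA := covOp_pos hφ hn p
  have hB := mix_pos hφ hn hα hα1 p q
  have hBA := mix_ge hφ hn hα1 p q
  set A := covOp φ p with hAdef
  have hg : ∀ j, mix φ α p q (g j) = gam j • g j := hg
  have trB : HasSum (fun j => ⟪g j, mix φ α p q (g j)⟫) 1 := by
    have := ((trace_one hφ hn p g).mul_left α).add ((trace_one hφ hn q g).mul_left (1 - α))
    simp only [mix_inner]
    have e : α * 1 + (1 - α) * 1 = 1 := by ring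
    rwa [e] at this
  set B := mix φ α p q with hBdef
  set c : ι × ι → ℝ := fun ij => ⟪(f ij.1 : H), (g ij.2 : H)⟫ ^ 2 with hcdef
  have hc0 : ∀ ij, 0 ≤ c ij := fun ij => sq_nonneg _
  have hfn : ∀ i, ⟪f i, A (f i)⟫ = lam i := fun i => by
    rw [hf, inner_smul_right, basis_norm, mul_one]
  have hgn : ∀ j, ⟪g j, B (g j)⟫ = gam j := fun j => by
    rw [hg, inner_smul_right, basis_norm, mul_one]
  have hc1 : ∀ i, HasSum (fun j => c (i, j)) 1 := fun i => by
    have := hasSum_sq g (f i)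
    rwa [f.orthonormal.1 i, one_pow] at this
  have hc2 : ∀ j, HasSum (fun i => c (i, j)) 1 := fun j => by
    have := hasSum_sq f (g j)
    rw [g.orthonormal.1 j, one_pow] at this
    refine this.congr_fun fun i => ?_
    rw [hcdef]; simp only; rw [real_inner_comm]
  have quad : ∀ x, HasSum (fun i => lam i * ⟪f i, x⟫ ^ 2) ⟪x, A x⟫ := fun x => by
    refine (f.hasSum_inner_mul_inner x (A x)).congr_fun fun i => ?_
    rw [← hA.1, hf, inner_smul_left, real_inner_comm x (f i)]
    simp only [conj_trivial]; ring
  have lsum : HasSum lam 1 := by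
    have := trace_one hφ hn p f
    rw [← hAdef] at this
    simpa only [hfn] using this
  have gsum : HasSum gam 1 := by simpa only [hgn] using trB
  have lc0 : ∀ ij : ι × ι, 0 ≤ lam ij.1 * c ij := fun ij => mul_nonneg (hl _) (hc0 _)
  have lcsum : HasSum (fun ij : ι × ι => lam ij.1 * c ij) 1 :=
    hasSum_prod_nonneg lc0 (fun i => by simpa using (hc1 i).mul_left (lam i)) lsum
  have gcsum : HasSum (fun ij : ι × ι => gam ij.2 * c ij) 1 :=
    hasSum_prod_nonneg' (fun ij => mul_nonneg (hgm _) (hc0 _))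
      (fun j => by simpa using (hc2 j).mul_left (gam j)) gsum
  have hz : ∀ i j, gam j = 0 → lam i * c (i, j) = 0 := fun i j h0 => by
    have h1 := hBA (g j)
    rw [hgn, h0] at h1
    have h2 : ⟪g j, A (g j)⟫ ≤ 0 := by
      by_contra h; push Not at h
      have := mul_pos hα h
      linarith
    have h3 := le_hasSum (quad (g j)) i (fun i' _ => mul_nonneg (hl _) (sq_nonneg _))
    exact le_antisymm (h3.trans h2) (lc0 (i, j))
  have hpos : ∀ i j, lam i * c (i, j) ≠ 0 → 0 < lam i ∧ 0 < gam j := fun i j h =>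
    ⟨lt_of_le_of_ne (hl i) (fun h0 => h (by rw [← h0, zero_mul])),
      lt_of_le_of_ne (hgm j) (fun h0 => h (hz i j h0.symm))⟩
  set F : ι × ι → ℝ → ℝ := fun ij β =>
    lam ij.1 * c ij * (1 / (gam ij.2 + β) - 1 / (lam ij.1 + β)) with hF
  set t : ι × ι → ℝ := fun ij => lam ij.1 * Real.log (lam ij.1 / gam ij.2) * c ij with ht
  have hFi : ∀ ij, Integrable (F ij) (volume.restrict (Set.Ioi 0)) ∧
      ∫ β in Set.Ioi 0, F ij β = t ij ∧ ∫ β in Set.Ioi 0, ‖F ij β‖ = |t ij| := by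
    rintro ⟨i, j⟩
    by_cases h : lam i * c (i, j) = 0
    · have h1 : F (i, j) = fun _ => 0 := by funext β; simp [hF, h]
      have h2 : t (i, j) = 0 := by
        simp only [ht]
        calc _ = Real.log (lam i / gam j) * (lam i * c (i, j)) := by ring
          _ = 0 := by rw [h, mul_zero]
      rw [h1, h2]; simp
    · obtain ⟨h1, h2⟩ := hpos i j h
      obtain ⟨i1, i2, i3⟩ := log_integral h1 h2
      refine ⟨i1.const_mul _, ?_, ?_⟩
      · simp only [hF, ht]
        rw [integral_const_mul, i2]; ring
      · simp only [hF, ht, norm_mul _ (_ - _)]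
        rw [integral_const_mul, i3, Real.norm_of_nonneg (lc0 (i, j)),
          ← abs_of_nonneg (lc0 (i, j)), ← abs_mul]
        congr 1
        simp only; ring
  have hsumF : ∀ β ∈ Set.Ioi (0:ℝ), HasSum (fun ij => F ij β) (Gf φ α p q β) := by
    intro β hβ
    have hβ : 0 < β := hβ
    have h1 : HasSum (fun ij : ι × ι => 1 / (gam ij.2 + β) * (lam ij.1 * c ij))
        (∫ x, ⟪φ x, res B β (φ x)⟫ ∂p) := by
      refine hasSum_prod_nonneg' (r := fun j => 1 / (gam j + β) * ⟪g j, A (g j)⟫) (fun ij => ?_)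
        (fun j => (quad (g j)).mul_left _) ?_
      · have := hgm ij.2
        exact mul_nonneg (by positivity) (lc0 ij)
      · refine trace_hasSum hφ hn p g _ (1 / β) (fun j => ?_) (fun j => ?_)
          (fun x => res_hasSum hB hβ g hg hgm (φ x))
        · have := hgm j; positivity
        · have := hgm j; gcongr; linarith
    have h2 : HasSum (fun ij : ι × ι => 1 / (lam ij.1 + β) * (lam ij.1 * c ij))
        (∫ x, ⟪φ x, res A β (φ x)⟫ ∂p) := by
      refine hasSum_prod_nonneg (r := fun i => 1 / (lam i + β) * ⟪f i, A (f i)⟫) (fun ij => ?_)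
        (fun i => ?_) ?_
      · have := hl ij.1
        exact mul_nonneg (by positivity) (lc0 ij)
      · rw [hfn]
        simpa using ((hc1 i).mul_left (lam i)).mul_left (1 / (lam i + β))
      · refine trace_hasSum hφ hn p f _ (1 / β) (fun j => ?_) (fun j => ?_)
          (fun x => res_hasSum hA hβ f hf hl (φ x))
        · have := hl j; positivity
        · have := hl j; gcongr; linarith
    refine (h1.sub h2).congr_fun fun ij => ?_
    simp only [hF]; ring
  have key := integrable_hasSum (ν := volume.restrict (Set.Ioi 0)) (F := F) (G := Gf φ α p q)
    (lcsum.summable.countable_support.mono (by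
      rintro ij ⟨β, hβ⟩ h0
      have h1 : lam ij.1 * c ij = 0 := h0
      exact hβ (by simp only [hF]; rw [h1, zero_mul])))
    (fun ij => (hFi ij).1) (by
      simp_rw [fun ij => (hFi ij).2.2]
      exact hsum.abs)
    ((ae_restrict_iff' measurableSet_Ioi).2 (Filter.Eventually.of_forall hsumF))
  have hts : HasSum t v := by rw [hv]; exact hsum.hasSum
  have hk2 := key.2
  simp_rw [fun ij => (hFi ij).2.1] at hk2
  refine ⟨key.1, hts.unique hk2, ?_, ?_⟩
  · have h0 := lcsum.sub gcsum
    rw [sub_self] at h0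
    refine hasSum_le ?_ h0 hts
    rintro ⟨i, j⟩
    simp only [ht]
    by_cases h : lam i * c (i, j) = 0
    · have : lam i * Real.log (lam i / gam j) * c (i, j) = 0 := by
        calc _ = Real.log (lam i / gam j) * (lam i * c (i, j)) := by ring
          _ = 0 := by rw [h, mul_zero]
      rw [this, h]
      have := mul_nonneg (hgm j) (hc0 (i, j))
      linarith
    · obtain ⟨h1, h2⟩ := hpos i j h
      have h3 := Real.one_sub_inv_le_log_of_pos (div_pos h1 h2)
      rw [inv_div] at h3
      have h4 := mul_le_mul_of_nonneg_left h3 h1.le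
      have h5 : lam i * (1 - gam j / lam i) = lam i - gam j := by field_simp
      rw [h5] at h4
      have := mul_le_mul_of_nonneg_right h4 (hc0 (i, j))
      linarith
  · have hT : ∀ i (s : Finset ι), ∑ j ∈ s, lam i * ((gam j)⁻¹ * c (i, j)) ≤ 1 / α := by
      intro i s
      set u : H := ∑ j ∈ s, ((gam j)⁻¹ * ⟪f i, g j⟫) • g j with hu
      set S := ∑ j ∈ s, (gam j)⁻¹ * c (i, j) with hS
      have hS0 : 0 ≤ S := Finset.sum_nonneg fun j _ => mul_nonneg (inv_nonneg.2 (hgm j)) (hc0 _)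
      have e1 : ⟪f i, u⟫ = S := by
        rw [hu, inner_sum]
        refine Finset.sum_congr rfl fun j _ => ?_
        rw [inner_smul_right]; simp only [hcdef]; ring
      have eg : ∀ j ∈ s, ⟪g j, u⟫ = (gam j)⁻¹ * ⟪f i, g j⟫ := fun j hj => by
        rw [hu]
        have := g.orthonormal.inner_right_sum (fun j => (gam j)⁻¹ * ⟪f i, g j⟫) hj
        exact this
      have e2 : ⟪u, B u⟫ = S := by
        rw [← hB.1]
        conv_lhs => rw [hu]
        rw [map_sum, sum_inner]
        refine Finset.sum_congr rfl fun j hj => ?_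
        rw [map_smul, hg, inner_smul_left, inner_smul_left, ← hu, eg j hj]
        simp only [conj_trivial, hcdef]
        by_cases h : gam j = 0
        · simp [h]
        · field_simp
      have e3 : lam i * S ^ 2 ≤ ⟪u, A u⟫ := by
        have := le_hasSum (quad u) i (fun i' _ => mul_nonneg (hl _) (sq_nonneg _))
        rwa [e1] at this
      have e4 := hBA u
      rw [e2] at e4
      rw [← Finset.mul_sum, ← hS, le_div_iff₀ hα]
      by_contra h; push Not at h
      have hSpos : 0 < S := lt_of_le_of_ne hS0 (fun h0 => by rw [← h0] at h; norm_num at h)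
      have := mul_lt_mul_of_pos_right h hSpos
      have := mul_le_mul_of_nonneg_left e3 hα.le
      nlinarith
    have hTs : ∀ i, Summable fun j => lam i * ((gam j)⁻¹ * c (i, j)) := fun i =>
      summable_of_sum_le (fun j => mul_nonneg (hl i) (mul_nonneg (inv_nonneg.2 (hgm j)) (hc0 _)))
        (hT i)
    have hTle : ∀ i, ∑' j, lam i * ((gam j)⁻¹ * c (i, j)) ≤ 1 / α := fun i =>
      (hTs i).tsum_le_of_sum_le (hT i)
    set r : ι → ℝ := fun i => lam i * ∑' j, lam i * ((gam j)⁻¹ * c (i, j)) with hr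
    have hr0 : ∀ i, 0 ≤ r i := fun i => mul_nonneg (hl i) (tsum_nonneg fun j =>
      mul_nonneg (hl i) (mul_nonneg (inv_nonneg.2 (hgm j)) (hc0 _)))
    have hrle : ∀ i, r i ≤ lam i * (1 / α) := fun i => mul_le_mul_of_nonneg_left (hTle i) (hl i)
    have hrs : Summable r := Summable.of_nonneg_of_le hr0 hrle (lsum.summable.mul_right _)
    have hU := hasSum_prod_nonneg (F := fun ij : ι × ι =>
        lam ij.1 * (lam ij.1 * ((gam ij.2)⁻¹ * c ij))) (r := r) (R := ∑' i, r i)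
      (fun ij => mul_nonneg (hl _) (mul_nonneg (hl _) (mul_nonneg (inv_nonneg.2 (hgm _)) (hc0 _))))
      (fun i => (hTs i).hasSum.mul_left _) hrs.hasSum
    have hR : ∑' i, r i ≤ 1 * (1 / α) := hasSum_le hrle hrs.hasSum (lsum.mul_right _)
    rw [one_mul] at hR
    refine le_trans (hasSum_le ?_ hts hU) hR
    rintro ⟨i, j⟩
    simp only [ht]
    have h3 := Real.log_le_self (div_nonneg (hl i) (hgm j))
    have h4 := mul_le_mul_of_nonneg_right (mul_le_mul_of_nonneg_left h3 (hl i)) (hc0 (i, j))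
    refine h4.trans (le_of_eq ?_)
    rw [div_eq_mul_inv]; ring

end link

section emp
set_option linter.unusedSectionVars false
variable {d n m : ℕ} {H : Type u} [NormedAddCommGroup H] [InnerProductSpace ℝ H] [CompleteSpace H]
variable {φ : EuclideanSpace ℝ (Fin d) → H}

lemma emp_prob (hn : 0 < n) (xs : Fin n → EuclideanSpace ℝ (Fin d)) :
    IsProbabilityMeasure (empMeas xs) := by
  constructor
  simp only [empMeas, Measure.smul_apply, Measure.finsetSum_apply, measure_univ]
  simp only [Finset.sum_const, Finset.card_univ, Fintype.card_fin, nsmul_eq_mul, mul_one, smul_eq_mul]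
  exact ENNReal.inv_mul_cancel (by exact_mod_cast hn.ne') (ENNReal.natCast_ne_top n)

lemma emp_integral {G : Type*} [NormedAddCommGroup G] [NormedSpace ℝ G] [CompleteSpace G]
    (xs : Fin n → EuclideanSpace ℝ (Fin d)) (F : EuclideanSpace ℝ (Fin d) → G) :
    ∫ x, F x ∂(empMeas xs) = ∑ i, (1 / (n : ℝ)) • F (xs i) := by
  unfold empMeas
  rw [integral_smul_measure, integral_finsetSum_measure (fun i _ => integrable_dirac enorm_lt_top),
    ← Finset.smul_sum]
  simp

/-- weights -/
def wt (n m : ℕ) (a : ℝ) : Fin n ⊕ Fin m → ℝ :=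
  Sum.elim (fun _ => a / n) (fun _ => (1 - a) / m)

/-- sampling measures -/
def PP (n m : ℕ) (p q : Measure (EuclideanSpace ℝ (Fin d))) :
    Fin n ⊕ Fin m → Measure (EuclideanSpace ℝ (Fin d)) := Sum.elim (fun _ => p) (fun _ => q)

instance (p q : Measure (EuclideanSpace ℝ (Fin d))) [IsProbabilityMeasure p]
    [IsProbabilityMeasure q] (i : Fin n ⊕ Fin m) : IsProbabilityMeasure (PP n m p q i) := by
  cases i <;> simp only [PP, Sum.elim_inl, Sum.elim_inr] <;> infer_instance

lemma wt_nonneg {a : ℝ} (ha : 0 ≤ a) (ha1 : a ≤ 1) (i : Fin n ⊕ Fin m) : 0 ≤ wt n m a i := by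
  have : 0 ≤ 1 - a := by linarith
  cases i <;> simp only [wt, Sum.elim_inl, Sum.elim_inr] <;> positivity

lemma wt_sum (hn : 0 < n) (hm : 0 < m) (a : ℝ) : ∑ i, wt n m a i = 1 := by
  rw [Fintype.sum_sum_type]
  simp only [wt, Sum.elim_inl, Sum.elim_inr, Finset.sum_const, Finset.card_univ, Fintype.card_fin,
    nsmul_eq_mul]
  have : (n : ℝ) ≠ 0 := by exact_mod_cast hn.ne'
  have : (m : ℝ) ≠ 0 := by exact_mod_cast hm.ne'
  field_simp; ring

lemma wt_le (hn : 0 < n) (hm : 0 < m) {a : ℝ} (ha : 0 ≤ a) (ha1 : a ≤ 1) (i : Fin n ⊕ Fin m) :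
    wt n m a i ≤ 1 / (min m n : ℕ) := by
  have h0 : (0:ℝ) < (min m n : ℕ) := by exact_mod_cast lt_min hm hn
  have h1 : ((min m n : ℕ) : ℝ) ≤ n := by exact_mod_cast min_le_right m n
  have h2 : ((min m n : ℕ) : ℝ) ≤ m := by exact_mod_cast min_le_left m n
  cases i <;> simp only [wt, Sum.elim_inl, Sum.elim_inr] <;> gcongr; linarith

lemma wt_av {a : ℝ} (ha1 : a ≤ 1) (i : Fin n ⊕ Fin m) :
    a * wt n m 1 i ≤ wt n m a i := by
  have : 0 ≤ 1 - a := by linarith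
  cases i <;> simp only [wt, Sum.elim_inl, Sum.elim_inr]
  · apply le_of_eq; ring
  · simp only [sub_self, zero_div, mul_zero]; positivity

lemma wt_wsum (hn : 0 < n) (hm : 0 < m) (p q : Measure (EuclideanSpace ℝ (Fin d))) (a : ℝ)
    (I : Measure (EuclideanSpace ℝ (Fin d)) → ℝ) :
    ∑ i, wt n m a i * I (PP n m p q i) = a * I p + (1 - a) * I q := by
  rw [Fintype.sum_sum_type]
  simp only [wt, PP, Sum.elim_inl, Sum.elim_inr, Finset.sum_const, Finset.card_univ,
    Fintype.card_fin, nsmul_eq_mul]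
  have : (n : ℝ) ≠ 0 := by exact_mod_cast hn.ne'
  have : (m : ℝ) ≠ 0 := by exact_mod_cast hm.ne'
  field_simp

lemma mix_one (p q : Measure (EuclideanSpace ℝ (Fin d))) : mix φ 1 p q = covOp φ p := by
  simp [mix]

lemma mix_emp (a : ℝ) (z : Fin n ⊕ Fin m → EuclideanSpace ℝ (Fin d)) :
    mix φ a (empMeas fun i => z (Sum.inl i)) (empMeas fun i => z (Sum.inr i))
      = Bh φ (wt n m a) z := by
  unfold mix covOp Bh
  rw [emp_integral, emp_integral, Fintype.sum_sum_type, Finset.smul_sum, Finset.smul_sum]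
  congr 1 <;> refine Finset.sum_congr rfl fun i _ => ?_ <;> rw [smul_smul] <;>
    simp only [wt, Sum.elim_inl, Sum.elim_inr] <;> congr 1 <;> ring

/-- empirical statistic -/
def Dh (φ : EuclideanSpace ℝ (Fin d) → H) (a β : ℝ)
    (z : Fin n ⊕ Fin m → EuclideanSpace ℝ (Fin d)) : ℝ := Fh φ (wt n m a) (wt n m 1) β z

/-- population statistic -/
def D0 (φ : EuclideanSpace ℝ (Fin d) → H) (p q : Measure (EuclideanSpace ℝ (Fin d))) (a β : ℝ) : ℝ :=
  ∫ x, ⟪φ x, res (mix φ a p q) β (φ x)⟫ ∂p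

lemma Gf_pop (α : ℝ) (p q : Measure (EuclideanSpace ℝ (Fin d))) (β : ℝ) :
    Gf φ α p q β = D0 φ p q α β - D0 φ p q 1 β := by
  unfold Gf D0; rw [mix_one]

lemma D0_emp (a β : ℝ) (z : Fin n ⊕ Fin m → EuclideanSpace ℝ (Fin d)) :
    D0 φ (empMeas fun i => z (Sum.inl i)) (empMeas fun i => z (Sum.inr i)) a β = Dh φ a β z := by
  unfold D0 Dh Fh Rh
  rw [mix_emp, emp_integral, Fintype.sum_sum_type]
  simp [wt]

lemma setup (hφ : Continuous φ) (hφn : ∀ x, ‖φ x‖ = 1) (hn : 0 < n) (hm : 0 < m)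
    (p q : Measure (EuclideanSpace ℝ (Fin d))) [IsProbabilityMeasure p] [IsProbabilityMeasure q]
    {a : ℝ} (ha : 0 < a) (ha1 : a ≤ 1) {β : ℝ} (hβ : 16 / (min m n : ℕ) ≤ β) :
    Setup φ (PP n m p q) (wt n m a) β (mix φ a p q) where
  hφ := hφ
  hn := hφn
  hβ := lt_of_lt_of_le (by have : 0 < min m n := lt_min hm hn; positivity) hβ
  hw := wt_nonneg ha.le ha1
  hwβ i := (wt_le hn hm ha.le ha1 i).trans (by
    have e : (16:ℝ) / (min m n : ℕ) = 16 * (1 / (min m n : ℕ)) := by ring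
    rw [e] at hβ; linarith)
  hB := mix_pos hφ hφn ha ha1 p q
  hBf u v := by
    rw [wt_wsum hn hm p q a (fun P => ∫ t, ⟪φ t, u⟫ * ⟪φ t, v⟫ ∂P), mix_inner, covOp_inner hφ hφn,
      covOp_inner hφ hφn]

lemma high (hφ : Continuous φ) (hφn : ∀ x, ‖φ x‖ = 1) (hn : 0 < n) (hm : 0 < m)
    (p q : Measure (EuclideanSpace ℝ (Fin d))) [IsProbabilityMeasure p] [IsProbabilityMeasure q]
    {a : ℝ} (ha : 0 < a) (ha1 : a ≤ 1) {β : ℝ} (hβ : 16 / (min m n : ℕ) ≤ β) {s : ℝ} (hs0 : 0 < s)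
    (hs : ∀ t, ⟪φ t, res (mix φ a p q) β (φ t)⟫ ≤ s) :
    ∫ z, |Dh φ a β z - D0 φ p q a β| ∂(Measure.pi (PP n m p q))
      ≤ 195 * (1 / (min m n : ℕ)) * s ^ 2
        + Real.sqrt (1 / (min m n : ℕ)) / a * min (9 * s) (2 / β ^ 2) := by
  have S := setup hφ hφn hn hm p q ha ha1 hβ
  have h := S.six hs0 hs (by positivity) (wt_le hn hm ha.le ha1) (wt_sum hn hm a).le
    (wt_nonneg zero_le_one le_rfl) (wt_sum hn hm 1) ha ha1 (wt_av ha1)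
  rw [wt_wsum hn hm p q 1 (fun P => ∫ t, ⟪φ t, res (mix φ a p q) β (φ t)⟫ ∂P)] at h
  simpa [Dh, D0] using h

lemma Dh_nonneg {a : ℝ} (ha : 0 ≤ a) (ha1 : a ≤ 1) {β : ℝ} (hβ : 0 < β)
    (z : Fin n ⊕ Fin m → EuclideanSpace ℝ (Fin d)) : 0 ≤ Dh φ a β z := by
  unfold Dh Fh Rh
  exact Finset.sum_nonneg fun i _ => mul_nonneg (wt_nonneg zero_le_one le_rfl i)
    (res_nonneg (Bh_pos φ (wt_nonneg ha ha1) z) hβ _)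

lemma bm_Dh (hφ : Continuous φ) (hφn : ∀ x, ‖φ x‖ = 1) {a : ℝ} (ha : 0 ≤ a) (ha1 : a ≤ 1)
    {β : ℝ} (hβ : 0 < β) : BM (Dh φ a β : (Fin n ⊕ Fin m → EuclideanSpace ℝ (Fin d)) → ℝ) := by
  unfold Dh Fh Rh
  refine BM.sum _ fun i _ => BM.const_mul _ ?_
  exact bm_res (T := Bh φ (wt n m a)) (continuous_Bh hφ _) (fun z => Bh_pos φ (wt_nonneg ha ha1) z) hβ
    (hφ.comp (continuous_apply i)) (hφ.comp (continuous_apply i)) (fun z => (hφn _).le)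
    (fun z => (hφn _).le)

/-- reduction to `a = 1` -/
lemma Dh_le {a : ℝ} (ha : 0 < a) (ha1 : a ≤ 1) {β : ℝ} (hβ : 0 < β)
    (z : Fin n ⊕ Fin m → EuclideanSpace ℝ (Fin d)) :
    Dh φ a β z ≤ (1 / a) * Dh φ 1 (β / a) z := by
  unfold Dh Fh
  rw [Finset.mul_sum]
  refine Finset.sum_le_sum fun i _ => ?_
  have := res_anti (Bh_pos φ (wt_nonneg ha.le ha1) z) (Bh_pos φ (wt_nonneg zero_le_one le_rfl) z)
    hβ ha (fun u => by
      rw [Bh_inner, Bh_inner, Finset.mul_sum]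
      refine Finset.sum_le_sum fun k _ => ?_
      rw [← mul_assoc]
      exact mul_le_mul_of_nonneg_right (wt_av ha1 k) (mul_self_nonneg _)) (φ (z i))
  have := mul_le_mul_of_nonneg_left this (wt_nonneg zero_le_one le_rfl (n := n) (m := m) i)
  unfold Rh
  linarith


lemma low (hφ : Continuous φ) (hφn : ∀ x, ‖φ x‖ = 1) (hn : 0 < n) (hm : 0 < m)
    (p q : Measure (EuclideanSpace ℝ (Fin d))) [IsProbabilityMeasure p] [IsProbabilityMeasure q]
    {ι : Type*} (f : HilbertBasis ι ℝ H) (lam : ι → ℝ)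
    (hf : ∀ i, covOp φ p (f i) = lam i • f i) (hl : ∀ i, 0 ≤ lam i) {b : ℝ} (hb : 0 < b) :
    ∫ z, Dh φ 1 b z ∂(Measure.pi (PP n m p q)) ≤ D0 φ p q 1 b := by
  have hA := covOp_pos hφ hφn p
  set A := covOp φ p with hAdef
  have hfn : ∀ i, ⟪f i, A (f i)⟫ = lam i := fun i => by
    rw [hf, inner_smul_right, basis_norm, mul_one]
  have hr : ∀ i, 0 < 1 / (lam i + b) := fun i => by have := hl i; positivity
  have hrb : ∀ i, 1 / (lam i + b) ≤ 1 / b := fun i => by have := hl i; gcongr; linarith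
  have hR2 : ∀ x : H, HasSum (fun i => (1 / (lam i + b)) ^ 2 * ⟪x, f i⟫ ^ 2) (‖res A b x‖ ^ 2) := by
    intro x
    refine (hasSum_sq f (res A b x)).congr_fun fun i => ?_
    rw [res_symm hA hb, res_eig hA hb (hl i) (hf i), inner_smul_right]; ring
  have t1 := trace_hasSum hφ hφn p f (fun i => 1 / (lam i + b)) (1 / b) (fun i => (hr i).le) hrb
    (F := fun x => ⟪φ x, res A b (φ x)⟫) (fun x => res_hasSum hA hb f hf hl (φ x))
  have t2 := trace_hasSum hφ hφn p f (fun i => (1 / (lam i + b)) ^ 2) ((1 / b) ^ 2)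
    (fun i => sq_nonneg _) (fun i => pow_le_pow_left₀ (hr i).le (hrb i) 2)
    (F := fun x => ‖res A b (φ x)‖ ^ 2) (fun x => hR2 (φ x))
  rw [← hAdef] at t1 t2
  simp only [hfn] at t1 t2
  have hpt : ∀ z : Fin n ⊕ Fin m → EuclideanSpace ℝ (Fin d), Dh φ 1 b z ≤
      ∫ x, ⟪φ x, res A b (φ x)⟫ ∂p + b * (∑ k, wt n m 1 k * ‖res A b (φ (z k))‖ ^ 2
        - ∫ x, ‖res A b (φ x)‖ ^ 2 ∂p) := by
    intro z
    have hw := wt_nonneg (n := n) (m := m) zero_le_one le_rfl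
    have hÂ := Bh_pos φ hw z
    have s1 : HasSum (fun i => ∑ k, wt n m 1 k *
        (⟪φ (z k), f i⟫ * ⟪f i, Rh φ (wt n m 1) b z (φ (z k))⟫)) (Dh φ 1 b z) :=
      hasSum_sum fun k _ => (f.hasSum_inner_mul_inner _ _).mul_left _
    have s2 : HasSum (fun i => ∑ k, wt n m 1 k * ((1 / (lam i + b)) ^ 2 * ⟪φ (z k), f i⟫ ^ 2))
        (∑ k, wt n m 1 k * ‖res A b (φ (z k))‖ ^ 2) :=
      hasSum_sum fun k _ => (hR2 _).mul_left _
    refine hasSum_le (fun i => ?_) s1 (t1.add ((s2.sub t2).mul_left b))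
    have e1 : ∑ k, wt n m 1 k * (⟪φ (z k), f i⟫ * ⟪f i, Rh φ (wt n m 1) b z (φ (z k))⟫)
        = 1 - b * ⟪f i, Rh φ (wt n m 1) b z (f i)⟫ := by
      have h1 := Bh_inner φ (wt n m 1) z (f i) (Rh φ (wt n m 1) b z (f i))
      have h2 := congrArg (fun y => ⟪f i, y⟫) (mul_res_apply hÂ hb (f i))
      simp only [inner_add_right, inner_smul_right, basis_norm] at h2
      have h3 : ∑ k, wt n m 1 k * (⟪φ (z k), f i⟫ * ⟪f i, Rh φ (wt n m 1) b z (φ (z k))⟫)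
          = ⟪f i, Bh φ (wt n m 1) z (Rh φ (wt n m 1) b z (f i))⟫ := by
        rw [h1]
        refine Finset.sum_congr rfl fun k _ => ?_
        unfold Rh
        rw [← res_symm hÂ hb, real_inner_comm (φ (z k)) (res _ _ (f i))]
      rw [h3]
      unfold Rh
      linarith
    have e2 : ∑ k, wt n m 1 k * ((1 / (lam i + b)) ^ 2 * ⟪φ (z k), f i⟫ ^ 2)
        = (1 / (lam i + b)) ^ 2 * ⟪f i, Bh φ (wt n m 1) z (f i)⟫ := by
      rw [Bh_inner, Finset.mul_sum]
      refine Finset.sum_congr rfl fun k _ => ?_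
      ring
    rw [e1, e2]
    have h4 := res_lower hÂ hb (f i)
    have h5 := hÂ.2 (f i)
    have h6 := res_nonneg hÂ hb (f i)
    rw [f.orthonormal.1 i] at h4
    unfold Rh
    set S := ⟪f i, res (Bh φ (wt n m 1) z) b (f i)⟫
    set ai := ⟪f i, Bh φ (wt n m 1) z (f i)⟫
    have hy : 0 < ai + b := by linarith
    have h7 : (1:ℝ) ≤ S * (ai + b) := by simpa using h4
    have h8 : (1 / (lam i + b)) * (lam i + b) = 1 := by
      have := hl i
      rw [one_div, inv_mul_cancel₀ (by positivity)]
    set r := 1 / (lam i + b)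
    have h9 : 2 * r - r ^ 2 * (ai + b) ≤ S := by
      by_contra hcon; push Not at hcon
      have := mul_lt_mul_of_pos_right hcon hy
      nlinarith [sq_nonneg (1 - r * (ai + b))]
    have h10 := mul_le_mul_of_nonneg_left h9 hb.le
    have h11 : r * lam i = 1 - r * b := by linarith
    have h12 : r ^ 2 * lam i = r - r ^ 2 * b := by
      calc r ^ 2 * lam i = r * (r * lam i) := by ring
        _ = _ := by rw [h11]; ring
    rw [h11, h12]
    nlinarith
  have bR : BM fun x => ‖res A b (φ x)‖ ^ 2 := by
    refine BM.of_cont (by fun_prop) ((1 / b) ^ 2) fun x => ?_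
    rw [abs_of_nonneg (sq_nonneg _)]
    have := norm_res_le hA hb (φ x)
    rw [hφn] at this
    gcongr
  have bS : BM fun z : Fin n ⊕ Fin m → EuclideanSpace ℝ (Fin d) =>
      ∑ k, wt n m 1 k * ‖res A b (φ (z k))‖ ^ 2 :=
    BM.sum _ fun k _ => (bR.comp (measurable_pi_apply k)).const_mul _
  have hE : ∫ z, ∑ k, wt n m 1 k * ‖res A b (φ (z k))‖ ^ 2 ∂(Measure.pi (PP n m p q))
      = ∫ x, ‖res A b (φ x)‖ ^ 2 ∂p := by
    rw [integral_finsetSum _ (fun k _ =>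
      ((bR.comp (measurable_pi_apply k)).const_mul (wt n m 1 k)).integrable _)]
    have : ∀ k, ∫ z, wt n m 1 k * ‖res A b (φ (z k))‖ ^ 2 ∂(Measure.pi (PP n m p q))
        = wt n m 1 k * ∫ x, ‖res A b (φ x)‖ ^ 2 ∂(PP n m p q k) := fun k => by
      rw [integral_const_mul]
      congr 1
      exact integral_comp_eval (μ := PP n m p q) (i := k) (f := fun x => ‖res A b (φ x)‖ ^ 2)
        bR.1.aestronglyMeasurable
    simp_rw [this]
    rw [wt_wsum hn hm p q 1 (fun P => ∫ x, ‖res A b (φ x)‖ ^ 2 ∂P)]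
    ring
  have hI := integral_mono ((bm_Dh hφ hφn zero_le_one le_rfl hb).integrable (Measure.pi (PP n m p q)))
    (((BM.const _).add ((bS.sub (BM.const _)).const_mul b)).integrable _) hpt
  refine hI.trans (le_of_eq ?_)
  rw [integral_add ((BM.const _).integrable _) (((bS.sub (BM.const _)).const_mul b).integrable _),
    integral_const_mul, integral_sub (bS.integrable _) ((BM.const _).integrable _), hE]
  simp [D0, mix_one, hAdef]

end emp

section scal

lemma cs_loc {g : ℝ → ℝ} (hg0 : ∀ β, 0 < β → 0 ≤ g β) {C L : ℝ} (hL : 0 < L) (hC : 0 < C)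
    (hi : IntegrableOn (fun β => g β ^ 2) (Set.Ioi 0)) (hC2 : ∫ β in Set.Ioi 0, g β ^ 2 = C) :
    IntegrableOn g (Set.Ioc 0 L) ∧ ∫ β in Set.Ioc 0 L, g β ≤ Real.sqrt (L * C) := by
  have hsub : Set.Ioc 0 L ⊆ Set.Ioi (0:ℝ) := fun x hx => hx.1
  have hi' := hi.mono_set hsub
  have hLC : 0 < Real.sqrt (L * C) := Real.sqrt_pos.2 (by positivity)
  set t := Real.sqrt (L * C) / C with ht
  have ht0 : 0 < t := by positivity
  have hb : ∀ β ∈ Set.Ioc 0 L, g β ≤ t / 2 * g β ^ 2 + 1 / (2 * t) := fun β _ => by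
    have : t / 2 * g β ^ 2 + 1 / (2 * t) - g β = (t * g β - 1) ^ 2 / (2 * t) := by
      field_simp; ring
    have h2 : 0 ≤ (t * g β - 1) ^ 2 / (2 * t) := by positivity
    linarith
  have hi2 : IntegrableOn (fun β => t / 2 * g β ^ 2 + 1 / (2 * t)) (Set.Ioc 0 L) :=
    (hi'.const_mul _).add (integrableOn_const (by simp))
  have hm : AEStronglyMeasurable g (volume.restrict (Set.Ioc 0 L)) := by
    have h1 := (Real.continuous_sqrt.comp_aestronglyMeasurable hi'.1)
    refine h1.congr ((ae_restrict_iff' measurableSet_Ioc).2 (Filter.Eventually.of_forall fun β hβ => ?_))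
    exact Real.sqrt_sq (hg0 β hβ.1)
  have hig : IntegrableOn g (Set.Ioc 0 L) := by
    refine Integrable.mono' hi2 hm ((ae_restrict_iff' measurableSet_Ioc).2
      (Filter.Eventually.of_forall fun β hβ => ?_))
    rw [Real.norm_of_nonneg (hg0 β hβ.1)]
    exact hb β hβ
  refine ⟨hig, ?_⟩
  have h1 := setIntegral_mono_on hig hi2 measurableSet_Ioc hb
  have h2 : ∫ β in Set.Ioc 0 L, (t / 2 * g β ^ 2 + 1 / (2 * t))
      = t / 2 * (∫ β in Set.Ioc 0 L, g β ^ 2) + L * (1 / (2 * t)) := by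
    rw [integral_add (hi'.const_mul _) (integrableOn_const (by simp)), integral_const_mul]
    simp [hL.le]
  have h3 : ∫ β in Set.Ioc 0 L, g β ^ 2 ≤ C := by
    rw [← hC2]
    exact setIntegral_mono_set hi (Filter.Eventually.of_forall fun β => sq_nonneg _)
      (Filter.Eventually.of_forall hsub)
  have h4 := mul_le_mul_of_nonneg_left h3 (by positivity : 0 ≤ t / 2)
  have h5 : t / 2 * C + L * (1 / (2 * t)) = Real.sqrt (L * C) := by
    have hsq : Real.sqrt (L * C) ^ 2 = L * C := Real.sq_sqrt (by positivity)
    set S := Real.sqrt (L * C)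
    rw [ht]
    field_simp
    nlinarith
  linarith

lemma scale_sq {s : ℝ → ℝ} {c κ : ℝ} (hκ : 0 < κ)
    (hi : IntegrableOn (fun β => s β ^ 2) (Set.Ioi 0)) (hc : ∫ β in Set.Ioi 0, s β ^ 2 = c) :
    IntegrableOn (fun β => ((1 / κ) * s (β / κ)) ^ 2) (Set.Ioi 0) ∧
      ∫ β in Set.Ioi 0, ((1 / κ) * s (β / κ)) ^ 2 = c / κ := by
  have hκ' : 0 < κ⁻¹ := inv_pos.2 hκ
  simp only [mul_pow, div_eq_mul_inv _ κ]
  constructor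
  · refine Integrable.const_mul ?_ _
    have := (integrableOn_Ioi_comp_mul_right_iff (fun β => s β ^ 2) 0 hκ').2 (by simpa using hi)
    exact this
  · rw [integral_const_mul, integral_comp_mul_right_Ioi (fun β => s β ^ 2) 0 hκ', zero_mul, hc]
    simp only [smul_eq_mul, inv_inv]
    field_simp

lemma tail_int : IntegrableOn (fun β : ℝ => 2 / β ^ 2) (Set.Ioi 1) ∧
    ∫ β in Set.Ioi (1:ℝ), 2 / β ^ 2 = 2 := by
  have hd : ∀ x ∈ Set.Ici (1:ℝ), HasDerivAt (fun β : ℝ => -2 * β⁻¹) (2 / x ^ 2) x := by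
    intro x hx
    have hx : (1:ℝ) ≤ x := hx
    have := (hasDerivAt_inv (by linarith : x ≠ 0)).const_mul (-2)
    have e : 2 / x ^ 2 = -2 * -(x ^ 2)⁻¹ := by rw [div_eq_mul_inv]; ring
    rw [e]; exact this
  have hp : ∀ x ∈ Set.Ioi (1:ℝ), 0 ≤ 2 / x ^ 2 := fun x _ => by positivity
  have ht : Filter.Tendsto (fun β : ℝ => -2 * β⁻¹) Filter.atTop (nhds 0) := by
    simpa using tendsto_inv_atTop_zero.const_mul (-2 : ℝ)
  refine ⟨integrableOn_Ioi_deriv_of_nonneg' hd hp ht, ?_⟩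
  rw [integral_Ioi_of_hasDerivAt_of_nonneg' hd hp ht]; norm_num

/-- the explicit majorant -/
def bnd (s : ℝ → ℝ) (N a κ : ℝ) (β : ℝ) : ℝ :=
  (Set.Ioc 0 (16 / N)).indicator (fun β => 2 * ((1 / a) * s (β / a))) β
    + 195 * (1 / N) * ((1 / κ) * s (β / κ)) ^ 2
    + Real.sqrt (1 / N) / a * ((Set.Ioc 0 1).indicator (fun β => 9 * ((1 / κ) * s (β / κ))) β
      + (Set.Ioi 1).indicator (fun β => 2 / β ^ 2) β)

lemma bnd_int {s : ℝ → ℝ} {c N a κ : ℝ} (hs0 : ∀ β, 0 < β → 0 ≤ s β) (hN : 0 < N) (ha : 0 < a)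
    (ha1 : a ≤ 1) (hκ : 0 < κ) (hκ1 : κ ≤ 1) (hc4 : 1 / 4 ≤ c) (hcN : Real.sqrt c / Real.sqrt N ≤ 1 / 70)
    (hi : IntegrableOn (fun β => s β ^ 2) (Set.Ioi 0)) (hc : ∫ β in Set.Ioi 0, s β ^ 2 = c) :
    IntegrableOn (bnd s N a κ) (Set.Ioi 0) ∧
      ∫ β in Set.Ioi 0, bnd s N a κ β ≤ 24 * (Real.sqrt c / Real.sqrt N) * (1 / (a * κ)) := by
  have hc0 : 0 < c := by linarith
  obtain ⟨ia, ea⟩ := scale_sq ha hi hc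
  obtain ⟨ik, ek⟩ := scale_sq hκ hi hc
  have pa : ∀ β, 0 < β → 0 ≤ (1 / a) * s (β / a) := fun β hβ =>
    mul_nonneg (by positivity) (hs0 _ (by positivity))
  have pk : ∀ β, 0 < β → 0 ≤ (1 / κ) * s (β / κ) := fun β hβ =>
    mul_nonneg (by positivity) (hs0 _ (by positivity))
  obtain ⟨ja, la⟩ := cs_loc pa (by positivity : 0 < 16 / N) (by positivity) ia ea
  obtain ⟨jk, lk⟩ := cs_loc pk one_pos (by positivity) ik ek
  obtain ⟨it, et⟩ := tail_int
  have i1 : IntegrableOn ((Set.Ioc 0 (16 / N)).indicator (fun β => 2 * ((1 / a) * s (β / a))))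
      (Set.Ioi 0) := ((integrable_indicator_iff measurableSet_Ioc).2 (ja.const_mul 2)).integrableOn
  have i2 : IntegrableOn (fun β => 195 * (1 / N) * ((1 / κ) * s (β / κ)) ^ 2) (Set.Ioi 0) :=
    ik.const_mul _
  have i3 : IntegrableOn ((Set.Ioc 0 1).indicator (fun β => 9 * ((1 / κ) * s (β / κ))))
      (Set.Ioi 0) := ((integrable_indicator_iff measurableSet_Ioc).2 (jk.const_mul 9)).integrableOn
  have i4 : IntegrableOn ((Set.Ioi 1).indicator (fun β : ℝ => 2 / β ^ 2)) (Set.Ioi 0) :=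
    ((integrable_indicator_iff measurableSet_Ioi).2 it).integrableOn
  have v1 : ∫ β in Set.Ioi 0, (Set.Ioc 0 (16 / N)).indicator (fun β => 2 * ((1 / a) * s (β / a))) β
      ≤ 2 * Real.sqrt (16 / N * (c / a)) := by
    have hsub : Set.Ioc (0:ℝ) (16 / N) ⊆ Set.Ioi 0 := fun x hx => hx.1
    rw [setIntegral_indicator measurableSet_Ioc, Set.inter_eq_right.2 hsub, integral_const_mul]
    linarith
  have v3 : ∫ β in Set.Ioi 0, (Set.Ioc 0 1).indicator (fun β => 9 * ((1 / κ) * s (β / κ))) β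
      ≤ 9 * Real.sqrt (1 * (c / κ)) := by
    have hsub : Set.Ioc (0:ℝ) 1 ⊆ Set.Ioi 0 := fun x hx => hx.1
    rw [setIntegral_indicator measurableSet_Ioc, Set.inter_eq_right.2 hsub, integral_const_mul]
    linarith
  have v4 : ∫ β in Set.Ioi 0, (Set.Ioi 1).indicator (fun β : ℝ => 2 / β ^ 2) β = 2 := by
    have hsub : Set.Ioi (1:ℝ) ⊆ Set.Ioi 0 := Set.Ioi_subset_Ioi zero_le_one
    rw [setIntegral_indicator measurableSet_Ioi, Set.inter_eq_right.2 hsub, et]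
  refine ⟨(i1.add i2).add ((i3.add i4).const_mul _), ?_⟩
  have eI : ∫ β in Set.Ioi 0, bnd s N a κ β =
      (∫ β in Set.Ioi 0, (Set.Ioc 0 (16 / N)).indicator (fun β => 2 * ((1 / a) * s (β / a))) β)
      + 195 * (1 / N) * (c / κ)
      + Real.sqrt (1 / N) / a *
        ((∫ β in Set.Ioi 0, (Set.Ioc 0 1).indicator (fun β => 9 * ((1 / κ) * s (β / κ))) β)
        + ∫ β in Set.Ioi 0, (Set.Ioi 1).indicator (fun β : ℝ => 2 / β ^ 2) β) := by
    have i12 : IntegrableOn (fun β => (Set.Ioc 0 (16 / N)).indicator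
        (fun β => 2 * ((1 / a) * s (β / a))) β + 195 * (1 / N) * ((1 / κ) * s (β / κ)) ^ 2)
        (Set.Ioi 0) := i1.add i2
    have i34 : IntegrableOn (fun β => Real.sqrt (1 / N) / a *
        ((Set.Ioc 0 1).indicator (fun β => 9 * ((1 / κ) * s (β / κ))) β
          + (Set.Ioi 1).indicator (fun β => 2 / β ^ 2) β)) (Set.Ioi 0) := (i3.add i4).const_mul _
    unfold bnd
    rw [integral_add i12 i34, integral_add i1 i2, integral_const_mul,
      integral_const_mul, integral_add i3 i4, ek]
  rw [eI, v4]
  set sc := Real.sqrt c with hsc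
  set sN := Real.sqrt N with hsN
  have hsN0 : 0 < sN := Real.sqrt_pos.2 hN
  have hsc0 : 1 / 2 ≤ sc := by
    rw [hsc]; apply Real.le_sqrt_of_sq_le; norm_num; linarith
  have hc2 : c = sc ^ 2 := (Real.sq_sqrt hc0.le).symm
  have hN2 : N = sN ^ 2 := (Real.sq_sqrt hN.le).symm
  have q1 : Real.sqrt (16 / N * (c / a)) ≤ 4 * (sc / sN) * (1 / a) := by
    apply Real.sqrt_le_iff.2
    refine ⟨by positivity, ?_⟩
    have : (4 * (sc / sN) * (1 / a)) ^ 2 = 16 / N * (c / a) * (1 / a) := by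
      rw [hc2, hN2]; field_simp; ring
    rw [this]
    exact le_mul_of_one_le_right (by positivity) ((one_le_div ha).2 ha1)
  have q2 : Real.sqrt (1 * (c / κ)) ≤ sc * (1 / κ) := by
    apply Real.sqrt_le_iff.2
    refine ⟨by positivity, ?_⟩
    have : (sc * (1 / κ)) ^ 2 = 1 * (c / κ) * (1 / κ) := by
      rw [hc2]; field_simp
    rw [this]
    exact le_mul_of_one_le_right (by positivity) ((one_le_div hκ).2 hκ1)
  have q3 : Real.sqrt (1 / N) = 1 / sN := by rw [Real.sqrt_div zero_le_one, Real.sqrt_one]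
  have ra : 1 ≤ 1 / a := (one_le_div ha).2 ha1
  have rk : 1 ≤ 1 / κ := (one_le_div hκ).2 hκ1
  set x := sc / sN with hx
  have hx0 : 0 < x := by positivity
  have q4 : 195 * (1 / N) * (c / κ) = 195 * x * x * (1 / κ) := by
    rw [hx, hc2, hN2]; field_simp
  have q5 : 195 * x * x * (1 / κ) ≤ 3 * x * (1 / κ) := by
    have : 195 * x * x ≤ 3 * x := by nlinarith
    gcongr
  have q6 : Real.sqrt (1 / N) / a * (9 * Real.sqrt (1 * (c / κ)) + 2)
      ≤ 13 * x * (1 / (a * κ)) := by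
    have : 9 * Real.sqrt (1 * (c / κ)) + 2 ≤ 13 * sc * (1 / κ) := by nlinarith
    calc _ ≤ 1 / sN / a * (13 * sc * (1 / κ)) := by rw [q3]; gcongr
      _ = _ := by rw [hx]; field_simp
  have q7 : Real.sqrt (1 / N) / a * ((∫ β in Set.Ioi 0,
      (Set.Ioc 0 1).indicator (fun β => 9 * ((1 / κ) * s (β / κ))) β) + 2)
      ≤ Real.sqrt (1 / N) / a * (9 * Real.sqrt (1 * (c / κ)) + 2) := by gcongr
  have eak : 1 / (a * κ) = (1 / a) * (1 / κ) := by field_simp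
  have q8 : x * (1 / a) ≤ x * (1 / (a * κ)) := by
    rw [eak]; gcongr; exact le_mul_of_one_le_right (by positivity) rk
  have q9 : x * (1 / κ) ≤ x * (1 / (a * κ)) := by
    rw [eak]; gcongr; exact le_mul_of_one_le_left (by positivity) ra
  rw [q4]
  linarith

end scal

section fin
variable {d n m : ℕ} {H : Type u} [NormedAddCommGroup H] [InnerProductSpace ℝ H] [CompleteSpace H]
variable {φ : EuclideanSpace ℝ (Fin d) → H}

/-- the leverage function -/
def sS (φ : EuclideanSpace ℝ (Fin d) → H) (p : Measure (EuclideanSpace ℝ (Fin d))) (β : ℝ) : ℝ :=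
  ⨆ x, ⟪φ x, res (covOp φ p) β (φ x)⟫

lemma le_sS (hφ : Continuous φ) (hφn : ∀ x, ‖φ x‖ = 1)
    (p : Measure (EuclideanSpace ℝ (Fin d))) [IsProbabilityMeasure p] {β : ℝ} (hβ : 0 < β)
    (x : EuclideanSpace ℝ (Fin d)) : ⟪φ x, res (covOp φ p) β (φ x)⟫ ≤ sS φ p β := by
  refine le_ciSup (f := fun x => ⟪φ x, res (covOp φ p) β (φ x)⟫) ⟨1 / β, ?_⟩ x
  rintro _ ⟨y, rfl⟩
  simpa [hφn] using res_le (covOp_pos hφ hφn p) hβ (φ y)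

lemma sS_lower (hφ : Continuous φ) (hφn : ∀ x, ‖φ x‖ = 1)
    (p : Measure (EuclideanSpace ℝ (Fin d))) [IsProbabilityMeasure p] {β : ℝ} (hβ : 0 < β) :
    1 / (1 + β) ≤ sS φ p β := by
  refine le_trans ?_ (le_sS hφ hφn p hβ 0)
  have h := res_lower (covOp_pos hφ hφn p) hβ (φ 0)
  rw [hφn] at h
  have h0 := res_nonneg (covOp_pos hφ hφn p) hβ (φ 0)
  have h1 : ⟪φ 0, covOp φ p (φ 0)⟫ ≤ 1 := by
    rw [covOp_inner hφ hφn]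
    have hb : ∀ t, ⟪φ t, φ 0⟫ * ⟪φ t, φ 0⟫ ≤ 1 := fun t => by
      have h := abs_real_inner_le_norm (φ t) (φ 0)
      rw [hφn, hφn, one_mul] at h
      have := abs_le.1 h
      nlinarith
    have hb2 : BM fun t => ⟪φ t, φ 0⟫ * ⟪φ t, φ 0⟫ := by
      refine BM.of_cont (by fun_prop) 1 fun t => ?_
      rw [abs_of_nonneg (mul_self_nonneg _)]; exact hb t
    have := integral_mono (hb2.integrable p) ((BM.const (1:ℝ)).integrable p) hb
    simpa using this
  rw [div_le_iff₀ (by positivity)]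
  have h2 : ⟪φ 0, res (covOp φ p) β (φ 0)⟫ * (⟪φ 0, covOp φ p (φ 0)⟫ + β * 1 ^ 2)
      ≤ ⟪φ 0, res (covOp φ p) β (φ 0)⟫ * (1 + β) := by gcongr; linarith
  linarith

lemma sS_pos (hφ : Continuous φ) (hφn : ∀ x, ‖φ x‖ = 1)
    (p : Measure (EuclideanSpace ℝ (Fin d))) [IsProbabilityMeasure p] {β : ℝ} (hβ : 0 < β) :
    0 < sS φ p β := lt_of_lt_of_le (by positivity) (sS_lower hφ hφn p hβ)

lemma c_ge (hφ : Continuous φ) (hφn : ∀ x, ‖φ x‖ = 1)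
    (p : Measure (EuclideanSpace ℝ (Fin d))) [IsProbabilityMeasure p]
    (hi : IntegrableOn (fun β => sS φ p β ^ 2) (Set.Ioi 0)) :
    1 / 4 ≤ ∫ β in Set.Ioi 0, sS φ p β ^ 2 := by
  have hsub : Set.Ioc (0:ℝ) 1 ⊆ Set.Ioi 0 := fun x hx => hx.1
  have h1 : ∫ β in Set.Ioc (0:ℝ) 1, sS φ p β ^ 2 ≤ ∫ β in Set.Ioi 0, sS φ p β ^ 2 :=
    setIntegral_mono_set hi (Filter.Eventually.of_forall fun β => sq_nonneg _)
      (Filter.Eventually.of_forall hsub)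
  have h2 : ∫ β in Set.Ioc (0:ℝ) 1, (1 / 4 : ℝ) ≤ ∫ β in Set.Ioc 0 1, sS φ p β ^ 2 := by
    refine setIntegral_mono_on (integrableOn_const (by simp)) (hi.mono_set hsub) measurableSet_Ioc
      fun β hβ => ?_
    have h := sS_lower hφ hφn p hβ.1
    have h3 : (1:ℝ) / 2 ≤ 1 / (1 + β) := by
      have := hβ.1
      gcongr; linarith [hβ.2]
    nlinarith
  have h3 : ∫ β in Set.Ioc (0:ℝ) 1, (1 / 4 : ℝ) = 1 / 4 := by simp
  linarith

lemma bm_D0 (hφ : Continuous φ) (hφn : ∀ x, ‖φ x‖ = 1)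
    (p q : Measure (EuclideanSpace ℝ (Fin d))) [IsProbabilityMeasure p] [IsProbabilityMeasure q]
    {a : ℝ} (ha : 0 < a) (ha1 : a ≤ 1) {β : ℝ} (hβ : 0 < β) :
    BM (fun x => ⟪φ x, res (mix φ a p q) β (φ x)⟫) :=
  bm_res (T := fun _ => mix φ a p q) continuous_const (fun _ => mix_pos hφ hφn ha ha1 p q) hβ hφ hφ
    (fun z => (hφn _).le) (fun z => (hφn _).le)

lemma D0_nonneg (hφ : Continuous φ) (hφn : ∀ x, ‖φ x‖ = 1)
    (p q : Measure (EuclideanSpace ℝ (Fin d))) [IsProbabilityMeasure p] [IsProbabilityMeasure q]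
    {a : ℝ} (ha : 0 < a) (ha1 : a ≤ 1) {β : ℝ} (hβ : 0 < β) : 0 ≤ D0 φ p q a β :=
  integral_nonneg fun _ => res_nonneg (mix_pos hφ hφn ha ha1 p q) hβ _

lemma D0_one_le (hφ : Continuous φ) (hφn : ∀ x, ‖φ x‖ = 1)
    (p q : Measure (EuclideanSpace ℝ (Fin d))) [IsProbabilityMeasure p] [IsProbabilityMeasure q]
    {β : ℝ} (hβ : 0 < β) : D0 φ p q 1 β ≤ sS φ p β := by
  have := integral_mono ((bm_D0 hφ hφn p q one_pos le_rfl hβ).integrable p)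
    ((BM.const (sS φ p β)).integrable p) (fun x => by rw [mix_one]; exact le_sS hφ hφn p hβ x)
  simpa [D0] using this

lemma D0_le (hφ : Continuous φ) (hφn : ∀ x, ‖φ x‖ = 1)
    (p q : Measure (EuclideanSpace ℝ (Fin d))) [IsProbabilityMeasure p] [IsProbabilityMeasure q]
    {a : ℝ} (ha : 0 < a) (ha1 : a ≤ 1) {β : ℝ} (hβ : 0 < β) :
    D0 φ p q a β ≤ (1 / a) * D0 φ p q 1 (β / a) := by
  unfold D0
  rw [← integral_const_mul]
  refine integral_mono ((bm_D0 hφ hφn p q ha ha1 hβ).integrable p)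
    (((bm_D0 hφ hφn p q one_pos le_rfl (by positivity)).const_mul _).integrable p) fun x => ?_
  simp only [mix_one]
  exact res_anti (mix_pos hφ hφn ha ha1 p q) (covOp_pos hφ hφn p) hβ ha (mix_ge hφ hφn ha1 p q) _

lemma lowb (hφ : Continuous φ) (hφn : ∀ x, ‖φ x‖ = 1) (hn : 0 < n) (hm : 0 < m)
    (p q : Measure (EuclideanSpace ℝ (Fin d))) [IsProbabilityMeasure p] [IsProbabilityMeasure q]
    {ι : Type*} (f : HilbertBasis ι ℝ H) (lam : ι → ℝ)
    (hf : ∀ i, covOp φ p (f i) = lam i • f i) (hl : ∀ i, 0 ≤ lam i)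
    {a : ℝ} (ha : 0 < a) (ha1 : a ≤ 1) {β : ℝ} (hβ : 0 < β) :
    ∫ z, |Dh φ a β z - D0 φ p q a β| ∂(Measure.pi (PP n m p q))
      ≤ 2 * ((1 / a) * sS φ p (β / a)) := by
  have hβa : 0 < β / a := by positivity
  have b1 := bm_Dh (n := n) (m := m) hφ hφn ha.le ha1 hβ
  have b2 := bm_Dh (n := n) (m := m) hφ hφn zero_le_one le_rfl hβa
  have hE := low hφ hφn hn hm p q f lam hf hl hβa
  have h1 := D0_le hφ hφn p q ha ha1 hβ
  have h2 := D0_one_le hφ hφn p q hβa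
  have h0 := D0_nonneg hφ hφn p q ha ha1 hβ
  have hI := integral_mono (((b1.sub (BM.const (D0 φ p q a β))).abs).integrable (Measure.pi (PP n m p q)))
    (((b2.const_mul (1 / a)).add (BM.const (D0 φ p q a β))).integrable (Measure.pi (PP n m p q)))
    (fun z => by
      have g1 := Dh_le (φ := φ) ha ha1 hβ z
      have g2 := Dh_nonneg (φ := φ) ha.le ha1 hβ z
      show |Dh φ a β z - D0 φ p q a β| ≤ 1 / a * Dh φ 1 (β / a) z + D0 φ p q a β
      rw [abs_le]; constructor <;> linarith)
  rw [integral_add ((b2.const_mul (1 / a)).integrable _) ((BM.const _).integrable _),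
    integral_const_mul] at hI
  simp only [integral_const, probReal_univ, one_smul] at hI
  have h3 : (1 / a) * ∫ z, Dh φ 1 (β / a) z ∂(Measure.pi (PP n m p q))
    ≤ (1 / a) * D0 φ p q 1 (β / a) := by gcongr
  have h4 : (1 / a) * D0 φ p q 1 (β / a) ≤ (1 / a) * sS φ p (β / a) := by gcongr
  linarith

lemma ptw (hφ : Continuous φ) (hφn : ∀ x, ‖φ x‖ = 1) (hn : 0 < n) (hm : 0 < m)
    (p q : Measure (EuclideanSpace ℝ (Fin d))) [IsProbabilityMeasure p] [IsProbabilityMeasure q]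
    {ι : Type*} (f : HilbertBasis ι ℝ H) (lam : ι → ℝ)
    (hf : ∀ i, covOp φ p (f i) = lam i • f i) (hl : ∀ i, 0 ≤ lam i)
    {a : ℝ} (ha : 0 < a) (ha1 : a ≤ 1) {κ : ℝ} (hκ : 0 < κ)
    (hκm : ∀ u, κ * ⟪u, covOp φ p u⟫ ≤ ⟪u, mix φ a p q u⟫) {β : ℝ} (hβ : 0 < β) :
    ∫ z, |Dh φ a β z - D0 φ p q a β| ∂(Measure.pi (PP n m p q))
      ≤ bnd (sS φ p) (min m n : ℕ) a κ β := by
  unfold bnd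
  have hs : 0 < (1 / κ) * sS φ p (β / κ) :=
    mul_pos (by positivity) (sS_pos hφ hφn p (by positivity))
  have t2 : 0 ≤ 195 * (1 / ((min m n : ℕ):ℝ)) * ((1 / κ) * sS φ p (β / κ)) ^ 2 := by positivity
  have hcoef : 0 ≤ Real.sqrt (1 / ((min m n : ℕ):ℝ)) / a := by positivity
  have t3 : 0 ≤ (Set.Ioc 0 1).indicator (fun β => 9 * ((1 / κ) * sS φ p (β / κ))) β := by
    by_cases h : β ∈ Set.Ioc (0:ℝ) 1
    · rw [Set.indicator_of_mem h]; positivity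
    · rw [Set.indicator_of_notMem h]
  have t4 : 0 ≤ (Set.Ioi 1).indicator (fun β : ℝ => 2 / β ^ 2) β := by
    by_cases h : β ∈ Set.Ioi (1:ℝ)
    · rw [Set.indicator_of_mem h]; positivity
    · rw [Set.indicator_of_notMem h]
  have t34 := mul_nonneg hcoef (add_nonneg t3 t4)
  by_cases hc : β ≤ 16 / ((min m n : ℕ):ℝ)
  · have hmem : β ∈ Set.Ioc (0:ℝ) (16 / ((min m n : ℕ):ℝ)) := ⟨hβ, hc⟩
    rw [Set.indicator_of_mem hmem]
    have := lowb hφ hφn hn hm p q f lam hf hl ha ha1 hβ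
    linarith
  · have hmem : β ∉ Set.Ioc (0:ℝ) (16 / ((min m n : ℕ):ℝ)) := fun h => hc h.2
    rw [Set.indicator_of_notMem hmem, zero_add]
    push Not at hc
    have := high hφ hφn hn hm p q ha ha1 hc.le hs (fun t =>
      (res_anti (mix_pos hφ hφn ha ha1 p q) (covOp_pos hφ hφn p) hβ hκ hκm (φ t)).trans
        (mul_le_mul_of_nonneg_left (le_sS hφ hφn p (by positivity) t) (by positivity)))
    refine this.trans (add_le_add le_rfl (mul_le_mul_of_nonneg_left ?_ hcoef))
    rcases le_or_gt β 1 with h1 | h1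
    · have e : (Set.Ioc 0 1).indicator (fun β => 9 * ((1 / κ) * sS φ p (β / κ))) β
        = 9 * ((1 / κ) * sS φ p (β / κ)) := Set.indicator_of_mem (show β ∈ Set.Ioc (0:ℝ) 1 from ⟨hβ, h1⟩) _
      have := min_le_left (9 * ((1 / κ) * sS φ p (β / κ))) (2 / β ^ 2)
      linarith
    · have e : (Set.Ioi 1).indicator (fun β : ℝ => 2 / β ^ 2) β = 2 / β ^ 2 :=
        Set.indicator_of_mem (show β ∈ Set.Ioi (1:ℝ) from h1) _
      have := min_le_right (9 * ((1 / κ) * sS φ p (β / κ))) (2 / β ^ 2)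
      linarith

lemma mix_mu (hφ : Continuous φ) (hφn : ∀ x, ‖φ x‖ = 1)
    (p q : Measure (EuclideanSpace ℝ (Fin d))) [IsProbabilityMeasure p] [IsProbabilityMeasure q]
    {a μ : ℝ} (ha : 0 < a) (ha1 : a ≤ 1) (hμ : 0 < μ) (hμ1 : μ ≤ 1)
    (hpq : p ≪ q) (hratio : ∀ᵐ x ∂q, p.rnDeriv q x ≤ ENNReal.ofReal (1 / μ)) (u : H) :
    μ * ⟪u, covOp φ p u⟫ ≤ ⟪u, mix φ a p q u⟫ := by
  have hle : p ≤ ENNReal.ofReal (1 / μ) • q := by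
    have : p.HaveLebesgueDecomposition q := Measure.haveLebesgueDecomposition_of_sigmaFinite p q
    have h := withDensity_mono (μ := q) hratio
    rwa [Measure.withDensity_rnDeriv_eq p q hpq, withDensity_const] at h
  have hb : BM fun t => ⟪φ t, u⟫ ^ 2 := by
    refine BM.of_cont (by fun_prop) (‖u‖ ^ 2) fun t => ?_
    rw [abs_of_nonneg (sq_nonneg _)]
    have h := abs_real_inner_le_norm (φ t) u
    rw [hφn, one_mul] at h
    rw [← sq_abs]
    gcongr
  have h1 : ⟪u, covOp φ p u⟫ ≤ (1 / μ) * ⟪u, covOp φ q u⟫ := by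
    rw [covOp_quad hφ hφn, covOp_quad hφ hφn]
    have := integral_mono_measure hle (Filter.Eventually.of_forall fun t => sq_nonneg (⟪φ t, u⟫))
      ((hb.integrable q).smul_measure ENNReal.ofReal_ne_top)
    rw [integral_smul_measure, ENNReal.toReal_ofReal (by positivity)] at this
    exact this
  have h2 : μ * ⟪u, covOp φ p u⟫ ≤ ⟪u, covOp φ q u⟫ := by
    have := mul_le_mul_of_nonneg_left h1 hμ.le
    rwa [← mul_assoc, mul_one_div_cancel hμ.ne', one_mul] at this
  have h3 := (covOp_pos hφ hφn p).2 u
  rw [mix_inner]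
  have h4 := mul_le_mul_of_nonneg_left h2 (by linarith : 0 ≤ 1 - a)
  have h5 : μ * ⟪u, covOp φ p u⟫ ≤ ⟪u, covOp φ p u⟫ := by nlinarith
  have h6 := mul_le_mul_of_nonneg_left h5 ha.le
  nlinarith

end fin

section fin2
variable {d n m : ℕ} {H : Type u} [NormedAddCommGroup H] [InnerProductSpace ℝ H] [CompleteSpace H]
variable {φ : EuclideanSpace ℝ (Fin d) → H}

lemma meas_D0 (hφ : Continuous φ) (hφn : ∀ x, ‖φ x‖ = 1)
    (p q : Measure (EuclideanSpace ℝ (Fin d))) [IsProbabilityMeasure p] [IsProbabilityMeasure q]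
    {a : ℝ} (ha : 0 < a) (ha1 : a ≤ 1) :
    AEStronglyMeasurable (D0 φ p q a) (volume.restrict (Set.Ioi 0)) := by
  have hc : ContinuousOn (fun w : ℝ × EuclideanSpace ℝ (Fin d) =>
      ⟪φ w.2, res (mix φ a p q) w.1 (φ w.2)⟫) (Set.Ioi 0 ×ˢ Set.univ) := by
    have h1 : ContinuousOn (fun w : ℝ × EuclideanSpace ℝ (Fin d) => res (mix φ a p q) w.1)
        (Set.Ioi 0 ×ˢ Set.univ) :=
      continuousOn_res continuousOn_const continuousOn_fst
        (fun _ _ => mix_pos hφ hφn ha ha1 p q) (fun w hw => hw.1)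
    have h2 : ContinuousOn (fun w : ℝ × EuclideanSpace ℝ (Fin d) => φ w.2)
        (Set.Ioi 0 ×ˢ Set.univ) := (hφ.comp continuous_snd).continuousOn
    exact h2.inner (𝕜 := ℝ) (h1.clm_apply h2)
  have hm := hc.aestronglyMeasurable (μ := (volume : Measure ℝ).prod p)
    (measurableSet_Ioi.prod MeasurableSet.univ)
  rw [← Measure.prod_restrict, Measure.restrict_univ] at hm
  exact hm.integral_prod_right'

lemma meas_Dh (hφ : Continuous φ) {a : ℝ} (ha : 0 ≤ a) (ha1 : a ≤ 1)
    (P : Measure (Fin n ⊕ Fin m → EuclideanSpace ℝ (Fin d))) [SFinite P] :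
    AEStronglyMeasurable (fun w : (Fin n ⊕ Fin m → EuclideanSpace ℝ (Fin d)) × ℝ => Dh φ a w.2 w.1)
      (P.prod (volume.restrict (Set.Ioi 0))) := by
  have hc : ContinuousOn (fun w : (Fin n ⊕ Fin m → EuclideanSpace ℝ (Fin d)) × ℝ => Dh φ a w.2 w.1)
      (Set.univ ×ˢ Set.Ioi 0) := by
    unfold Dh Fh Rh
    have h1 : ContinuousOn (fun w : (Fin n ⊕ Fin m → EuclideanSpace ℝ (Fin d)) × ℝ =>
        res (Bh φ (wt n m a) w.1) w.2) (Set.univ ×ˢ Set.Ioi 0) :=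
      continuousOn_res ((continuous_Bh hφ _).comp continuous_fst).continuousOn continuousOn_snd
        (fun w _ => Bh_pos φ (wt_nonneg ha ha1) w.1) (fun w hw => hw.2)
    refine continuousOn_finsetSum _ fun i _ => ContinuousOn.mul continuousOn_const ?_
    have h2 : ContinuousOn (fun w : (Fin n ⊕ Fin m → EuclideanSpace ℝ (Fin d)) × ℝ => φ (w.1 i))
        (Set.univ ×ˢ Set.Ioi 0) :=
      (hφ.comp ((continuous_apply i).comp continuous_fst)).continuousOn
    exact h2.inner (𝕜 := ℝ) (h1.clm_apply h2)
  have hm := hc.aestronglyMeasurable (μ := P.prod (volume : Measure ℝ))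
    (MeasurableSet.univ.prod measurableSet_Ioi)
  rwa [← Measure.prod_restrict, Measure.restrict_univ] at hm

/-- one-parameter contribution -/
lemma contrib (hφ : Continuous φ) (hφn : ∀ x, ‖φ x‖ = 1) (hn : 0 < n) (hm : 0 < m)
    (p q : Measure (EuclideanSpace ℝ (Fin d))) [IsProbabilityMeasure p] [IsProbabilityMeasure q]
    {ι : Type*} (f : HilbertBasis ι ℝ H) (lam : ι → ℝ)
    (hf : ∀ i, covOp φ p (f i) = lam i • f i) (hl : ∀ i, 0 ≤ lam i)
    {a : ℝ} (ha : 0 < a) (ha1 : a ≤ 1) {κ : ℝ} (hκ : 0 < κ) (hκ1 : κ ≤ 1)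
    (hκm : ∀ u, κ * ⟪u, covOp φ p u⟫ ≤ ⟪u, mix φ a p q u⟫) {c : ℝ}
    (hcN : Real.sqrt c / Real.sqrt (min m n : ℕ) ≤ 1 / 70)
    (hi : IntegrableOn (fun β => sS φ p β ^ 2) (Set.Ioi 0))
    (hc : ∫ β in Set.Ioi 0, sS φ p β ^ 2 = c) :
    ∫⁻ z, (∫⁻ β in Set.Ioi (0:ℝ), ENNReal.ofReal |Dh φ a β z - D0 φ p q a β|)
      ∂(Measure.pi (PP n m p q))
      ≤ ENNReal.ofReal (24 * (Real.sqrt c / Real.sqrt (min m n : ℕ)) * (1 / (a * κ))) := by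
  have hc4 : 1 / 4 ≤ c := by rw [← hc]; exact c_ge hφ hφn p hi
  have hN : (0:ℝ) < (min m n : ℕ) := by exact_mod_cast lt_min hm hn
  obtain ⟨ib, vb⟩ := bnd_int (fun β hβ => (sS_pos hφ hφn p hβ).le) hN ha ha1 hκ hκ1 hc4 hcN hi hc
  have hpt := fun β (hβ : (0:ℝ) < β) => ptw (n := n) (m := m) hφ hφn hn hm p q f lam hf hl ha ha1 hκ hκm hβ
  have hmeas : AEMeasurable (Function.uncurry fun (z : Fin n ⊕ Fin m → EuclideanSpace ℝ (Fin d)) β =>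
      ENNReal.ofReal |Dh φ a β z - D0 φ p q a β|)
      ((Measure.pi (PP n m p q)).prod (volume.restrict (Set.Ioi 0))) := by
    have h1 := (meas_Dh (n := n) (m := m) hφ ha.le ha1 (Measure.pi (PP n m p q))).aemeasurable
    have h2 : AEMeasurable (fun w : (Fin n ⊕ Fin m → EuclideanSpace ℝ (Fin d)) × ℝ =>
      D0 φ p q a w.2) ((Measure.pi (PP n m p q)).prod (volume.restrict (Set.Ioi 0))) :=
      ((meas_D0 hφ hφn p q ha ha1).comp_snd).aemeasurable
    exact ((continuous_abs.measurable.comp_aemeasurable (h1.sub h2))).ennreal_ofReal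
  rw [lintegral_lintegral_swap hmeas]
  calc _ ≤ ∫⁻ β in Set.Ioi (0:ℝ), ENNReal.ofReal (bnd (sS φ p) (min m n : ℕ) a κ β) := by
        refine setLIntegral_mono' measurableSet_Ioi fun β hβ => ?_
        have hβ : 0 < β := hβ
        have hb := ((bm_Dh (n := n) (m := m) hφ hφn ha.le ha1 hβ).sub
          (BM.const (D0 φ p q a β))).abs
        rw [← ofReal_integral_eq_lintegral_ofReal (hb.integrable _)
          (Filter.Eventually.of_forall fun z => abs_nonneg _)]
        exact ENNReal.ofReal_le_ofReal (hpt β hβ)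
    _ = ENNReal.ofReal (∫ β in Set.Ioi 0, bnd (sS φ p) (min m n : ℕ) a κ β) := by
        rw [ofReal_integral_eq_lintegral_ofReal ib]
        refine (ae_restrict_iff' measurableSet_Ioi).2 (Filter.Eventually.of_forall fun β hβ => ?_)
        exact (integral_nonneg fun z => abs_nonneg _).trans (hpt β hβ)
    _ ≤ _ := ENNReal.ofReal_le_ofReal vb

/-- pointwise comparison -/
lemma V_sub (hφ : Continuous φ) (hφn : ∀ x, ‖φ x‖ = 1) (hn : 0 < n) (hm : 0 < m)
    (p q : Measure (EuclideanSpace ℝ (Fin d))) [IsProbabilityMeasure p] [IsProbabilityMeasure q]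
    {α : ℝ} (hα : 0 < α) (hα1 : α ≤ 1) {v v0 : ℝ} (hv0 : IsKKLa φ α p q v0)
    (z : Fin n ⊕ Fin m → EuclideanSpace ℝ (Fin d))
    (hv : IsKKLa φ α (empMeas fun i => z (Sum.inl i)) (empMeas fun i => z (Sum.inr i)) v) :
    ENNReal.ofReal |v - v0| ≤ (∫⁻ β in Set.Ioi (0:ℝ), ENNReal.ofReal |Dh φ α β z - D0 φ p q α β|)
      + ∫⁻ β in Set.Ioi (0:ℝ), ENNReal.ofReal |Dh φ 1 β z - D0 φ p q 1 β| := by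
  have := emp_prob hn (fun i => z (Sum.inl i))
  have := emp_prob hm (fun i => z (Sum.inr i))
  obtain ⟨i1, e1, -, -⟩ := kkl_link hφ hφn hα hα1 _ _ hv
  obtain ⟨i0, e0, -, -⟩ := kkl_link hφ hφn hα hα1 _ _ hv0
  have hmm : AEMeasurable (fun β => ENNReal.ofReal |Dh φ α β z - D0 φ p q α β|)
      (volume.restrict (Set.Ioi 0)) := by
    have h1 := (meas_D0 hφ hφn (empMeas fun i => z (Sum.inl i)) (empMeas fun i => z (Sum.inr i))
      hα hα1).aemeasurable
    have h2 := (meas_D0 hφ hφn p q hα hα1).aemeasurable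
    have h1' : AEMeasurable (fun β => Dh φ α β z) (volume.restrict (Set.Ioi 0)) :=
      h1.congr (Filter.Eventually.of_forall fun β => D0_emp α β z)
    exact ((continuous_abs.measurable.comp_aemeasurable (h1'.sub h2))).ennreal_ofReal
  rw [e1, e0, ← integral_sub i1 i0, ← lintegral_add_left' hmm, ← Real.enorm_eq_ofReal_abs]
  refine (enorm_integral_le_lintegral_enorm _).trans (lintegral_mono fun β => ?_)
  rw [Real.enorm_eq_ofReal_abs, ← ENNReal.ofReal_add (abs_nonneg _) (abs_nonneg _),
    Gf_pop, Gf_pop, D0_emp, D0_emp]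
  refine ENNReal.ofReal_le_ofReal ?_
  have e : Dh φ α β z - Dh φ 1 β z - (D0 φ p q α β - D0 φ p q 1 β)
      = (Dh φ α β z - D0 φ p q α β) - (Dh φ 1 β z - D0 φ p q 1 β) := by ring
  rw [e]
  exact abs_sub _ _

end fin2

end KKLp

/-- **Finite-sample concentration of the regularized kernel KL divergence.**
If `p ≪ q` with `dp/dq ≤ 1/μ`, `0 < μ ≤ 1`, `0 < α ≤ 1/2`, and
`c = ∫₀^∞ sup_x ⟪φ(x), (Σ_p + βI)⁻¹ φ(x)⟫² dβ < ∞`, then for empirical measures on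
`n` i.i.d. samples of `p` and `m` i.i.d. samples of `q`,
`E|KKL_α(p̂‖q̂) - KKL_α(p‖q)| ≤ (35/√(m∧n)) (1/(αμ)) (2√c + log n)
  + (1/(m∧n)) (1 + 1/μ + (c(24 log n)²/(αμ²))(1 + n/(m∧n)))`. -/
theorem kkl_alpha_empirical_bound {d n m : ℕ} (hn : 0 < n) (hm : 0 < m)
    {H : Type u} [NormedAddCommGroup H] [InnerProductSpace ℝ H] [CompleteSpace H]
    (k : EuclideanSpace ℝ (Fin d) → EuclideanSpace ℝ (Fin d) → ℝ)
    (φ : EuclideanSpace ℝ (Fin d) → H) (hφc : Continuous φ)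
    (hk : ∀ x y, k x y = ⟪φ x, φ y⟫) (hk1 : ∀ x, k x x = 1)
    (p q : Measure (EuclideanSpace ℝ (Fin d)))
    [IsProbabilityMeasure p] [IsProbabilityMeasure q]
    (μ α : ℝ) (hμ : 0 < μ) (hμ1 : μ ≤ 1) (hα : 0 < α) (hα2 : α ≤ 1 / 2)
    (hpq : p ≪ q) (hratio : ∀ᵐ x ∂q, p.rnDeriv q x ≤ ENNReal.ofReal (1 / μ))
    (Rp : ℝ → H →L[ℝ] H)
    (hRp : ∀ β > (0 : ℝ), Rp β ∘L (covOp φ p + β • 1) = 1 ∧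
      (covOp φ p + β • 1) ∘L Rp β = 1)
    (c : ℝ)
    (hc : c = ∫ β in Set.Ioi (0 : ℝ),
      (⨆ x : EuclideanSpace ℝ (Fin d), ⟪φ x, Rp β (φ x)⟫) ^ 2)
    (hcfin : IntegrableOn
      (fun β => (⨆ x : EuclideanSpace ℝ (Fin d), ⟪φ x, Rp β (φ x)⟫) ^ 2)
      (Set.Ioi (0 : ℝ)))
    (vpop : ℝ) (hvpop : IsKKLa φ α p q vpop)
    (V : (Fin n → EuclideanSpace ℝ (Fin d)) → (Fin m → EuclideanSpace ℝ (Fin d)) → ℝ)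
    (hV : ∀ xs ys, IsKKLa φ α (empMeas xs) (empMeas ys) (V xs ys)) :
    ∫⁻ ω : (Fin n → EuclideanSpace ℝ (Fin d)) × (Fin m → EuclideanSpace ℝ (Fin d)),
        ENNReal.ofReal |V ω.1 ω.2 - vpop|
        ∂((Measure.pi fun _ : Fin n => p).prod (Measure.pi fun _ : Fin m => q))
      ≤ ENNReal.ofReal
          (35 / Real.sqrt (min m n : ℕ) * (1 / (α * μ)) * (2 * Real.sqrt c + Real.log n)
            + (1 / (min m n : ℕ))
              * (1 + 1 / μ + c * (24 * Real.log n) ^ 2 / (α * μ ^ 2)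
                  * (1 + (n : ℝ) / (min m n : ℕ)))) := by
  have hφn : ∀ x, ‖φ x‖ = 1 := fun x => by
    have h := hk1 x
    rw [hk, real_inner_self_eq_norm_sq] at h
    nlinarith [norm_nonneg (φ x)]
  have hα1 : α ≤ 1 := by linarith
  have hs : ∀ β ∈ Set.Ioi (0:ℝ), (⨆ x : EuclideanSpace ℝ (Fin d), ⟪φ x, Rp β (φ x)⟫) ^ 2
      = KKLp.sS φ p β ^ 2 := fun β hβ => by
    rw [KKLp.sS, KKLp.res_eq (KKLp.covOp_pos hφc hφn p) hβ (hRp β hβ).1]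
  have hi : IntegrableOn (fun β => KKLp.sS φ p β ^ 2) (Set.Ioi 0) :=
    hcfin.congr_fun hs measurableSet_Ioi
  have hc' : ∫ β in Set.Ioi 0, KKLp.sS φ p β ^ 2 = c := by
    rw [hc]; exact (setIntegral_congr_fun measurableSet_Ioi hs).symm
  have hc4 : 1 / 4 ≤ c := by rw [← hc']; exact KKLp.c_ge hφc hφn p hi
  have hN : (0:ℝ) < (min m n : ℕ) := by exact_mod_cast lt_min hm hn
  have hsN : 0 < Real.sqrt (min m n : ℕ) := Real.sqrt_pos.2 hN
  have hlog : 0 ≤ Real.log n := Real.log_natCast_nonneg n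
  have hsc : 0 ≤ Real.sqrt c := Real.sqrt_nonneg c
  have hαμ : 0 < 1 / (α * μ) := by positivity
  -- the target dominates `70 √c/√N /(αμ)`
  have htarget : 70 * (Real.sqrt c / Real.sqrt (min m n : ℕ)) * (1 / (α * μ)) ≤
      35 / Real.sqrt (min m n : ℕ) * (1 / (α * μ)) * (2 * Real.sqrt c + Real.log n)
            + (1 / (min m n : ℕ))
              * (1 + 1 / μ + c * (24 * Real.log n) ^ 2 / (α * μ ^ 2)
                  * (1 + (n : ℝ) / (min m n : ℕ))) := by
    have h1 : 0 ≤ (1 / ((min m n : ℕ) : ℝ))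
              * (1 + 1 / μ + c * (24 * Real.log n) ^ 2 / (α * μ ^ 2)
                  * (1 + (n : ℝ) / (min m n : ℕ))) := by
      have : 0 ≤ c := by linarith
      positivity
    have h2 : 0 ≤ 35 / Real.sqrt (min m n : ℕ) * (1 / (α * μ)) * Real.log n := by positivity
    have h3 : 35 / Real.sqrt (min m n : ℕ) * (1 / (α * μ)) * (2 * Real.sqrt c + Real.log n)
        = 70 * (Real.sqrt c / Real.sqrt (min m n : ℕ)) * (1 / (α * μ))
          + 35 / Real.sqrt (min m n : ℕ) * (1 / (α * μ)) * Real.log n := by ring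
    linarith
  refine le_trans ?_ (ENNReal.ofReal_le_ofReal htarget)
  rcases le_or_gt (Real.sqrt c / Real.sqrt (min m n : ℕ)) (1 / 70) with hx | hx
  · have hmp := measurePreserving_sumPiEquivProdPi (KKLp.PP n m p q)
    have hmp' : MeasurePreserving (MeasurableEquiv.sumPiEquivProdPi
        (fun _ : Fin n ⊕ Fin m => EuclideanSpace ℝ (Fin d)))
        (Measure.pi (KKLp.PP n m p q))
        ((Measure.pi fun _ : Fin n => p).prod (Measure.pi fun _ : Fin m => q)) := hmp
    rw [← hmp'.lintegral_comp_emb (MeasurableEquiv.measurableEmbedding _)]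
    obtain ⟨ι, f, lam, -, -, hf, hl, -⟩ := id hvpop
    have c1 := KKLp.contrib (n := n) (m := m) hφc hφn hn hm p q f lam hf hl hα hα1 hμ hμ1
      (KKLp.mix_mu hφc hφn p q hα hα1 hμ hμ1 hpq hratio) hx hi hc'
    have c2 := KKLp.contrib (n := n) (m := m) hφc hφn hn hm p q f lam hf hl one_pos le_rfl one_pos
      le_rfl (fun u => by rw [KKLp.mix_one, one_mul]) hx hi hc'
    have hmeas : AEMeasurable (fun z : Fin n ⊕ Fin m → EuclideanSpace ℝ (Fin d) =>
        ∫⁻ β in Set.Ioi (0:ℝ), ENNReal.ofReal |KKLp.Dh φ α β z - KKLp.D0 φ p q α β|)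
        (Measure.pi (KKLp.PP n m p q)) := by
      have h1 := (KKLp.meas_Dh (n := n) (m := m) hφc hα.le hα1
        (Measure.pi (KKLp.PP n m p q))).aemeasurable
      have h2 : AEMeasurable (fun w : (Fin n ⊕ Fin m → EuclideanSpace ℝ (Fin d)) × ℝ =>
        KKLp.D0 φ p q α w.2) ((Measure.pi (KKLp.PP n m p q)).prod (volume.restrict (Set.Ioi 0))) :=
        ((KKLp.meas_D0 hφc hφn p q hα hα1).comp_snd).aemeasurable
      exact (((continuous_abs.measurable.comp_aemeasurable
        (h1.sub h2))).ennreal_ofReal).lintegral_prod_right'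
    calc _ ≤ ∫⁻ z, ((∫⁻ β in Set.Ioi (0:ℝ), ENNReal.ofReal |KKLp.Dh φ α β z - KKLp.D0 φ p q α β|)
          + ∫⁻ β in Set.Ioi (0:ℝ), ENNReal.ofReal |KKLp.Dh φ 1 β z - KKLp.D0 φ p q 1 β|)
          ∂(Measure.pi (KKLp.PP n m p q)) :=
          lintegral_mono fun z => KKLp.V_sub hφc hφn hn hm p q hα hα1 hvpop z (hV _ _)
      _ ≤ _ := by
          rw [lintegral_add_left' hmeas]
          refine (add_le_add c1 c2).trans ?_
          rw [← ENNReal.ofReal_add (by positivity) (by positivity)]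
          refine ENNReal.ofReal_le_ofReal ?_
          have h1 : (1:ℝ) / (1 * 1) ≤ 1 / (α * μ) := by
            rw [div_le_div_iff₀ (by norm_num) (by positivity)]; nlinarith
          have h0 : 0 ≤ Real.sqrt c / Real.sqrt (min m n : ℕ) := by positivity
          have h2 := mul_le_mul_of_nonneg_left h1 h0
          have h3 := mul_nonneg h0 hαμ.le
          linarith
  · obtain ⟨-, -, v0, v1⟩ := KKLp.kkl_link hφc hφn hα hα1 p q hvpop
    have hb : ∀ ω : (Fin n → EuclideanSpace ℝ (Fin d)) × (Fin m → EuclideanSpace ℝ (Fin d)),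
        ENNReal.ofReal |V ω.1 ω.2 - vpop| ≤ ENNReal.ofReal
          (70 * (Real.sqrt c / Real.sqrt (min m n : ℕ)) * (1 / (α * μ))) := fun ω => by
      have := KKLp.emp_prob hn ω.1
      have := KKLp.emp_prob hm ω.2
      obtain ⟨-, -, w0, w1⟩ := KKLp.kkl_link hφc hφn hα hα1 _ _ (hV ω.1 ω.2)
      refine ENNReal.ofReal_le_ofReal ?_
      have h1 : |V ω.1 ω.2 - vpop| ≤ 1 / α := by rw [abs_le]; constructor <;> linarith
      have h2 : 1 / α ≤ 1 / (α * μ) := by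
        apply one_div_le_one_div_of_le (by positivity); nlinarith
      nlinarith
    calc _ ≤ ∫⁻ _ω : (Fin n → EuclideanSpace ℝ (Fin d)) × (Fin m → EuclideanSpace ℝ (Fin d)),
          ENNReal.ofReal (70 * (Real.sqrt c / Real.sqrt (min m n : ℕ)) * (1 / (α * μ)))
          ∂((Measure.pi fun _ : Fin n => p).prod (Measure.pi fun _ : Fin m => q)) :=
          lintegral_mono hb
      _ = _ := by simp
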